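/- Let {X_n} be a stationary memoryless source over a finite alphabet with marginal P_X, entropy H = E[ι_X(X)], varentropy σ² = Var(ι_X(X)) > 0, and third absolute central moment μ₃ = E[|ι_X(X) − H|³]. Then for all 0 < ε < 1/2 and all n > n₀ = (1/4)·(1 + μ₃/(2σ³))² / ( φ(Q^{−1}(ε))·Q^{−1}(ε) )², the best achievable rate satisfies R*(n,ε) ≥ H + (σ/√n)·Q^{−1}(ε) − (log₂ n)/(2n) − ( μ₃/2 + σ³ ) / ( n·σ²·φ(Q^{−1}(ε)) ), where φ is the standard Gaussian density and Q the standard Gaussian tail function. -/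

import Mathlib

open scoped BigOperators
open MeasureTheory

/-- Probability of an event under a probability mass function. -/
noncomputable def prob {α : Type*} (P : α → ℝ) (s : Set α) : ℝ := ∑' x, s.indicator P x

/-- `R*(n,ε)`: the smallest rate `R` such that some injective compressor satisfies
`P[ℓ(f(X^n)) > nR] ≤ ε`. -/
noncomputable def RStar {α : Type*} (P : α → ℝ) (n : ℕ) (ε : ℝ) : ℝ :=
  sInf {R : ℝ | ∃ f : α → List Bool, Function.Injective f ∧
    prob P {x | (n : ℝ) * R < ((f x).length : ℝ)} ≤ ε}

/-- Product pmf of `n` i.i.d. letters with marginal `P`. -/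
noncomputable def iidPn {𝒜 : Type*} [Fintype 𝒜] (P : 𝒜 → ℝ) (n : ℕ)
    (x : Fin n → 𝒜) : ℝ := ∏ i, P (x i)

/-- Entropy (in bits) of the marginal `P`. -/
noncomputable def entBits {𝒜 : Type*} [Fintype 𝒜] (P : 𝒜 → ℝ) : ℝ :=
  ∑ a, P a * Real.logb 2 (1 / P a)

/-- Varentropy `σ² = Var(ι_X(X))` of the marginal `P` (in bits²). -/
noncomputable def varent {𝒜 : Type*} [Fintype 𝒜] (P : 𝒜 → ℝ) : ℝ :=
  ∑ a, P a * (Real.logb 2 (1 / P a) - entBits P) ^ 2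

/-- Third absolute central moment `μ₃ = E[|ι_X(X) − H|³]` of the information. -/
noncomputable def mu3 {𝒜 : Type*} [Fintype 𝒜] (P : 𝒜 → ℝ) : ℝ :=
  ∑ a, P a * |Real.logb 2 (1 / P a) - entBits P| ^ 3

/-- The standard Gaussian density `φ`. -/
noncomputable def gaussPdf (x : ℝ) : ℝ := Real.exp (-(x ^ 2) / 2) / Real.sqrt (2 * Real.pi)

/-- The standard Gaussian tail function `Q(x) = ∫_x^∞ φ(t) dt`. -/
noncomputable def gaussQ (x : ℝ) : ℝ := ∫ t in Set.Ioi x, gaussPdf t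

/-- The inverse of the Gaussian tail function `Q`. -/
noncomputable def gaussQinv (ε : ℝ) : ℝ := Function.invFun gaussQ ε

section
open Real MeasureTheory Filter Topology Set

lemma two_mul_one_sub_le_sin {u : ℝ} (h0 : 0 ≤ u) (h1 : u ≤ 1) :
    2 * u * (1 - u) ≤ sin (π * u) := by
  have hp := pi_pos
  rcases le_total u (1 / 2) with h | h
  · have := mul_le_sin (x := π * u) (by positivity) (by nlinarith)
    have e : 2 / π * (π * u) = 2 * u := by field_simp
    rw [e] at this
    nlinarith
  · have := mul_le_sin (x := π * (1 - u)) (mul_nonneg hp.le (by linarith)) (by nlinarith)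
    have e : 2 / π * (π * (1 - u)) = 2 * (1 - u) := by field_simp
    have e2 : sin (π * (1 - u)) = sin (π * u) := by
      rw [show π * (1 - u) = π - π * u by ring, sin_pi_sub]
    rw [e, e2] at this
    nlinarith

lemma sin_pi_mul_pos {u : ℝ} (hu : u ∈ Ioo (0 : ℝ) 1) : 0 < sin (π * u) :=
  lt_of_lt_of_le (by have := hu.1; have := hu.2; nlinarith [mul_pos hu.1 (sub_pos.2 hu.2)])
    (two_mul_one_sub_le_sin hu.1.le hu.2.le)

/-- Bounded measurable functions on the unit interval are interval integrable. -/
lemma intervalIntegrable_of_bound_Ioo {f : ℝ → ℝ} (hf : Measurable f) {C : ℝ}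
    (h : ∀ u ∈ Ioo (0 : ℝ) 1, |f u| ≤ C) : IntervalIntegrable f volume 0 1 := by
  rw [intervalIntegrable_iff_integrableOn_Ioo_of_le zero_le_one]
  exact IntegrableOn.of_bound (by simp) hf.aestronglyMeasurable C
    ((ae_restrict_iff' measurableSet_Ioo).2 (Eventually.of_forall h))

lemma intervalIntegral_congr_Ioo {f g : ℝ → ℝ} (h : ∀ u ∈ Ioo (0 : ℝ) 1, f u = g u) :
    ∫ u in (0 : ℝ)..1, f u = ∫ u in (0 : ℝ)..1, g u := by
  rw [intervalIntegral.integral_of_le zero_le_one, intervalIntegral.integral_of_le zero_le_one,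
    integral_Ioc_eq_integral_Ioo, integral_Ioc_eq_integral_Ioo]
  exact setIntegral_congr_fun measurableSet_Ioo h

lemma abs_one_sub_mul_div_sin_le {h : ℝ} {C u : ℝ} (hu : u ∈ Ioo (0 : ℝ) 1)
    (hb : |h| ≤ C * u) : |(1 - u) * h / sin (π * u)| ≤ C / 2 := by
  have hs := sin_pi_mul_pos hu
  have hl := two_mul_one_sub_le_sin hu.1.le hu.2.le
  have h1 : 0 < 1 - u := sub_pos.2 hu.2
  have hC : 0 ≤ C := by
    by_contra hC
    have := abs_nonneg h
    nlinarith [hu.1]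
  rw [abs_div, abs_mul, abs_of_pos hs, abs_of_pos h1, div_le_iff₀ hs]
  nlinarith

lemma intervalIntegrable_div_sin {h : ℝ → ℝ} (hc : Continuous h) {C : ℝ}
    (hb : ∀ u ∈ Ioo (0 : ℝ) 1, |h u| ≤ C * u) :
    IntervalIntegrable (fun u => (1 - u) * h u / sin (π * u)) volume 0 1 := by
  refine intervalIntegrable_of_bound_Ioo (C := C / 2) ?_ fun u hu =>
    abs_one_sub_mul_div_sin_le hu (hb u hu)
  have := hc.measurable
  fun_prop

lemma abs_sin_mul_le (a u : ℝ) (hu : 0 ≤ u) : |sin (a * u)| ≤ |a| * u := by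
  have := abs_sin_le_abs (x := a * u)
  rwa [abs_mul, abs_of_nonneg hu] at this

/-- `∫₀¹ (1-u) sin((2x-1)πu)/sin(πu) du`. -/
noncomputable def fejerRatio (x : ℝ) : ℝ :=
  ∫ u in (0 : ℝ)..1, (1 - u) * sin ((2 * x - 1) * π * u) / sin (π * u)

lemma intervalIntegrable_fejerRatio (x : ℝ) : IntervalIntegrable
    (fun u => (1 - u) * sin ((2 * x - 1) * π * u) / sin (π * u)) volume 0 1 :=
  intervalIntegrable_div_sin (by fun_prop) (C := |(2 * x - 1) * π|)
    fun u hu => abs_sin_mul_le _ _ hu.1.le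

lemma integral_one_sub_mul_cos {a : ℝ} (ha : a ≠ 0) :
    ∫ u in (0 : ℝ)..1, (1 - u) * cos (a * u) = (1 - cos a) / a ^ 2 := by
  have h : ∀ u ∈ uIcc (0 : ℝ) 1, HasDerivAt
      (fun u => (1 - u) * sin (a * u) / a - cos (a * u) / a ^ 2) ((1 - u) * cos (a * u)) u := by
    intro u _
    have hl : HasDerivAt (fun u : ℝ => a * u) a u := by simpa using (hasDerivAt_id u).const_mul a
    have h1 : HasDerivAt (fun u : ℝ => 1 - u) (-1) u := by
      simpa using (hasDerivAt_id u).const_sub 1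
    convert! ((h1.mul hl.sin).div_const a).sub (hl.cos.div_const (a ^ 2)) using 1
    field_simp
    ring
  rw [intervalIntegral.integral_eq_sub_of_hasDerivAt h
    (Continuous.intervalIntegrable (by fun_prop) _ _)]
  simp
  field_simp
  ring

lemma integral_sin_mul {a : ℝ} (ha : a ≠ 0) :
    ∫ u in (0 : ℝ)..1, sin (a * u) = (1 - cos a) / a := by
  rw [intervalIntegral.integral_comp_mul_left (fun x => sin x) ha]
  simp [integral_sin]
  field_simp

lemma fejerRatio_add_one (x : ℝ) : fejerRatio (x + 1) - fejerRatio x =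
    2 * ∫ u in (0 : ℝ)..1, (1 - u) * cos (2 * π * x * u) := by
  unfold fejerRatio
  rw [← intervalIntegral.integral_sub (intervalIntegrable_fejerRatio _)
    (intervalIntegrable_fejerRatio _), ← intervalIntegral.integral_const_mul]
  refine intervalIntegral_congr_Ioo fun u hu => ?_
  have hs := (sin_pi_mul_pos hu).ne'
  rw [show (2 * (x + 1) - 1) * π * u = 2 * π * x * u + π * u by ring,
    show (2 * x - 1) * π * u = 2 * π * x * u - π * u by ring, sin_add, sin_sub,
    div_sub_div_same, div_eq_iff hs]
  ring

lemma fejerRatio_add_one' {x : ℝ} (hx : 0 < x) : fejerRatio (x + 1) =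
    fejerRatio x + sin (π * x) ^ 2 / π ^ 2 / x ^ 2 := by
  have hp := pi_pos
  have h := fejerRatio_add_one x
  rw [integral_one_sub_mul_cos (by positivity)] at h
  have h2 : cos (2 * π * x) = 1 - 2 * sin (π * x) ^ 2 := by
    rw [show 2 * π * x = 2 * (π * x) by ring, cos_two_mul, ← sin_sq_add_cos_sq (π * x)]
    nlinarith [sin_sq_add_cos_sq (π * x)]
  rw [h2] at h
  rw [sub_eq_iff_eq_add'.1 h]
  field_simp
  ring

lemma sin_pi_mul_nat_add_sq (x : ℝ) (N : ℕ) : sin (π * (x + N)) ^ 2 = sin (π * x) ^ 2 := by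
  rw [mul_add, mul_comm π (N : ℝ), sin_add_nat_mul_pi, mul_pow, ← pow_mul, mul_comm N 2,
    pow_mul]
  simp

lemma fejerRatio_add_nat {x : ℝ} (hx : 0 < x) (N : ℕ) : fejerRatio (x + N) =
    fejerRatio x + sin (π * x) ^ 2 / π ^ 2 * ∑ k ∈ Finset.range N, 1 / (x + k) ^ 2 := by
  induction N with
  | zero => simp
  | succ N ih =>
    have : (0 : ℝ) < x + N := by positivity
    rw [Nat.cast_succ, ← add_assoc, fejerRatio_add_one' this, ih, sin_pi_mul_nat_add_sq,
      Finset.sum_range_succ]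
    ring

lemma fejerRatio_nat_add_one (N : ℕ) : fejerRatio (1 + N) = 1 / 2 := by
  rw [fejerRatio_add_nat one_pos]
  simp only [mul_one, sin_pi]
  rw [fejerRatio, intervalIntegral_congr_Ioo (g := fun u => 1 - u)]
  · rw [intervalIntegral.integral_sub (by simp) (by simp)]
    simp
    norm_num
  · intro u hu
    have hs := (sin_pi_mul_pos hu).ne'
    rw [show (2 * 1 - 1 : ℝ) * π * u = π * u by ring, mul_div_cancel_right₀ _ hs]

/-- Riemann–Lebesgue on the unit interval. -/
lemma tendsto_integral_mul_cos {g : ℝ → ℝ} (hg : IntervalIntegrable g volume 0 1) (x : ℝ) :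
    Tendsto (fun N : ℕ => ∫ u in (0 : ℝ)..1, g u * cos (2 * π * (x + N) * u)) atTop (𝓝 0) := by
  rw [intervalIntegrable_iff_integrableOn_Ioc_of_le zero_le_one] at hg
  have h1 := Real.tendsto_integral_exp_smul_cocompact
    (fun u => (((Ioc (0 : ℝ) 1).indicator g u : ℝ) : ℂ))
  have h2 : Tendsto (fun N : ℕ => x + (N : ℝ)) atTop (cocompact ℝ) :=
    (tendsto_atTop_add_const_left _ x tendsto_natCast_atTop_atTop).mono_right
      atTop_le_cocompact
  have h3 := (Complex.continuous_re.tendsto _).comp (h1.comp h2)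
  rw [Complex.zero_re] at h3
  refine h3.congr fun N => ?_
  simp only [Function.comp]
  have hi : Integrable (fun v : ℝ => fourierChar (-(v * (x + N))) •
      (((Ioc (0 : ℝ) 1).indicator g v : ℝ) : ℂ)) := by
    have hf : Integrable (fun v : ℝ => (((Ioc (0 : ℝ) 1).indicator g v : ℝ) : ℂ)) :=
      (hg.integrable_indicator measurableSet_Ioc).ofReal
    refine hf.mono (AEStronglyMeasurable.smul (Continuous.aestronglyMeasurable ?_) hf.1)
      (Eventually.of_forall fun v => ?_)
    · fun_prop
    · rw [Circle.smul_def, norm_smul, Circle.norm_coe, one_mul]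
  rw [← RCLike.re_eq_complex_re, ← integral_re hi, intervalIntegral.integral_of_le zero_le_one,
    ← integral_indicator measurableSet_Ioc]
  congr 1
  ext u
  by_cases hu : u ∈ Ioc (0 : ℝ) 1
  · simp only [indicator_of_mem hu, RCLike.re_eq_complex_re, Circle.smul_def, fourierChar_apply,
      smul_eq_mul, Complex.re_mul_ofReal]
    rw [Complex.exp_ofReal_mul_I_re, mul_comm (g u), ← cos_neg]
    ring_nf
  · simp [indicator_of_notMem hu]

lemma tendsto_fejerRatio {x : ℝ} :
    Tendsto (fun N : ℕ => fejerRatio (x + N)) atTop (𝓝 (1 / 2)) := by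
  have hI : IntervalIntegrable (fun u => 2 * ((1 - u) * sin ((x - 1) * π * u) / sin (π * u)))
      volume 0 1 :=
    (intervalIntegrable_div_sin (by fun_prop) (C := |(x - 1) * π|)
      fun u hu => abs_sin_mul_le _ _ hu.1.le).const_mul 2
  have h := (tendsto_integral_mul_cos hI (x / 2)).const_add (1 / 2)
  rw [add_zero] at h
  refine h.congr fun N => ?_
  symm
  rw [← fejerRatio_nat_add_one N, ← sub_eq_iff_eq_add', fejerRatio, fejerRatio,
    ← intervalIntegral.integral_sub (intervalIntegrable_fejerRatio _)
    (intervalIntegrable_fejerRatio _)]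
  refine intervalIntegral_congr_Ioo fun u hu => ?_
  have e1 : (2 * (x + N) - 1) * π * u = 2 * π * (x / 2 + N) * u + (x - 1) * π * u := by ring
  have e2 : (2 * (1 + (N : ℝ)) - 1) * π * u = 2 * π * (x / 2 + N) * u - (x - 1) * π * u := by ring
  rw [e1, e2, sin_add, sin_sub]
  ring

/-- The Fejér kernel `(sin πx / πx)²`, with value `0` at `0`. -/
noncomputable def fejer (x : ℝ) : ℝ := sin (π * x) ^ 2 / π ^ 2 / x ^ 2

lemma fejer_nonneg (x : ℝ) : 0 ≤ fejer x := by unfold fejer; positivity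

lemma fejer_neg (x : ℝ) : fejer (-x) = fejer x := by simp [fejer]

lemma measurable_fejer : Measurable fejer := by unfold fejer; fun_prop

lemma fejer_le_one (x : ℝ) : fejer x ≤ 1 := by
  rcases eq_or_ne x 0 with rfl | hx
  · simp [fejer]
  · have h := abs_sin_le_abs (x := π * x)
    have h2 : sin (π * x) ^ 2 ≤ (π * x) ^ 2 := sq_le_sq.2 h
    unfold fejer
    rw [div_div, div_le_one (by positivity)]
    nlinarith

lemma measurable_fejerRatio : Measurable fejerRatio := by
  unfold fejerRatio
  simp_rw [intervalIntegral.integral_of_le zero_le_one]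
  refine (StronglyMeasurable.integral_prod_right (f := fun x u : ℝ =>
    (1 - u) * sin ((2 * x - 1) * π * u) / sin (π * u)) ?_).measurable
  apply Measurable.stronglyMeasurable
  unfold Function.uncurry
  fun_prop

lemma fejerRatio_one_sub (x : ℝ) : fejerRatio (1 - x) = - fejerRatio x := by
  unfold fejerRatio
  rw [← intervalIntegral.integral_neg]
  congr 1
  ext u
  rw [show (2 * (1 - x) - 1) * π * u = - ((2 * x - 1) * π * u) by ring, sin_neg]
  ring

lemma abs_fejerRatio_le {x : ℝ} (hx : x ∈ Icc (0 : ℝ) 1) : |fejerRatio x| ≤ π / 2 := by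
  unfold fejerRatio
  rw [intervalIntegral.integral_of_le zero_le_one, integral_Ioc_eq_integral_Ioo]
  refine (norm_setIntegral_le_of_norm_le_const (μ := volume) (s := Ioo (0 : ℝ) 1) (C := π / 2)
    (f := fun u => (1 - u) * sin ((2 * x - 1) * π * u) / sin (π * u)) (by simp) fun u hu =>
    abs_one_sub_mul_div_sin_le (C := π) hu ?_).trans (by simp)
  refine (abs_sin_mul_le _ _ hu.1.le).trans (mul_le_mul_of_nonneg_right ?_ hu.1.le)
  rw [abs_mul, abs_of_pos pi_pos]
  have : |2 * x - 1| ≤ 1 := abs_le.2 ⟨by linarith [hx.1], by linarith [hx.2]⟩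
  nlinarith [pi_pos]

lemma intervalIntegrable_fejerRatio_unit : IntervalIntegrable fejerRatio volume 0 1 :=
  intervalIntegrable_of_bound_Ioo measurable_fejerRatio
    fun _ hu => abs_fejerRatio_le (Ioo_subset_Icc_self hu)

lemma integral_fejerRatio_unit : ∫ x in (0 : ℝ)..1, fejerRatio x = 0 := by
  have h : ∫ x in (0 : ℝ)..1, fejerRatio (1 - x) = ∫ x in (0 : ℝ)..1, fejerRatio x := by
    rw [intervalIntegral.integral_comp_sub_left]
    simp
  simp_rw [fejerRatio_one_sub, intervalIntegral.integral_neg] at h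
  linarith

lemma fejer_add_nat (x : ℝ) (k : ℕ) :
    fejer (x + k) = sin (π * x) ^ 2 / π ^ 2 * (1 / (x + k) ^ 2) := by
  rw [fejer, sin_pi_mul_nat_add_sq]
  ring

lemma fejerRatio_le_half {x : ℝ} (hx : 0 < x) : fejerRatio x ≤ 1 / 2 := by
  refine ge_of_tendsto' (tendsto_fejerRatio (x := x)) fun N => ?_
  rw [fejerRatio_add_nat hx]
  have : 0 ≤ sin (π * x) ^ 2 / π ^ 2 * ∑ k ∈ Finset.range N, 1 / (x + k) ^ 2 :=
    mul_nonneg (by positivity) (Finset.sum_nonneg fun k _ => by positivity)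
  linarith

lemma intervalIntegrable_fejer (a b : ℝ) : IntervalIntegrable fejer volume a b := by
  rw [intervalIntegrable_iff]
  refine IntegrableOn.of_bound (by simp) measurable_fejer.aestronglyMeasurable 1
    (Eventually.of_forall fun x => ?_)
  rw [norm_of_nonneg (fejer_nonneg x)]
  exact fejer_le_one x

lemma integral_fejer_nat_le (N : ℕ) : ∫ x in (0 : ℝ)..N, fejer x ≤ 1 / 2 := by
  have h := intervalIntegral.sum_integral_adjacent_intervals (f := fejer) (μ := volume)
    (a := fun k : ℕ => (k : ℝ)) (n := N) fun k _ => intervalIntegrable_fejer _ _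
  rw [Nat.cast_zero] at h
  rw [← h]
  have h2 : ∀ k : ℕ, ∫ x in (k : ℝ)..(k + 1 : ℕ), fejer x =
      ∫ x in (0 : ℝ)..1, fejer (x + k) := by
    intro k
    rw [intervalIntegral.integral_comp_add_right]
    simp [add_comm]
  have hk : ∀ k : ℕ, IntervalIntegrable (fun x => fejer (x + k)) volume 0 1 := fun k =>
    intervalIntegrable_of_bound_Ioo (C := 1) (measurable_fejer.comp (measurable_add_const _))
      fun u _ => by rw [abs_of_nonneg (fejer_nonneg _)]; exact fejer_le_one _
  simp_rw [h2]
  rw [← intervalIntegral.integral_finsetSum fun k _ => hk k]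
  calc ∫ x in (0 : ℝ)..1, ∑ k ∈ Finset.range N, fejer (x + k)
      ≤ ∫ x in (0 : ℝ)..1, (1 / 2 - fejerRatio x) := by
        refine intervalIntegral.integral_mono_on_of_le_Ioo zero_le_one
          (by
            convert! IntervalIntegrable.sum (Finset.range N) fun k _ => hk k using 1
            ext x
            simp)
          ((by simp : IntervalIntegrable (fun _ => (1 / 2 : ℝ)) volume 0 1).sub
            intervalIntegrable_fejerRatio_unit) fun x hx => ?_
        have h3 := fejerRatio_le_half (x := x + N) (by have := hx.1; positivity)
        rw [fejerRatio_add_nat hx.1] at h3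
        simp_rw [fejer_add_nat, ← Finset.mul_sum]
        linarith
    _ = 1 / 2 := by
        rw [intervalIntegral.integral_sub (by simp) intervalIntegrable_fejerRatio_unit,
          integral_fejerRatio_unit]
        simp

lemma integrableOn_fejer : IntegrableOn fejer (Ioi 0) := by
  refine integrableOn_Ioi_of_intervalIntegral_norm_bounded (1 / 2) 0
    (fun N : ℕ => (intervalIntegrable_iff_integrableOn_Ioc_of_le (Nat.cast_nonneg N)).1
      (intervalIntegrable_fejer 0 N)) tendsto_natCast_atTop_atTop
    (Eventually.of_forall fun N => ?_)
  simp_rw [norm_of_nonneg (fejer_nonneg _)]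
  exact integral_fejer_nat_le N

lemma integral_fejer_le : ∫ x in Ioi (0 : ℝ), fejer x ≤ 1 / 2 :=
  le_of_tendsto' (intervalIntegral_tendsto_integral_Ioi 0 integrableOn_fejer
    tendsto_natCast_atTop_atTop) integral_fejer_nat_le

lemma sum_inv_sq_ge {x : ℝ} (hx : 0 < x) (N : ℕ) :
    1 / x - 1 / (x + N) ≤ ∑ k ∈ Finset.range N, 1 / (x + k) ^ 2 := by
  induction N with
  | zero => simp
  | succ N ih =>
    rw [Finset.sum_range_succ, Nat.cast_succ]
    have h : (0 : ℝ) < x + N := by positivity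
    have : 1 / (x + N) - 1 / (x + (N + 1)) ≤ 1 / (x + N) ^ 2 := by
      rw [div_sub_div _ _ h.ne' (by positivity), div_le_div_iff₀ (by positivity) (by positivity)]
      nlinarith
    linarith

lemma sum_inv_sq_le {x : ℝ} (hx : 0 < x) (N : ℕ) :
    ∑ k ∈ Finset.range (N + 1), 1 / (x + k) ^ 2 ≤ 1 / x + 1 / x ^ 2 - 1 / (x + N) := by
  induction N with
  | zero => simp
  | succ N ih =>
    rw [Finset.sum_range_succ, Nat.cast_succ]
    have h : (0 : ℝ) < x + N := by positivity
    have : 1 / (x + (N + 1)) ^ 2 ≤ 1 / (x + N) - 1 / (x + (N + 1)) := by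
      rw [div_sub_div _ _ h.ne' (by positivity), div_le_div_iff₀ (by positivity) (by positivity)]
      nlinarith
    linarith

lemma half_sub_fejerRatio_ge {x : ℝ} (hx : 0 < x) :
    sin (π * x) ^ 2 / π ^ 2 / x ≤ 1 / 2 - fejerRatio x := by
  have h1 : Tendsto (fun N : ℕ => fejerRatio (x + N) - fejerRatio x) atTop
      (𝓝 (1 / 2 - fejerRatio x)) := tendsto_fejerRatio.sub_const _
  have h2 : Tendsto (fun N : ℕ => sin (π * x) ^ 2 / π ^ 2 * (1 / x - 1 / (x + (N : ℝ)))) atTop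
      (𝓝 (sin (π * x) ^ 2 / π ^ 2 * (1 / x - 0))) := by
    refine Tendsto.const_mul _ (Tendsto.const_sub _ ?_)
    simp_rw [one_div]
    exact tendsto_inv_atTop_zero.comp
      (tendsto_atTop_add_const_left _ x tendsto_natCast_atTop_atTop)
  rw [sub_zero, mul_one_div] at h2
  refine le_of_tendsto_of_tendsto' h2 h1 fun N => ?_
  rw [fejerRatio_add_nat hx, add_sub_cancel_left]
  exact mul_le_mul_of_nonneg_left (sum_inv_sq_ge hx N) (by positivity)

lemma half_sub_fejerRatio_le {x : ℝ} (hx : 0 < x) :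
    1 / 2 - fejerRatio x ≤ sin (π * x) ^ 2 / π ^ 2 / x + fejer x := by
  have h1 : Tendsto (fun N : ℕ => fejerRatio (x + N) - fejerRatio x) atTop
      (𝓝 (1 / 2 - fejerRatio x)) := tendsto_fejerRatio.sub_const _
  refine le_of_tendsto' h1 fun N => ?_
  rw [fejerRatio_add_nat hx, add_sub_cancel_left]
  have h3 : ∑ k ∈ Finset.range N, 1 / (x + k) ^ 2 ≤ 1 / x + 1 / x ^ 2 := by
    have h4 := sum_inv_sq_le hx N
    rw [Finset.sum_range_succ] at h4
    have h5 : (0 : ℝ) ≤ 1 / (x + N) := by positivity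
    have h6 : (0 : ℝ) ≤ 1 / (x + N) ^ 2 := by positivity
    linarith
  calc _ ≤ sin (π * x) ^ 2 / π ^ 2 * (1 / x + 1 / x ^ 2) :=
        mul_le_mul_of_nonneg_left h3 (by positivity)
    _ = _ := by unfold fejer; ring

/-- The sine coefficient of Prawitz's smoothed indicator. -/
noncomputable def prawitz (u : ℝ) : ℝ := (1 - u) * (cos (π * u) / sin (π * u)) + 1 / π

/-- Prawitz's band-limited majorant of the indicator of `[0,∞)`. -/
noncomputable def smoothInd (z : ℝ) : ℝ :=
  1 / 2 + ∫ u in (0 : ℝ)..1, ((1 - u) * cos (2 * π * z * u) + prawitz u * sin (2 * π * z * u))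

lemma measurable_prawitz : Measurable prawitz := by unfold prawitz; fun_prop

lemma abs_prawitz_mul_sin_le {u : ℝ} (hu : u ∈ Ioo (0 : ℝ) 1) (a : ℝ) :
    |prawitz u * sin (a * u)| ≤ |a| := by
  have hb := abs_sin_mul_le a u hu.1.le
  have h1 : |(1 - u) * (cos (π * u) * sin (a * u)) / sin (π * u)| ≤ |a| / 2 :=
    abs_one_sub_mul_div_sin_le hu (by
      rw [abs_mul]
      nlinarith [abs_cos_le_one (π * u), abs_nonneg (sin (a * u)), abs_nonneg (cos (π * u))])
  have h2 : |1 / π * sin (a * u)| ≤ |a| / 2 := by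
    rw [abs_mul, abs_of_pos (by positivity), one_div, inv_mul_le_iff₀ pi_pos]
    nlinarith [pi_gt_three, abs_nonneg a, hu.2]
  have e : prawitz u * sin (a * u) = (1 - u) * (cos (π * u) * sin (a * u)) / sin (π * u) +
      1 / π * sin (a * u) := by unfold prawitz; ring
  rw [e]
  linarith [abs_add_le ((1 - u) * (cos (π * u) * sin (a * u)) / sin (π * u))
    (1 / π * sin (a * u))]

lemma intervalIntegrable_prawitz_sin (a : ℝ) :
    IntervalIntegrable (fun u => prawitz u * sin (a * u)) volume 0 1 :=
  intervalIntegrable_of_bound_Ioo (by have := measurable_prawitz; fun_prop)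
    fun _ hu => abs_prawitz_mul_sin_le hu a

lemma intervalIntegrable_one_sub_cos (a : ℝ) :
    IntervalIntegrable (fun u : ℝ => (1 - u) * cos (a * u)) volume 0 1 :=
  Continuous.intervalIntegrable (by fun_prop) _ _

lemma smoothInd_add_neg {z : ℝ} (hz : z ≠ 0) : smoothInd z + smoothInd (-z) = 1 + fejer z := by
  have hp := pi_pos
  unfold smoothInd
  rw [intervalIntegral.integral_add (intervalIntegrable_one_sub_cos _)
    (intervalIntegrable_prawitz_sin _), intervalIntegral.integral_add
    (intervalIntegrable_one_sub_cos _) (intervalIntegrable_prawitz_sin _),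
    integral_one_sub_mul_cos (by positivity), integral_one_sub_mul_cos
      (mul_ne_zero (by positivity) (neg_ne_zero.2 hz))]
  have e : ∫ u in (0 : ℝ)..1, prawitz u * sin (2 * π * (-z) * u) =
      - ∫ u in (0 : ℝ)..1, prawitz u * sin (2 * π * z * u) := by
    rw [← intervalIntegral.integral_neg]
    congr 1
    ext u
    rw [show 2 * π * (-z) * u = - (2 * π * z * u) by ring, sin_neg]
    ring
  have h2 : cos (2 * π * z) = 1 - 2 * sin (π * z) ^ 2 := by
    rw [show 2 * π * z = 2 * (π * z) by ring, cos_two_mul]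
    nlinarith [sin_sq_add_cos_sq (π * z)]
  rw [e, show 2 * π * -z = -(2 * π * z) by ring, cos_neg, h2, fejer]
  field_simp
  ring

lemma smoothInd_neg {x : ℝ} (hx : 0 < x) :
    smoothInd (-x) = 1 / 2 - fejerRatio x - sin (π * x) ^ 2 / π ^ 2 / x := by
  have hp := pi_pos
  have h1 : ∫ u in (0 : ℝ)..1, sin (2 * π * x * u) / π = 2 * (sin (π * x) ^ 2 / π ^ 2 / x) / 2 := by
    rw [intervalIntegral.integral_div, integral_sin_mul (by positivity)]
    have h2 : cos (2 * π * x) = 1 - 2 * sin (π * x) ^ 2 := by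
      rw [show 2 * π * x = 2 * (π * x) by ring, cos_two_mul]
      nlinarith [sin_sq_add_cos_sq (π * x)]
    rw [h2]
    field_simp
    ring
  have h3 : sin (π * x) ^ 2 / π ^ 2 / x = ∫ u in (0 : ℝ)..1, sin (2 * π * x * u) / π := by
    rw [h1]; ring
  rw [h3, smoothInd, fejerRatio, sub_sub, ← intervalIntegral.integral_add
    (intervalIntegrable_fejerRatio x) (Continuous.intervalIntegrable (by fun_prop) _ _),
    sub_eq_add_neg, ← intervalIntegral.integral_neg]
  congr 1
  refine intervalIntegral_congr_Ioo fun u hu => ?_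
  have hs := (sin_pi_mul_pos hu).ne'
  rw [show (2 * x - 1) * π * u = 2 * π * x * u - π * u by ring, sin_sub,
    show 2 * π * -x * u = - (2 * π * x * u) by ring, cos_neg, sin_neg, prawitz]
  have e : (1 - u) * cos (2 * π * x * u) =
      (1 - u) * (cos (2 * π * x * u) * sin (π * u)) / sin (π * u) := by
    rw [← mul_assoc, mul_div_cancel_right₀ _ hs]
  rw [e]
  ring

/-- The excess of the smoothed indicator over the indicator of `[0,∞)`. -/
noncomputable def smoothExc (z : ℝ) : ℝ := smoothInd z - (Ici (0 : ℝ)).indicator 1 z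

lemma smoothInd_zero : smoothInd 0 = 1 := by
  have : ∫ u in (0 : ℝ)..1, (1 - u) = 1 / 2 := by
    rw [intervalIntegral.integral_sub (by simp) (by simp)]
    simp
    norm_num
  simp [smoothInd, this]
  norm_num

lemma smoothExc_neg_nonneg {x : ℝ} (hx : 0 < x) : 0 ≤ smoothExc (-x) := by
  have := half_sub_fejerRatio_ge hx
  rw [smoothExc, smoothInd_neg hx, indicator_of_notMem (by simpa using hx)]
  linarith

lemma smoothExc_neg_le {x : ℝ} (hx : 0 < x) : smoothExc (-x) ≤ fejer x := by
  have := half_sub_fejerRatio_le hx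
  rw [smoothExc, smoothInd_neg hx, indicator_of_notMem (by simpa using hx)]
  linarith

lemma smoothExc_add_neg {x : ℝ} (hx : 0 < x) : smoothExc x + smoothExc (-x) = fejer x := by
  have := smoothInd_add_neg hx.ne'
  rw [smoothExc, smoothExc, indicator_of_notMem (by simpa using hx : -x ∉ Ici 0),
    indicator_of_mem (mem_Ici.2 hx.le), Pi.one_apply]
  linarith

lemma smoothExc_nonneg (z : ℝ) : 0 ≤ smoothExc z := by
  rcases lt_trichotomy z 0 with h | rfl | h
  · simpa using smoothExc_neg_nonneg (neg_pos.2 h)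
  · simp [smoothExc, smoothInd_zero]
  · have := smoothExc_add_neg h
    have := smoothExc_neg_le h
    linarith

lemma smoothExc_le {z : ℝ} (hz : z ≠ 0) : smoothExc z ≤ fejer z := by
  rcases lt_or_gt_of_ne hz with h | h
  · simpa [fejer_neg] using smoothExc_neg_le (neg_pos.2 h)
  · have := smoothExc_add_neg h
    have := smoothExc_neg_nonneg h
    linarith

lemma measurable_smoothInd : Measurable smoothInd := by
  unfold smoothInd
  simp_rw [intervalIntegral.integral_of_le zero_le_one]
  refine (StronglyMeasurable.integral_prod_right (f := fun z u : ℝ =>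
    (1 - u) * cos (2 * π * z * u) + prawitz u * sin (2 * π * z * u)) ?_).measurable.const_add _
  apply Measurable.stronglyMeasurable
  unfold Function.uncurry
  have := measurable_prawitz
  fun_prop

lemma measurable_smoothExc : Measurable smoothExc :=
  measurable_smoothInd.sub (measurable_one.indicator measurableSet_Ici)

lemma integrableOn_smoothExc_Ioi : IntegrableOn smoothExc (Ioi 0) := by
  refine Integrable.mono integrableOn_fejer measurable_smoothExc.aestronglyMeasurable
    ((ae_restrict_iff' measurableSet_Ioi).2 (Eventually.of_forall fun x hx => ?_))
  rw [norm_of_nonneg (smoothExc_nonneg x), norm_of_nonneg (fejer_nonneg x)]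
  exact smoothExc_le (ne_of_gt hx)

lemma integrableOn_smoothExc_neg : IntegrableOn (fun x => smoothExc (-x)) (Ioi 0) := by
  refine Integrable.mono integrableOn_fejer
    (measurable_smoothExc.comp measurable_neg).aestronglyMeasurable
    ((ae_restrict_iff' measurableSet_Ioi).2 (Eventually.of_forall fun x hx => ?_))
  rw [norm_of_nonneg (smoothExc_nonneg _), norm_of_nonneg (fejer_nonneg x)]
  exact smoothExc_neg_le hx

lemma integrable_smoothExc : Integrable smoothExc := by
  rw [← integrableOn_univ, ← Iic_union_Ioi (a := (0 : ℝ))]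
  refine IntegrableOn.union ?_ integrableOn_smoothExc_Ioi
  have h := (integrable_indicator_iff measurableSet_Ici).2
    ((integrableOn_Ici_iff_integrableOn_Ioi (μ := volume) (b := (0 : ℝ))
    (f := fun x => smoothExc (-x))).2 integrableOn_smoothExc_neg)
  rw [← integrable_indicator_iff measurableSet_Iic]
  convert! h.comp_neg using 1
  ext x
  simp [indicator]

lemma integral_smoothExc_le : ∫ z, smoothExc z ≤ 1 / 2 := by
  rw [← intervalIntegral.integral_Iic_add_Ioi integrable_smoothExc.integrableOn
    integrable_smoothExc.integrableOn (b := (0 : ℝ))]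
  have h : ∫ x in Iic (0 : ℝ), smoothExc x = ∫ x in Ioi (0 : ℝ), smoothExc (-x) := by
    rw [integral_comp_neg_Ioi, neg_zero]
  rw [h, ← integral_add integrableOn_smoothExc_neg integrableOn_smoothExc_Ioi]
  refine le_trans (le_of_eq (setIntegral_congr_fun measurableSet_Ioi fun x hx => ?_))
    integral_fejer_le
  rw [← smoothExc_add_neg hx, add_comm]

lemma gaussPdf_eq : gaussPdf = ProbabilityTheory.gaussianPDFReal 0 1 := by
  ext x
  simp [gaussPdf, ProbabilityTheory.gaussianPDFReal]
  ring

lemma gaussPdf_pos (x : ℝ) : 0 < gaussPdf x := by unfold gaussPdf; positivity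

lemma continuous_gaussPdf : Continuous gaussPdf := by unfold gaussPdf; fun_prop

lemma integrable_gaussPdf : Integrable gaussPdf := by
  rw [gaussPdf_eq]; exact ProbabilityTheory.integrable_gaussianPDFReal 0 1

lemma integral_gaussPdf : ∫ x, gaussPdf x = 1 := by
  rw [gaussPdf_eq]; exact ProbabilityTheory.integral_gaussianPDFReal_eq_one 0 one_ne_zero

lemma gaussPdf_le (x : ℝ) : gaussPdf x ≤ 1 / sqrt (2 * π) := by
  unfold gaussPdf
  gcongr
  exact exp_le_one_iff.2 (by nlinarith [sq_nonneg x])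

lemma gaussPdf_neg (x : ℝ) : gaussPdf (-x) = gaussPdf x := by simp [gaussPdf]

lemma integrable_abs_mul_gaussPdf : Integrable fun x => |x| * gaussPdf x := by
  have h := (integrable_mul_exp_neg_mul_sq (b := 1 / 2) (by norm_num)).norm.div_const (sqrt (2 * π))
  refine h.congr (Eventually.of_forall fun x => ?_)
  simp only [norm_mul, norm_eq_abs, abs_exp, gaussPdf]
  rw [mul_div_assoc, show -(1 / 2) * x ^ 2 = -x ^ 2 / 2 by ring]

lemma integral_gaussPdf_mul_cexp (t : ℝ) :
    ∫ x, (gaussPdf x : ℂ) * Complex.exp (t * x * Complex.I) = Real.exp (-(t ^ 2) / 2) := by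
  have h := ProbabilityTheory.charFun_gaussianReal (μ := 0) (v := 1) t
  rw [charFun_apply_real, ProbabilityTheory.integral_gaussianReal_eq_integral_smul one_ne_zero] at h
  simp only [Complex.real_smul, ← gaussPdf_eq] at h
  rw [h]
  push_cast
  congr 1
  simp
  ring

lemma integrable_gaussPdf_mul_cexp (t : ℝ) :
    Integrable fun x => (gaussPdf x : ℂ) * Complex.exp (t * x * Complex.I) := by
  refine (integrable_gaussPdf.ofReal (𝕜 := ℂ)).mono (Continuous.aestronglyMeasurable ?_)
    (Eventually.of_forall fun x => ?_)
  · have := continuous_gaussPdf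
    fun_prop
  · rw [norm_mul, ← Complex.ofReal_mul, Complex.norm_exp_ofReal_mul_I, mul_one]
    exact le_rfl

lemma integral_gaussPdf_mul_cos (t : ℝ) :
    ∫ x, gaussPdf x * cos (t * x) = Real.exp (-(t ^ 2) / 2) := by
  have h := congrArg Complex.re (integral_gaussPdf_mul_cexp t)
  rw [← RCLike.re_eq_complex_re, ← integral_re (integrable_gaussPdf_mul_cexp t),
    RCLike.re_eq_complex_re, Complex.ofReal_re] at h
  rw [← h]
  congr 1
  ext x
  rw [Complex.re_ofReal_mul, ← Complex.ofReal_mul, Complex.exp_ofReal_mul_I_re]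

lemma integral_gaussPdf_mul_sin (t : ℝ) : ∫ x, gaussPdf x * sin (t * x) = 0 := by
  have h := congrArg Complex.im (integral_gaussPdf_mul_cexp t)
  rw [← RCLike.im_eq_complex_im, ← integral_im (integrable_gaussPdf_mul_cexp t),
    RCLike.im_eq_complex_im, Complex.ofReal_im] at h
  rw [← h]
  congr 1
  ext x
  rw [Complex.im_ofReal_mul, ← Complex.ofReal_mul, Complex.exp_ofReal_mul_I_im]

lemma integrable_gaussPdf_mul {f : ℝ → ℝ} (hf : Continuous f) (hb : ∀ x, |f x| ≤ 1) :
    Integrable fun x => gaussPdf x * f x := by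
  refine integrable_gaussPdf.mono (continuous_gaussPdf.mul hf).aestronglyMeasurable
    (Eventually.of_forall fun x => ?_)
  rw [norm_mul]
  exact mul_le_of_le_one_right (norm_nonneg _) (hb x)

/-- The Fourier kernel of the smoothed indicator at phase `θ`. -/
noncomputable def prawitzTrig (u θ : ℝ) : ℝ := (1 - u) * cos θ + prawitz u * sin θ

lemma integral_gaussPdf_mul_prawitzTrig (u s v : ℝ) :
    ∫ z, gaussPdf z * prawitzTrig u (s * (v - z)) =
      prawitzTrig u (s * v) * Real.exp (-(s ^ 2) / 2) := by
  have e : ∀ z, gaussPdf z * prawitzTrig u (s * (v - z)) =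
      ((1 - u) * cos (s * v) + prawitz u * sin (s * v)) * (gaussPdf z * cos (s * z)) +
      ((1 - u) * sin (s * v) - prawitz u * cos (s * v)) * (gaussPdf z * sin (s * z)) := by
    intro z
    rw [prawitzTrig, mul_sub, cos_sub, sin_sub]
    ring
  simp_rw [e]
  rw [integral_add, integral_const_mul, integral_const_mul, integral_gaussPdf_mul_cos,
    integral_gaussPdf_mul_sin, prawitzTrig]
  · ring
  · exact (integrable_gaussPdf_mul (by fun_prop) fun x => abs_cos_le_one _).const_mul _
  · exact (integrable_gaussPdf_mul (by fun_prop) fun x => abs_sin_le_one _).const_mul _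

lemma abs_prawitzTrig_le {u : ℝ} (hu : u ∈ Ioo (0 : ℝ) 1) (a : ℝ) :
    |prawitzTrig u (a * u)| ≤ 1 + |a| := by
  have h1 := abs_prawitz_mul_sin_le hu a
  have h2 : |(1 - u) * cos (a * u)| ≤ 1 := by
    rw [abs_mul, abs_of_pos (sub_pos.2 hu.2)]
    nlinarith [abs_cos_le_one (a * u), hu.1, hu.2, abs_nonneg (cos (a * u))]
  exact (abs_add_le _ _).trans (by linarith)

lemma measurable_prawitzTrig : Measurable (Function.uncurry prawitzTrig) := by
  unfold Function.uncurry prawitzTrig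
  have := measurable_prawitz
  fun_prop

lemma smoothInd_scaled {U : ℝ} (s : ℝ) :
    smoothInd (U * s / (2 * π)) = 1 / 2 + ∫ u in (0 : ℝ)..1, prawitzTrig u (U * s * u) := by
  have hp := pi_pos
  unfold smoothInd prawitzTrig
  congr 2
  ext u
  rw [show 2 * π * (U * s / (2 * π)) * u = U * s * u by field_simp]

lemma intervalIntegrable_prawitzTrig (a : ℝ) :
    IntervalIntegrable (fun u => prawitzTrig u (a * u)) volume 0 1 :=
  (intervalIntegrable_one_sub_cos a).add (intervalIntegrable_prawitz_sin a)

/-- The standard Gaussian distribution function. -/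
noncomputable def gaussPhi (v : ℝ) : ℝ := ∫ z in Iic v, gaussPdf z

lemma integral_gaussPdf_mul_smoothInd {U : ℝ} (hU : 0 < U) (v : ℝ) :
    ∫ z, gaussPdf z * smoothInd (U * (v - z) / (2 * π)) = 1 / 2 +
      ∫ u in (0 : ℝ)..1, prawitzTrig u (U * v * u) * Real.exp (-((U * u) ^ 2) / 2) := by
  have hintegrable : Integrable (Function.uncurry fun z u : ℝ =>
      gaussPdf z * prawitzTrig u (U * (v - z) * u))
      (volume.prod (volume.restrict (Ioo 0 1))) := by
    have hdom : Integrable (fun p : ℝ × ℝ => ((1 + U * |v|) * gaussPdf p.1 +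
        U * (|p.1| * gaussPdf p.1)) * 1) (volume.prod (volume.restrict (Ioo 0 1))) := by
      refine Integrable.mul_prod (f := fun z => (1 + U * |v|) * gaussPdf z +
        U * (|z| * gaussPdf z)) (g := fun _ => 1) ?_ ?_
      · exact (integrable_gaussPdf.const_mul _).add (integrable_abs_mul_gaussPdf.const_mul _)
      · exact integrable_const _
    refine hdom.mono (Measurable.aestronglyMeasurable ?_) ?_
    · have h1 := continuous_gaussPdf.measurable
      have h2 := measurable_prawitzTrig
      have h3 : Measurable fun p : ℝ × ℝ => (p.2, U * (v - p.1) * p.2) := by fun_prop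
      exact (h1.comp measurable_fst).mul (h2.comp h3)
    · have : ∀ᵐ p : ℝ × ℝ ∂(volume.prod (volume.restrict (Ioo 0 1))), p.2 ∈ Ioo (0 : ℝ) 1 :=
        Measure.quasiMeasurePreserving_snd.ae
          (p := fun u => u ∈ Ioo (0 : ℝ) 1) (ae_restrict_mem measurableSet_Ioo)
      filter_upwards [this] with p hp
      have hg := gaussPdf_pos p.1
      have h4 := abs_prawitzTrig_le hp (U * (v - p.1))
      rw [abs_mul, abs_of_pos hU] at h4
      have h5 : |v - p.1| ≤ |v| + |p.1| := abs_sub _ _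
      have h6 : 0 ≤ ((1 + U * |v|) * gaussPdf p.1 + U * (|p.1| * gaussPdf p.1)) * 1 := by positivity
      rw [norm_of_nonneg h6]
      simp only [Function.uncurry, norm_mul, norm_eq_abs, abs_of_pos hg]
      nlinarith [mul_le_mul_of_nonneg_left h5 hU.le]
  have h := integral_integral_swap hintegrable
  have h1 : ∀ z, gaussPdf z * smoothInd (U * (v - z) / (2 * π)) = gaussPdf z * (1 / 2) +
      ∫ u in Ioo (0 : ℝ) 1, gaussPdf z * prawitzTrig u (U * (v - z) * u) := by
    intro z
    rw [smoothInd_scaled, mul_add, integral_const_mul,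
      intervalIntegral.integral_of_le zero_le_one, integral_Ioc_eq_integral_Ioo]
  have h2 : Integrable fun z => ∫ u in Ioo (0 : ℝ) 1,
      gaussPdf z * prawitzTrig u (U * (v - z) * u) := hintegrable.integral_prod_left
  simp_rw [h1]
  rw [integral_add (integrable_gaussPdf.mul_const _) h2, integral_mul_const,
    integral_gaussPdf, one_mul, h, intervalIntegral.integral_of_le zero_le_one, integral_Ioc_eq_integral_Ioo]
  congr 2
  ext u
  have := integral_gaussPdf_mul_prawitzTrig u (U * u) v
  rw [show U * v * u = U * u * v by ring, ← this]
  congr 1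
  ext z
  ring_nf

lemma gauss_smoothing {U : ℝ} (hU : 0 < U) (v : ℝ) : 1 / 2 +
      ∫ u in (0 : ℝ)..1, prawitzTrig u (U * v * u) * Real.exp (-((U * u) ^ 2) / 2) ≤
      gaussPhi v + sqrt (π / 2) / U := by
  have hp := pi_pos
  rw [← integral_gaussPdf_mul_smoothInd hU v]
  have hc : 0 < U / (2 * π) := by positivity
  have hI : Integrable fun z => smoothExc (U / (2 * π) * (v - z)) :=
    (integrable_smoothExc.comp_mul_left' hc.ne').comp_sub_left v
  have hI2 : ∫ z, smoothExc (U / (2 * π) * (v - z)) ≤ 2 * π / U * (1 / 2) := by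
    rw [integral_sub_left_eq_self (fun z => smoothExc (U / (2 * π) * z)) volume v,
      Measure.integral_comp_mul_left, abs_inv, abs_of_pos hc, inv_div, smul_eq_mul]
    exact mul_le_mul_of_nonneg_left integral_smoothExc_le (by positivity)
  have hI3 : Integrable fun z => gaussPdf z * smoothExc (U / (2 * π) * (v - z)) := by
    refine (hI.const_mul (1 / sqrt (2 * π))).mono
      (continuous_gaussPdf.aestronglyMeasurable.mul hI.1) (Eventually.of_forall fun z => ?_)
    rw [norm_mul, norm_mul, norm_of_nonneg (gaussPdf_pos z).le,
      norm_of_nonneg (by positivity : 0 ≤ 1 / sqrt (2 * π))]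
    exact mul_le_mul_of_nonneg_right (gaussPdf_le z) (norm_nonneg _)
  have e : ∀ z, gaussPdf z * smoothInd (U * (v - z) / (2 * π)) =
      (Iic v).indicator gaussPdf z + gaussPdf z * smoothExc (U / (2 * π) * (v - z)) := by
    intro z
    rw [show U * (v - z) / (2 * π) = U / (2 * π) * (v - z) by ring, smoothExc]
    by_cases hz : z ≤ v
    · rw [indicator_of_mem (mem_Iic.2 hz), indicator_of_mem
        (mem_Ici.2 (mul_nonneg hc.le (sub_nonneg.2 hz))), Pi.one_apply]
      ring
    · rw [indicator_of_notMem (by simpa using hz), indicator_of_notMem]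
      · ring
      · rw [mem_Ici, not_le]
        exact mul_neg_of_pos_of_neg hc (by linarith)
  simp_rw [e]
  rw [integral_add (integrable_gaussPdf.indicator measurableSet_Iic) hI3,
    integral_indicator measurableSet_Iic]
  refine add_le_add le_rfl ?_
  calc ∫ z, gaussPdf z * smoothExc (U / (2 * π) * (v - z))
      ≤ ∫ z, 1 / sqrt (2 * π) * smoothExc (U / (2 * π) * (v - z)) :=
        integral_mono hI3 (hI.const_mul _) fun z =>
          mul_le_mul_of_nonneg_right (gaussPdf_le z) (smoothExc_nonneg _)
    _ ≤ 1 / sqrt (2 * π) * (2 * π / U * (1 / 2)) := by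
        rw [integral_const_mul]
        exact mul_le_mul_of_nonneg_left hI2 (by positivity)
    _ = sqrt (π / 2) / U := by
        have h1 : sqrt (2 * π) = 2 * sqrt (π / 2) := by
          rw [show 2 * π = 2 ^ 2 * (π / 2) by ring, sqrt_mul (by positivity),
            sqrt_sq (by norm_num)]
        have h2 : sqrt (π / 2) * sqrt (π / 2) = π / 2 := mul_self_sqrt (by positivity)
        have h3 : 0 < sqrt (π / 2) := by positivity
        rw [h1]
        field_simp
        nlinarith

lemma indicator_le_smoothInd {U : ℝ} (hU : 0 < U) (v w : ℝ) :
    (if w ≤ v then (1 : ℝ) else 0) ≤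
      1 / 2 + ∫ u in (0 : ℝ)..1, prawitzTrig u (U * (v - w) * u) := by
  have hp := pi_pos
  rw [← smoothInd_scaled]
  have h := smoothExc_nonneg (U * (v - w) / (2 * π))
  rw [smoothExc] at h
  split_ifs with hw
  · rw [indicator_of_mem (mem_Ici.2 (div_nonneg (mul_nonneg hU.le (sub_nonneg.2 hw))
      (by positivity)))] at h
    simpa using h
  · rw [indicator_of_notMem] at h
    · simpa using h
    · rw [mem_Ici, not_le]
      exact div_neg_of_neg_of_pos (mul_neg_of_pos_of_neg hU (by linarith)) (by positivity)

/-- Prawitz's smoothing inequality for a finitely supported law. -/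
lemma prawitz_smoothing {ι : Type*} (s : Finset ι) (p w : ι → ℝ) (hp : ∀ i ∈ s, 0 ≤ p i)
    (hp1 : ∑ i ∈ s, p i = 1) {U : ℝ} (hU : 0 < U) (v : ℝ) :
    ∑ i ∈ s, p i * (if w i ≤ v then 1 else 0) ≤ gaussPhi v + sqrt (π / 2) / U +
      ∫ u in (0 : ℝ)..1, (∑ i ∈ s, p i * prawitzTrig u (U * (v - w i) * u) -
        prawitzTrig u (U * v * u) * Real.exp (-((U * u) ^ 2) / 2)) := by
  have h1 := gauss_smoothing hU v
  have hi : ∀ i ∈ s, IntervalIntegrable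
      (fun u => p i * prawitzTrig u (U * (v - w i) * u)) volume 0 1 :=
    fun i _ => (intervalIntegrable_prawitzTrig _).const_mul _
  have hi2 : IntervalIntegrable (fun u => ∑ i ∈ s, p i * prawitzTrig u (U * (v - w i) * u))
      volume 0 1 := by
    convert! IntervalIntegrable.sum s hi using 1
    ext u
    simp
  rw [intervalIntegral.integral_sub hi2 ((intervalIntegrable_prawitzTrig _).mul_continuousOn
    (Continuous.continuousOn (by fun_prop))), intervalIntegral.integral_finsetSum hi]
  have h2 : ∑ i ∈ s, p i * (if w i ≤ v then (1 : ℝ) else 0) ≤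
      ∑ i ∈ s, p i * (1 / 2 + ∫ u in (0 : ℝ)..1, prawitzTrig u (U * (v - w i) * u)) :=
    Finset.sum_le_sum fun i hi => mul_le_mul_of_nonneg_left (indicator_le_smoothInd hU v _) (hp i hi)
  simp_rw [mul_add, Finset.sum_add_distrib, ← Finset.sum_mul, hp1] at h2
  simp_rw [intervalIntegral.integral_const_mul]
  linarith

lemma mul_cos_le_sin {x : ℝ} (h0 : 0 ≤ x) (h1 : x ≤ π) : x * cos x ≤ sin x := by
  rcases h0.eq_or_lt with rfl | hx
  · simp
  rcases lt_or_ge x (π / 2) with h | h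
  · have := lt_tan hx h
    rw [tan_eq_sin_div_cos, lt_div_iff₀ (cos_pos_of_mem_Ioo ⟨by linarith, h⟩)] at this
    exact this.le
  · have h2 : cos x ≤ 0 := cos_nonpos_of_pi_div_two_le_of_le h (by linarith [pi_pos])
    have h3 : 0 ≤ sin x := sin_nonneg_of_nonneg_of_le_pi h0 h1
    nlinarith

lemma mul_cos_le_mul_sin {x : ℝ} (h0 : 0 ≤ x) (h1 : x ≤ π) :
    x * cos x ≤ (1 - x ^ 2 / 3) * sin x := by
  have hmono : MonotoneOn (fun x => sin x - x * cos x - x ^ 2 * sin x / 3) (Icc 0 π) := by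
    refine monotoneOn_of_deriv_nonneg (convex_Icc 0 π) (by fun_prop) (by fun_prop) fun y hy => ?_
    rw [interior_Icc] at hy
    have hd : HasDerivAt (fun x => sin x - x * cos x - x ^ 2 * sin x / 3)
        (y / 3 * (sin y - y * cos y)) y := by
      have := ((hasDerivAt_sin y).sub ((hasDerivAt_id y).mul (hasDerivAt_cos y))).sub
        (((hasDerivAt_pow 2 y).mul (hasDerivAt_sin y)).div_const 3)
      convert! this using 1
      simp
      ring
    rw [hd.deriv]
    have := mul_cos_le_sin hy.1.le hy.2.le
    exact mul_nonneg (by linarith [hy.1]) (by linarith)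
  have := hmono ⟨le_rfl, pi_pos.le⟩ ⟨h0, h1⟩ h0
  simp at this
  linarith

lemma prawitz_nonneg {u : ℝ} (hu : u ∈ Ioo (0 : ℝ) 1) : 0 ≤ prawitz u := by
  have hs := sin_pi_mul_pos hu
  have hp := pi_pos
  have h := mul_cos_le_sin (x := π * (1 - u)) (mul_nonneg hp.le (by linarith [hu.2]))
    (by nlinarith [hu.1])
  rw [show π * (1 - u) = π - π * u by ring, cos_pi_sub, sin_pi_sub] at h
  have e : prawitz u = (sin (π * u) - (π - π * u) * -cos (π * u)) / (π * sin (π * u)) := by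
    rw [prawitz]
    generalize sin (π * u) = S at hs
    generalize cos (π * u) = C
    field_simp
    ring
  rw [e]
  exact div_nonneg (by linarith) (by positivity)

lemma prawitz_le {u : ℝ} (hu : u ∈ Ioo (0 : ℝ) 1) :
    π * u * prawitz u ≤ 1 - π ^ 2 * u ^ 2 * (1 - u) / 3 := by
  have hs := sin_pi_mul_pos hu
  have hp := pi_pos
  have h := mul_cos_le_mul_sin (x := π * u) (mul_nonneg hp.le hu.1.le) (by nlinarith [hu.2])
  rw [← div_le_iff₀ hs] at h
  have e : π * u * prawitz u = (1 - u) * (π * u * cos (π * u) / sin (π * u)) + u := by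
    unfold prawitz
    field_simp
  rw [e]
  nlinarith [hu.1, hu.2]

lemma prawitz_poly {u P : ℝ} (h0 : 0 ≤ u) (h1 : u ≤ 1) (hP0 : 0 ≤ P) (hP : P ≤ 9.87) :
    P * u ^ 2 * (1 - u) ^ 2 + (1 - P * u ^ 2 * (1 - u) / 3) ^ 2 ≤ 1.04 ^ 2 := by
  have hv : 0 ≤ u ^ 2 * (1 - u) := mul_nonneg (sq_nonneg u) (by linarith)
  set v := u ^ 2 * (1 - u) with hvd
  have e : P * u ^ 2 * (1 - u) ^ 2 + (1 - P * u ^ 2 * (1 - u) / 3) ^ 2 =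
      1 + P * v * (1 / 3 - u + P * v / 9) := by rw [hvd]; ring
  rw [e]
  by_cases hb : 1 / 3 - u + P * v / 9 ≤ 0
  · have : P * v * (1 / 3 - u + P * v / 9) ≤ 0 := mul_nonpos_of_nonneg_of_nonpos (by positivity) hb
    norm_num
    linarith
  · push Not at hb
    have h3 : P * v ≤ 9.87 * v := mul_le_mul_of_nonneg_right hP hv
    have h4 : P * v * (1 / 3 - u + P * v / 9) ≤ 9.87 * v * (1 / 3 - u + 9.87 * v / 9) := by
      apply mul_le_mul h3 (by linarith) hb.le (by positivity)
    have h5 : 9.87 * v * (1 / 3 - u + 9.87 * v / 9) ≤ 0.08 := by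
      have hv1 : v ≤ u / 4 := by rw [hvd]; nlinarith [mul_nonneg h0 (sq_nonneg (u - 1 / 2))]
      have hu : u < 1 / 2 := by nlinarith
      have h6 : 9.87 * v * (1 / 3 - u + 9.87 * v / 9) ≤ 9.87 * v * (1 / 3 - 0.7258 * u) :=
        mul_le_mul_of_nonneg_left (by linarith) (by positivity)
      refine h6.trans ?_
      rw [hvd]
      nlinarith [mul_nonneg (mul_nonneg h0 (sub_nonneg.2 hu.le)) (sq_nonneg (u - 0.29)),
        mul_nonneg h0 (sq_nonneg (u - 0.29)), sq_nonneg (u - 0.29)]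
    norm_num at h5 ⊢
    linarith

/-- The complex Fourier coefficient of the smoothed indicator. -/
noncomputable def prawitzC (u : ℝ) : ℂ := ((1 - u : ℝ) : ℂ) - (prawitz u : ℝ) * Complex.I

lemma norm_prawitzC_le {u : ℝ} (hu : u ∈ Ioo (0 : ℝ) 1) : ‖prawitzC u‖ ≤ 1.04 / (π * u) := by
  have hp := pi_pos
  have hu0 := hu.1
  have h1 := prawitz_nonneg hu
  have h2 := prawitz_le hu
  have h3 : π ^ 2 ≤ 9.87 := by nlinarith [pi_lt_d4, pi_gt_three]
  have h4 := prawitz_poly hu.1.le hu.2.le (sq_nonneg π) h3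
  have h5 : 0 ≤ π * u * prawitz u := by positivity
  rw [le_div_iff₀ (by positivity)]
  refine (sq_le_sq₀ (by positivity) (by norm_num)).1 ?_
  rw [mul_pow, ← Complex.normSq_eq_norm_sq, Complex.normSq_apply]
  simp only [prawitzC, Complex.sub_re, Complex.sub_im, Complex.ofReal_re, Complex.ofReal_im,
    Complex.re_ofReal_mul, Complex.im_ofReal_mul, Complex.I_re, Complex.I_im]
  nlinarith [mul_self_le_mul_self h5 h2]

lemma prawitzTrig_eq_re (u θ : ℝ) :
    prawitzTrig u θ = (prawitzC u * Complex.exp (θ * Complex.I)).re := by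
  rw [Complex.mul_re, Complex.exp_ofReal_mul_I_re, Complex.exp_ofReal_mul_I_im]
  simp [prawitzC, prawitzTrig]

lemma gaussPhi_nonneg (v : ℝ) : 0 ≤ gaussPhi v :=
  setIntegral_nonneg measurableSet_Iic fun z _ => (gaussPdf_pos z).le

lemma gaussPhi_le_one (v : ℝ) : gaussPhi v ≤ 1 := by
  rw [← integral_gaussPdf]
  exact setIntegral_le_integral integrable_gaussPdf
    (Eventually.of_forall fun z => (gaussPdf_pos z).le)

lemma monotone_gaussPhi : Monotone gaussPhi := fun _ _ h =>
  setIntegral_mono_set integrable_gaussPdf.integrableOn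
    (Eventually.of_forall fun z => (gaussPdf_pos z).le) (Iic_subset_Iic.2 h).eventuallyLE

/-- The difference of conjugate characteristic functions of a finite law and the Gaussian. -/
noncomputable def charDiff {ι : Type*} (s : Finset ι) (p w : ι → ℝ) (t : ℝ) : ℂ :=
  ∑ i ∈ s, (p i : ℂ) * Complex.exp (((-(t * w i) : ℝ) : ℂ) * Complex.I) -
    (Real.exp (-(t ^ 2) / 2) : ℝ)

lemma charDiff_norm_le {ι : Type*} (s : Finset ι) (p w : ι → ℝ) (hp : ∀ i ∈ s, 0 ≤ p i)
    (hp1 : ∑ i ∈ s, p i = 1) (t : ℝ) :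
    ‖charDiff s p w t‖ ≤ |t| * ∑ i ∈ s, p i * |w i| + t ^ 2 / 2 := by
  have e : charDiff s p w t =
      ∑ i ∈ s, (p i : ℂ) * (Complex.exp (Complex.I * ((-(t * w i) : ℝ) : ℂ)) - 1) +
      ((1 - Real.exp (-(t ^ 2) / 2) : ℝ) : ℂ) := by
    simp_rw [mul_sub, Finset.sum_sub_distrib, mul_one, ← Complex.ofReal_sum, hp1, charDiff,
      mul_comm Complex.I]
    push_cast
    ring
  rw [e]
  refine (norm_add_le _ _).trans (add_le_add ((norm_sum_le _ _).trans ?_) ?_)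
  · rw [Finset.mul_sum]
    refine Finset.sum_le_sum fun i hi => ?_
    rw [norm_mul, Complex.norm_real, norm_of_nonneg (hp i hi)]
    have := Real.norm_exp_I_mul_ofReal_sub_one_le (x := -(t * w i))
    rw [norm_neg, norm_mul, norm_eq_abs, norm_eq_abs] at this
    nlinarith [mul_le_mul_of_nonneg_left this (hp i hi)]
  · have h1 : Real.exp (-(t ^ 2) / 2) ≤ 1 := exp_le_one_iff.2 (by nlinarith [sq_nonneg t])
    rw [Complex.norm_real, norm_of_nonneg (by linarith)]
    linarith [add_one_le_exp (-(t ^ 2) / 2)]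

lemma smoothing_integrand_eq {ι : Type*} (s : Finset ι) (p w : ι → ℝ) (U u v : ℝ) :
    ∑ i ∈ s, p i * prawitzTrig u (U * (v - w i) * u) -
        prawitzTrig u (U * v * u) * Real.exp (-((U * u) ^ 2) / 2) =
      (prawitzC u * charDiff s p w (U * u) * Complex.exp ((U * u * v : ℝ) * Complex.I)).re := by
  have e : prawitzC u * charDiff s p w (U * u) * Complex.exp ((U * u * v : ℝ) * Complex.I) =
      ∑ i ∈ s, (p i : ℂ) *
        (prawitzC u * Complex.exp ((U * (v - w i) * u : ℝ) * Complex.I)) -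
      ((Real.exp (-((U * u) ^ 2) / 2) : ℝ) : ℂ) *
        (prawitzC u * Complex.exp ((U * v * u : ℝ) * Complex.I)) := by
    rw [charDiff, mul_sub, sub_mul, Finset.mul_sum, Finset.sum_mul]
    congr 1
    · refine Finset.sum_congr rfl fun i _ => ?_
      rw [show ((U * (v - w i) * u : ℝ) : ℂ) * Complex.I =
        ((-(U * u * w i) : ℝ) : ℂ) * Complex.I + ((U * u * v : ℝ) : ℂ) * Complex.I by
          push_cast; ring, Complex.exp_add]
      ring
    · rw [show U * v * u = U * u * v by ring]
      ring
  rw [e, Complex.sub_re, Complex.re_sum]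
  simp_rw [Complex.re_ofReal_mul, ← prawitzTrig_eq_re]
  ring

lemma measurable_prawitzC : Measurable prawitzC := by
  unfold prawitzC
  have := measurable_prawitz
  fun_prop

lemma measurable_charDiff {ι : Type*} (s : Finset ι) (p w : ι → ℝ) :
    Measurable (charDiff s p w) := by
  unfold charDiff
  fun_prop

lemma integral_exp_neg_mul_cexp (a : ℝ) :
    ∫ y in Ioi (0 : ℝ), (Real.exp (-y) : ℂ) * Complex.exp ((-(a * y) : ℝ) * Complex.I) =
      1 / (1 + a * Complex.I) := by
  have h := integral_exp_mul_complex_Ioi (a := -(1 + a * Complex.I)) (by simp) 0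
  simp only [Complex.ofReal_zero, mul_zero, Complex.exp_zero] at h
  rw [neg_div_neg_eq] at h
  rw [← h]
  congr 1
  ext y
  rw [Complex.ofReal_exp, ← Complex.exp_add]
  congr 1
  push_cast
  ring

lemma norm_one_add_mul_I (a : ℝ) : ‖(1 + a * Complex.I : ℂ)‖ = sqrt (1 + a ^ 2) := by
  rw [← Complex.ofReal_one, Complex.norm_add_mul_I, one_pow]

lemma integrableOn_exp_neg : IntegrableOn (fun y : ℝ => Real.exp (-y)) (Ioi 0) := by
  simpa using exp_neg_integrableOn_Ioi 0 one_pos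

lemma integrable_exp_neg_mul_cexp (K : ℂ) (b a : ℝ) : IntegrableOn (fun y : ℝ =>
    (Real.exp (-y) : ℂ) * (K * Complex.exp ((b - a * y : ℝ) * Complex.I))) (Ioi 0) := by
  refine (integrableOn_exp_neg.ofReal (𝕜 := ℂ)).mul_bdd (c := ‖K‖)
    (Continuous.aestronglyMeasurable (by fun_prop)) (Eventually.of_forall fun y => ?_)
  rw [norm_mul, Complex.norm_exp_ofReal_mul_I, mul_one]

lemma integral_exp_neg_mul_re (K : ℂ) (b a : ℝ) :
    ∫ y in Ioi (0 : ℝ), Real.exp (-y) * (K * Complex.exp ((b - a * y : ℝ) * Complex.I)).re ≤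
      ‖K‖ / sqrt (1 + a ^ 2) := by
  have hi := integrable_exp_neg_mul_cexp K b a
  have h1 : ∫ y in Ioi (0 : ℝ), Real.exp (-y) *
      (K * Complex.exp ((b - a * y : ℝ) * Complex.I)).re =
      (K * Complex.exp (b * Complex.I) * (1 / (1 + a * Complex.I))).re := by
    rw [← integral_exp_neg_mul_cexp, ← integral_const_mul]
    have h2 : ∀ y : ℝ, K * Complex.exp (b * Complex.I) * ((Real.exp (-y) : ℂ) *
        Complex.exp ((-(a * y) : ℝ) * Complex.I)) =
        (Real.exp (-y) : ℂ) * (K * Complex.exp ((b - a * y : ℝ) * Complex.I)) := by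
      intro y
      rw [show ((b - a * y : ℝ) : ℂ) * Complex.I =
        (b : ℂ) * Complex.I + ((-(a * y) : ℝ) : ℂ) * Complex.I by push_cast; ring,
        Complex.exp_add]
      ring
    simp_rw [h2]
    rw [← RCLike.re_eq_complex_re, ← integral_re hi]
    congr 1
    ext y
    rw [RCLike.re_eq_complex_re, Complex.re_ofReal_mul]
  rw [h1]
  refine (Complex.re_le_norm _).trans (le_of_eq ?_)
  rw [norm_mul, norm_mul, norm_div, norm_one_add_mul_I, Complex.norm_exp_ofReal_mul_I, norm_one]
  ring

lemma integral_exp_neg_mul_indicator {m : ℝ} (hm : 0 < m) (x w : ℝ) :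
    IntegrableOn (fun y : ℝ => Real.exp (-y) * (if w ≤ x - m * y then 1 else 0)) (Ioi 0) ∧
    ∫ y in Ioi (0 : ℝ), Real.exp (-y) * (if w ≤ x - m * y then 1 else 0) =
      max 0 (1 - Real.exp (-((x - w) / m))) := by
  have e : ∀ y : ℝ, Real.exp (-y) * (if w ≤ x - m * y then 1 else 0) =
      (Iic ((x - w) / m)).indicator (fun y => Real.exp (-y)) y := by
    intro y
    have : w ≤ x - m * y ↔ y ∈ Iic ((x - w) / m) := by
      rw [mem_Iic, le_div_iff₀ hm]
      constructor <;> intro h <;> linarith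
    by_cases h : y ∈ Iic ((x - w) / m)
    · simp [indicator_of_mem h, this.2 h]
    · simp [indicator_of_notMem h, mt this.1 h]
  simp_rw [e]
  refine ⟨integrableOn_exp_neg.indicator measurableSet_Iic, ?_⟩
  rw [setIntegral_indicator measurableSet_Iic, Ioi_inter_Iic]
  rcases le_total 0 ((x - w) / m) with h | h
  · rw [← intervalIntegral.integral_of_le h, intervalIntegral.integral_comp_neg
      (fun y => Real.exp y), integral_exp, neg_zero, Real.exp_zero, max_eq_right]
    simpa using h
  · rw [Ioc_eq_empty (not_lt.2 h), setIntegral_empty, max_eq_left]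
    simpa using h

lemma integrableOn_exp_neg_mul_gaussPhi (x m : ℝ) :
    IntegrableOn (fun y : ℝ => Real.exp (-y) * gaussPhi (x - m * y)) (Ioi 0) := by
  refine integrableOn_exp_neg.mul_bdd (c := 1)
    (monotone_gaussPhi.measurable.comp (by fun_prop)).aestronglyMeasurable
    (Eventually.of_forall fun y => ?_)
  rw [norm_of_nonneg (gaussPhi_nonneg _)]
  exact gaussPhi_le_one _

/-- Prawitz smoothing averaged over an exponential shift. -/
lemma averaged_smoothing {ι : Type*} (s : Finset ι) (p w : ι → ℝ) (hp : ∀ i ∈ s, 0 ≤ p i)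
    (hp1 : ∑ i ∈ s, p i = 1) {U m : ℝ} (hU : 0 < U) (hm : 0 < m) (x : ℝ) {B : ℝ → ℝ}
    (hB : IntervalIntegrable B volume 0 1)
    (hb : ∀ u ∈ Ioo (0 : ℝ) 1,
      1.04 / (π * u) * ‖charDiff s p w (U * u)‖ / sqrt (1 + (m * (U * u)) ^ 2) ≤ B u) :
    ∑ i ∈ s, p i * max 0 (1 - Real.exp (-((x - w i) / m))) ≤
      (∫ y in Ioi (0 : ℝ), Real.exp (-y) * gaussPhi (x - m * y)) + sqrt (π / 2) / U +
        ∫ u in (0 : ℝ)..1, B u := by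
  have hpi := pi_pos
  set K : ℝ → ℂ := fun u => prawitzC u * charDiff s p w (U * u) with hK
  have hKm : Measurable K :=
    measurable_prawitzC.mul ((measurable_charDiff s p w).comp (by fun_prop))
  set C := 1.04 / π * (U * ∑ i ∈ s, p i * |w i| + U ^ 2 / 2) with hC
  have hKb : ∀ u ∈ Ioo (0 : ℝ) 1, ‖K u‖ ≤ 1.04 / (π * u) * ‖charDiff s p w (U * u)‖ :=
    fun u hu => by
      rw [hK, norm_mul]
      exact mul_le_mul_of_nonneg_right (norm_prawitzC_le hu) (norm_nonneg _)
  have hKC : ∀ u ∈ Ioo (0 : ℝ) 1, ‖K u‖ ≤ C := fun u hu => by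
    have hu0 := hu.1
    refine (hKb u hu).trans ?_
    have h1 := charDiff_norm_le s p w hp hp1 (U * u)
    rw [abs_of_pos (by positivity)] at h1
    have h2 : U * u * ∑ i ∈ s, p i * |w i| + (U * u) ^ 2 / 2 ≤
        u * (U * ∑ i ∈ s, p i * |w i| + U ^ 2 / 2) := by
      nlinarith [hu.1, hu.2, mul_pos hU hU, mul_nonneg hu0.le (sub_nonneg.2 hu.2.le)]
    calc _ ≤ 1.04 / (π * u) * (u * (U * ∑ i ∈ s, p i * |w i| + U ^ 2 / 2)) :=
          mul_le_mul_of_nonneg_left (h1.trans h2) (by positivity)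
      _ = C := by rw [hC]; field_simp
  -- the doubly indexed integrand
  have hintegrable : Integrable (Function.uncurry fun y u : ℝ =>
      Real.exp (-y) * (K u * Complex.exp ((U * u * (x - m * y) : ℝ) * Complex.I)).re)
      ((volume.restrict (Ioi 0)).prod (volume.restrict (Ioo 0 1))) := by
    have hdom : Integrable (fun q : ℝ × ℝ => Real.exp (-q.1) * C)
        ((volume.restrict (Ioi 0)).prod (volume.restrict (Ioo 0 1))) :=
      Integrable.mul_prod (f := fun y => Real.exp (-y)) (g := fun _ => C)
        integrableOn_exp_neg (integrable_const _)
    refine hdom.mono (Measurable.aestronglyMeasurable ?_) ?_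
    · unfold Function.uncurry
      fun_prop
    · have : ∀ᵐ q : ℝ × ℝ ∂((volume.restrict (Ioi 0)).prod (volume.restrict (Ioo 0 1))),
          q.2 ∈ Ioo (0 : ℝ) 1 :=
        Measure.quasiMeasurePreserving_snd.ae
          (p := fun u => u ∈ Ioo (0 : ℝ) 1) (ae_restrict_mem measurableSet_Ioo)
      filter_upwards [this] with q hq
      simp only [Function.uncurry, norm_mul]
      refine mul_le_mul_of_nonneg_left ?_ (norm_nonneg _)
      refine (Complex.abs_re_le_norm _).trans ?_
      rw [norm_mul, Complex.norm_exp_ofReal_mul_I, mul_one]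
      exact (hKC _ hq).trans (le_abs_self C)
  have hpt : ∀ y ∈ Ioi (0 : ℝ),
      ∑ i ∈ s, p i * (Real.exp (-y) * (if w i ≤ x - m * y then 1 else 0)) ≤
      (Real.exp (-y) * gaussPhi (x - m * y) + Real.exp (-y) * (sqrt (π / 2) / U)) +
      ∫ u in Ioo (0 : ℝ) 1,
        Real.exp (-y) * (K u * Complex.exp ((U * u * (x - m * y) : ℝ) * Complex.I)).re := by
    intro y _
    have h := prawitz_smoothing s p w hp hp1 hU (x - m * y)
    simp_rw [smoothing_integrand_eq] at h
    rw [intervalIntegral.integral_of_le zero_le_one, integral_Ioc_eq_integral_Ioo] at h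
    rw [integral_const_mul]
    have h2 := mul_le_mul_of_nonneg_left h (Real.exp_pos (-y)).le
    rw [Finset.mul_sum] at h2
    calc _ = ∑ i ∈ s, Real.exp (-y) * (p i * (if w i ≤ x - m * y then 1 else 0)) :=
          Finset.sum_congr rfl fun i _ => by ring
      _ ≤ _ := h2
      _ = _ := by ring
  have hi1 := integrableOn_exp_neg_mul_gaussPhi x m
  have hi2 := integrableOn_exp_neg.mul_const (sqrt (π / 2) / U)
  have hi3 : IntegrableOn (fun y => ∫ u in Ioo (0 : ℝ) 1,
      Real.exp (-y) * (K u * Complex.exp ((U * u * (x - m * y) : ℝ) * Complex.I)).re) (Ioi 0) :=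
    hintegrable.integral_prod_left
  have hi0 : ∀ i ∈ s, IntegrableOn
      (fun y => p i * (Real.exp (-y) * (if w i ≤ x - m * y then 1 else 0))) (Ioi 0) :=
    fun i _ => (integral_exp_neg_mul_indicator hm x (w i)).1.const_mul _
  have hmain := setIntegral_mono_on (integrable_finsetSum s hi0) ((hi1.add hi2).add hi3)
    measurableSet_Ioi hpt
  have hL : ∫ y in Ioi (0 : ℝ),
      ∑ i ∈ s, p i * (Real.exp (-y) * (if w i ≤ x - m * y then 1 else 0)) =
      ∑ i ∈ s, p i * max 0 (1 - Real.exp (-((x - w i) / m))) := by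
    rw [integral_finsetSum s hi0]
    refine Finset.sum_congr rfl fun i _ => ?_
    rw [integral_const_mul, (integral_exp_neg_mul_indicator hm x (w i)).2]
  rw [hL, integral_add' (hi1.add hi2) hi3, integral_add' hi1 hi2, integral_mul_const] at hmain
  have hE : ∫ y in Ioi (0 : ℝ), Real.exp (-y) = 1 := by rw [integral_exp_neg_Ioi]; simp
  rw [hE, one_mul, integral_integral_swap hintegrable] at hmain
  refine hmain.trans (add_le_add le_rfl ?_)
  rw [intervalIntegral.integral_of_le zero_le_one, integral_Ioc_eq_integral_Ioo]
  rw [intervalIntegrable_iff_integrableOn_Ioo_of_le zero_le_one] at hB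
  refine setIntegral_mono_on hintegrable.integral_prod_right hB measurableSet_Ioo fun u hu => ?_
  have h := integral_exp_neg_mul_re (K u) (U * u * x) (m * (U * u))
  simp_rw [show ∀ y, U * u * x - m * (U * u) * y = U * u * (x - m * y) from fun y => by ring] at h
  refine h.trans (le_trans ?_ (hb u hu))
  exact div_le_div_of_nonneg_right (hKb u hu) (sqrt_nonneg _)

lemma cos_le_quartic {x : ℝ} (hx : 0 ≤ x) : cos x ≤ 1 - x ^ 2 / 2 + x ^ 4 / 24 := by
  have hm : MonotoneOn (fun y : ℝ => 1 - y ^ 2 / 2 + y ^ 4 / 24 - cos y) (Ici 0) := by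
    refine monotoneOn_of_deriv_nonneg (convex_Ici 0) (by fun_prop) (by fun_prop) fun y hy => ?_
    rw [interior_Ici] at hy
    have h : HasDerivAt (fun y : ℝ => 1 - y ^ 2 / 2 + y ^ 4 / 24 - cos y)
        (0 - 2 * y ^ 1 / 2 + 4 * y ^ 3 / 24 - -sin y) y := by
      refine HasDerivAt.sub (HasDerivAt.add (HasDerivAt.sub (hasDerivAt_const _ _) ?_) ?_)
        (hasDerivAt_cos y)
      · simpa using (hasDerivAt_pow 2 y).div_const 2
      · simpa using (hasDerivAt_pow 4 y).div_const 24
    rw [h.deriv]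
    have := sin_ge_sub_cube (le_of_lt hy)
    nlinarith
  have := hm (mem_Ici.2 le_rfl) (mem_Ici.2 hx) hx
  norm_num at this
  linarith

lemma cos_le_cubic (x : ℝ) : cos x ≤ 1 - x ^ 2 / 2 + |x| ^ 3 / 10 := by
  rw [← cos_abs, ← sq_abs]
  generalize hy : |x| = y
  have hy0 : 0 ≤ y := hy ▸ abs_nonneg x
  by_cases h : y ≤ 2.4
  · have h1 : 0 ≤ y ^ 3 * (2.4 - y) := by have := sub_nonneg.2 h; positivity
    nlinarith [cos_le_quartic hy0]
  push Not at h
  by_cases h5 : 5 ≤ y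
  · have h1 : 0 ≤ y ^ 2 * (y - 5) := by have := sub_nonneg.2 h5; positivity
    nlinarith [cos_le_one y]
  push Not at h5
  have h1 := one_sub_sq_div_two_le_cos (x := y - π)
  rw [cos_sub_pi] at h1
  have h2 : 0 ≤ y ^ 3 / 10 - y ^ 2 + π * y + 2 - π ^ 2 / 2 := by
    have e1 := pi_gt_d4
    have e2 := pi_lt_d4
    nlinarith [mul_nonneg (sq_nonneg (y - 4.13)) (by linarith : 0 ≤ y - 1.74),
      mul_nonneg (by linarith : 0 ≤ y - 2.4) (by linarith : 0 ≤ π - 3.1415)]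
  nlinarith

lemma norm_cexp_sub_one_sub_le (x : ℝ) :
    ‖Complex.exp ((x : ℂ) * Complex.I) - 1 - (x : ℂ) * Complex.I‖ ≤ x ^ 2 / 2 := by
  wlog h : 0 ≤ x with H
  · have := H (-x) (by linarith)
    rw [← Complex.norm_conj, map_sub, map_sub, ← Complex.exp_conj] at this
    simpa using this
  have key := image_norm_le_of_norm_deriv_right_le_deriv_boundary (a := 0) (b := x)
    (f := fun y : ℝ => Complex.exp ((y : ℂ) * Complex.I) - 1 - (y : ℂ) * Complex.I)
    (f' := fun y : ℝ => Complex.exp ((y : ℂ) * Complex.I) * (1 * Complex.I) - 0 - 1 * Complex.I)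
    (B := fun y => y ^ 2 / 2) (B' := fun y => y) (by fun_prop) (fun y _ => ?_) (by simp)
    (fun y => ?_) (fun y hy => ?_)
  · exact key (right_mem_Icc.2 h)
  · refine HasDerivAt.hasDerivWithinAt ?_
    have h1 : HasDerivAt (fun y : ℝ => (y : ℂ) * Complex.I) (1 * Complex.I) y :=
      (HasDerivAt.ofReal_comp (hasDerivAt_id y)).mul_const _ |>.congr_deriv (by simp)
    exact (h1.cexp.sub (hasDerivAt_const _ _)).sub h1
  · simpa using (hasDerivAt_pow 2 y).div_const 2
  · have := Real.norm_exp_I_mul_ofReal_sub_one_le (x := y)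
    rw [norm_eq_abs, abs_of_nonneg hy.1] at this
    calc _ = ‖(Complex.exp (Complex.I * y) - 1) * Complex.I‖ := by rw [mul_comm Complex.I]; ring_nf
      _ ≤ y := by rw [norm_mul, Complex.norm_I, mul_one]; exact this

/-- Conjugate characteristic function of the law putting mass `P a` at `v a`. -/
noncomputable def charConj {α : Type*} [Fintype α] (P v : α → ℝ) (s : ℝ) : ℂ :=
  ∑ a, (P a : ℂ) * Complex.exp (((-(s * v a) : ℝ) : ℂ) * Complex.I)

/-- The law putting mass `P a` at `v a` is standardized. -/
structure Standardized {α : Type*} [Fintype α] (P v : α → ℝ) : Prop where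
  nonneg : ∀ a, 0 ≤ P a
  sum : ∑ a, P a = 1
  mean : ∑ a, P a * v a = 0
  var : ∑ a, P a * v a ^ 2 = 1

section
variable {α : Type*} [Fintype α] {P v : α → ℝ}

lemma Standardized.sum_abs_le (h : Standardized P v) : ∑ a, P a * |v a| ≤ 1 := by
  have : ∑ a, P a * |v a| ≤ ∑ a, (P a + P a * v a ^ 2) / 2 := by
    refine Finset.sum_le_sum fun a _ => ?_
    rw [← sq_abs]
    nlinarith [mul_nonneg (h.nonneg a) (sq_nonneg (|v a| - 1))]
  rwa [← Finset.sum_div, Finset.sum_add_distrib, h.sum, h.var, add_self_div_two] at this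

lemma Standardized.one_le_third (h : Standardized P v) : 1 ≤ ∑ a, P a * |v a| ^ 3 := by
  have : ∑ a, (3 * (P a * v a ^ 2) - P a) / 2 ≤ ∑ a, P a * |v a| ^ 3 := by
    refine Finset.sum_le_sum fun a _ => ?_
    rw [← sq_abs]
    have h0 := abs_nonneg (v a)
    nlinarith [mul_nonneg (h.nonneg a) (mul_nonneg (sq_nonneg (|v a| - 1))
      (by linarith : 0 ≤ |v a| + 1 / 2))]
  rw [← Finset.sum_div, Finset.sum_sub_distrib, ← Finset.mul_sum, h.sum, h.var] at this
  linarith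

lemma Standardized.norm_charConj_le_one (h : Standardized P v) (s : ℝ) : ‖charConj P v s‖ ≤ 1 := by
  refine (norm_sum_le _ _).trans (le_of_eq ?_)
  rw [← h.sum]
  refine Finset.sum_congr rfl fun a _ => ?_
  rw [norm_mul, Complex.norm_real, norm_of_nonneg (h.nonneg a), Complex.norm_exp_ofReal_mul_I,
    mul_one]

lemma Standardized.sum_sum_abs_sub_cube_le (h : Standardized P v) :
    ∑ a, ∑ b, P a * P b * |v a - v b| ^ 3 ≤ 2 * (∑ a, P a * |v a| ^ 3 + 1) := by
  have h1 : ∀ a b, P a * P b * |v a - v b| ^ 3 ≤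
      (P a * |v a| ^ 3) * P b + (P a * v a ^ 2) * (P b * |v b|)
      - 2 * (P a * (v a * |v a|)) * (P b * v b) - 2 * (P a * v a) * (P b * (v b * |v b|))
      + (P a * |v a|) * (P b * v b ^ 2) + P a * (P b * |v b| ^ 3) := by
    intro a b
    have e : |v a - v b| ^ 3 ≤ (v a - v b) ^ 2 * (|v a| + |v b|) := by
      rw [pow_succ, sq_abs]
      exact mul_le_mul_of_nonneg_left (abs_sub _ _) (sq_nonneg _)
    refine (mul_le_mul_of_nonneg_left e (mul_nonneg (h.nonneg a) (h.nonneg b))).trans (le_of_eq ?_)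
    rw [pow_succ |v a|, pow_succ |v b|, sq_abs, sq_abs]
    ring
  refine (Finset.sum_le_sum fun a _ => Finset.sum_le_sum fun b _ => h1 a b).trans ?_
  simp_rw [Finset.sum_add_distrib, Finset.sum_sub_distrib, Finset.sum_add_distrib,
    ← Finset.mul_sum, ← Finset.sum_mul, ← Finset.mul_sum, h.sum, h.var, h.mean]
  simp only [mul_zero, zero_mul, mul_one, one_mul, sub_zero]
  linarith [h.sum_abs_le]

lemma Standardized.normSq_charConj (s : ℝ) :
    ‖charConj P v s‖ ^ 2 = ∑ a, ∑ b, P a * P b * cos (s * (v a - v b)) := by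
  have re : (charConj P v s).re = ∑ a, P a * cos (s * v a) := by
    rw [charConj, Complex.re_sum]
    refine Finset.sum_congr rfl fun a _ => ?_
    rw [Complex.re_ofReal_mul, Complex.exp_ofReal_mul_I_re, cos_neg]
  have im : (charConj P v s).im = ∑ a, P a * -sin (s * v a) := by
    rw [charConj, Complex.im_sum]
    refine Finset.sum_congr rfl fun a _ => ?_
    rw [Complex.im_ofReal_mul, Complex.exp_ofReal_mul_I_im, sin_neg]
  rw [Complex.sq_norm, Complex.normSq_apply, re, im, Finset.sum_mul_sum, Finset.sum_mul_sum,
    ← Finset.sum_add_distrib]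
  refine Finset.sum_congr rfl fun a _ => ?_
  rw [← Finset.sum_add_distrib]
  refine Finset.sum_congr rfl fun b _ => ?_
  rw [mul_sub, cos_sub]
  ring

lemma Standardized.normSq_charConj_le (h : Standardized P v) {s : ℝ} (hs : 0 ≤ s) :
    ‖charConj P v s‖ ^ 2 ≤ 1 - s ^ 2 + (∑ a, P a * |v a| ^ 3 + 1) * s ^ 3 / 5 := by
  rw [Standardized.normSq_charConj]
  have h1 : ∀ a b, P a * P b * cos (s * (v a - v b)) ≤
      P a * P b - s ^ 2 / 2 * ((P a * v a ^ 2) * P b + P a * (P b * v b ^ 2)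
        - 2 * (P a * v a) * (P b * v b)) + s ^ 3 / 10 * (P a * P b * |v a - v b| ^ 3) := by
    intro a b
    have := cos_le_cubic (s * (v a - v b))
    rw [abs_mul, abs_of_nonneg hs] at this
    refine (mul_le_mul_of_nonneg_left this (mul_nonneg (h.nonneg a) (h.nonneg b))).trans
      (le_of_eq ?_)
    ring
  refine (Finset.sum_le_sum fun a _ => Finset.sum_le_sum fun b _ => h1 a b).trans ?_
  have h2 := h.sum_sum_abs_sub_cube_le
  simp_rw [Finset.sum_add_distrib, Finset.sum_sub_distrib, ← Finset.mul_sum,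
    Finset.sum_sub_distrib, Finset.sum_add_distrib,
    ← Finset.mul_sum, ← Finset.sum_mul, ← Finset.mul_sum, h.sum, h.var, h.mean]
  simp only [mul_zero, mul_one, sub_zero]
  have := mul_le_mul_of_nonneg_left h2 (by positivity : 0 ≤ s ^ 3 / 10)
  linarith

lemma Standardized.norm_charConj_le (h : Standardized P v) {s : ℝ} (hs : 0 ≤ s) :
    ‖charConj P v s‖ ≤ Real.exp (-s ^ 2 / 2 + (∑ a, P a * |v a| ^ 3 + 1) * s ^ 3 / 10) := by
  refine (sq_le_sq₀ (norm_nonneg _) (exp_pos _).le).1 ?_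
  refine (h.normSq_charConj_le hs).trans ?_
  rw [← exp_nat_mul]
  refine le_trans (le_of_eq ?_) (add_one_le_exp _)
  push_cast
  ring

end

section
variable {α : Type*} [Fintype α] {P v : α → ℝ}

lemma hasDerivAt_charConj (s : ℝ) : HasDerivAt (charConj P v)
    (∑ a, (P a : ℂ) * (Complex.exp (((-(s * v a) : ℝ) : ℂ) * Complex.I) *
      (((-(1 * v a) : ℝ) : ℂ) * Complex.I))) s := by
  refine HasDerivAt.fun_sum fun a _ => HasDerivAt.const_mul _ (HasDerivAt.cexp ?_)
  exact (HasDerivAt.ofReal_comp ((hasDerivAt_id s).mul_const (v a)).neg).mul_const _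

lemma Standardized.norm_deriv_add_le (h : Standardized P v) {s : ℝ} (hs : 0 ≤ s) :
    ‖(∑ a, (P a : ℂ) * (Complex.exp (((-(s * v a) : ℝ) : ℂ) * Complex.I) *
      (((-(1 * v a) : ℝ) : ℂ) * Complex.I))) + s * charConj P v s‖ ≤
      (∑ a, P a * |v a| ^ 3) * s ^ 2 / 2 + s ^ 3 / 2 := by
  set r : α → ℂ := fun a => Complex.exp (((-(s * v a) : ℝ) : ℂ) * Complex.I) - 1
    - ((-(s * v a) : ℝ) : ℂ) * Complex.I with hr
  have e : (∑ a, (P a : ℂ) * (Complex.exp (((-(s * v a) : ℝ) : ℂ) * Complex.I) *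
      (((-(1 * v a) : ℝ) : ℂ) * Complex.I))) + s * charConj P v s =
      ∑ a, (P a : ℂ) * ((((-(v a) : ℝ) : ℂ) * Complex.I + s) * r a) := by
    have h0 : ((∑ a, P a : ℝ) : ℂ) = 1 := by rw [h.sum]; simp
    have h1 : ((∑ a, P a * v a : ℝ) : ℂ) = 0 := by rw [h.mean]; simp
    have h2 : ((∑ a, P a * v a ^ 2 : ℝ) : ℂ) = 1 := by rw [h.var]; simp
    have e1 : ∀ a, (P a : ℂ) * (Complex.exp (((-(s * v a) : ℝ) : ℂ) * Complex.I) *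
        (((-(1 * v a) : ℝ) : ℂ) * Complex.I)) +
        s * ((P a : ℂ) * Complex.exp (((-(s * v a) : ℝ) : ℂ) * Complex.I)) =
        (P a : ℂ) * ((((-(v a) : ℝ) : ℂ) * Complex.I + s) * r a) +
        (s * (P a : ℝ) - ((P a * v a : ℝ) : ℂ) * (Complex.I + s ^ 2 * Complex.I)
          - s * ((P a * v a ^ 2 : ℝ) : ℂ)) := by
      intro a
      simp only [hr]
      push_cast
      linear_combination ((P a : ℂ) * s * (v a) ^ 2) * Complex.I_sq
    rw [charConj, Finset.mul_sum, ← Finset.sum_add_distrib, Finset.sum_congr rfl fun a _ => e1 a,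
      Finset.sum_add_distrib, Finset.sum_sub_distrib, Finset.sum_sub_distrib, ← Finset.mul_sum,
      ← Finset.sum_mul, ← Finset.mul_sum, ← Complex.ofReal_sum, ← Complex.ofReal_sum,
      ← Complex.ofReal_sum, h0, h1, h2]
    ring
  rw [e]
  refine (norm_sum_le _ _).trans ?_
  have h1 : ∀ a, ‖(P a : ℂ) * ((((-(v a) : ℝ) : ℂ) * Complex.I + s) * r a)‖ ≤
      s ^ 2 / 2 * (P a * |v a| ^ 3) + s ^ 3 / 2 * (P a * v a ^ 2) := by
    intro a
    have b1 : ‖((-(v a) : ℝ) : ℂ) * Complex.I + s‖ ≤ |v a| + s := by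
      refine (norm_add_le _ _).trans (le_of_eq ?_)
      rw [norm_mul, Complex.norm_I, mul_one, Complex.norm_real, Complex.norm_real, norm_neg,
        norm_eq_abs, norm_eq_abs, abs_of_nonneg hs]
    have b2 : ‖r a‖ ≤ s ^ 2 * |v a| ^ 2 / 2 :=
      (norm_cexp_sub_one_sub_le _).trans (le_of_eq (by rw [sq_abs]; ring))
    rw [norm_mul, norm_mul, Complex.norm_real, norm_of_nonneg (h.nonneg a)]
    calc P a * (‖((-(v a) : ℝ) : ℂ) * Complex.I + s‖ * ‖r a‖)
        ≤ P a * ((|v a| + s) * (s ^ 2 * |v a| ^ 2 / 2)) :=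
          mul_le_mul_of_nonneg_left (mul_le_mul b1 b2 (norm_nonneg _) (by positivity)) (h.nonneg a)
      _ = _ := by rw [← sq_abs (v a)]; ring
  refine (Finset.sum_le_sum fun a _ => h1 a).trans (le_of_eq ?_)
  rw [Finset.sum_add_distrib, ← Finset.mul_sum, ← Finset.mul_sum, h.var]
  ring

lemma exp_cube_le {c r t : ℝ} (hr : 0 ≤ r) (hrt : r ≤ t) (ht : 0 < t) :
    Real.exp (c * r ^ 3) ≤ 1 + (r / t) ^ 3 * (Real.exp (c * t ^ 3) - 1) := by
  have hq : (r / t) ^ 3 ≤ 1 := pow_le_one₀ (by positivity) ((div_le_one ht).2 hrt)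
  have hq0 : 0 ≤ (r / t) ^ 3 := by positivity
  have := convexOn_exp.2 (mem_univ 0) (mem_univ (c * t ^ 3)) (sub_nonneg.2 hq) hq0 (by ring)
  simp only [smul_eq_mul, mul_zero, zero_add, Real.exp_zero, mul_one] at this
  have e : (r / t) ^ 3 * (c * t ^ 3) = c * r ^ 3 := by field_simp
  rw [e] at this
  linarith

lemma Standardized.norm_charConj_pow_le (h : Standardized P v) {n : ℕ} (hn : 0 < n) (k : ℕ)
    {t : ℝ} (ht : 0 ≤ t) : ‖charConj P v (t / √n)‖ ^ k ≤
      Real.exp (k / n * (-t ^ 2 / 2 + (∑ a, P a * |v a| ^ 3 + 1) / √n * t ^ 3 / 10)) := by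
  have hn' : (0 : ℝ) < n := by exact_mod_cast hn
  refine (pow_le_pow_left₀ (norm_nonneg _) (h.norm_charConj_le (by positivity)) k).trans
    (le_of_eq ?_)
  rw [← exp_nat_mul]
  congr 1
  have e : √(n : ℝ) ^ 2 = n := sq_sqrt hn'.le
  have e3 : √(n : ℝ) ^ 3 = n * √n := by rw [pow_succ, e]
  rw [div_pow, div_pow, e, e3]
  field_simp

lemma Standardized.norm_charConj_pow_sub_le (h : Standardized P v) {n : ℕ} (hn : 0 < n)
    {t : ℝ} (ht : 0 < t) :
    ‖charConj P v (t / √n) ^ n - (Real.exp (-(t ^ 2) / 2) : ℝ)‖ ≤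
      Real.exp (-((1 - 1 / n) * t ^ 2 / 2)) *
        ((1 + Real.exp ((∑ a, P a * |v a| ^ 3 + 1) / √n / 10 * t ^ 3)) / 2 *
          ((∑ a, P a * |v a| ^ 3) / √n * t ^ 3 / 6 + t ^ 4 / (7 * n))) := by
  set T := ∑ a, P a * |v a| ^ 3 with hT
  have hT1 : 1 ≤ T := h.one_le_third
  have hn' : (0 : ℝ) < n := by exact_mod_cast hn
  have hs : 0 < √(n : ℝ) := sqrt_pos.2 hn'
  have hss : √(n : ℝ) * √n = n := mul_self_sqrt hn'.le
  set c := (T + 1) / √n / 10 with hc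
  have hc0 : 0 ≤ c := by positivity
  set E := Real.exp (c * t ^ 3) with hE
  have hE1 : 1 ≤ E := one_le_exp (by positivity)
  set d : ℝ → ℂ := fun s => ∑ a, (P a : ℂ) * (Complex.exp (((-(s * v a) : ℝ) : ℂ) * Complex.I) *
      (((-(1 * v a) : ℝ) : ℂ) * Complex.I)) with hd
  set G : ℝ → ℂ := fun r => charConj P v (r / √n) ^ n * (Real.exp (r ^ 2 / 2) : ℝ) - 1 with hG
  have hG' : ∀ r, HasDerivAt G (√n * charConj P v (r / √n) ^ (n - 1) *
      (Real.exp (r ^ 2 / 2) : ℝ) * (d (r / √n) + (r / √n : ℝ) * charConj P v (r / √n))) r := by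
    intro r
    have h1 : HasDerivAt (fun r : ℝ => charConj P v (r / √n)) ((1 / √n : ℝ) • d (r / √n)) r :=
      HasDerivAt.scomp (h := fun r : ℝ => r / √n) r (hasDerivAt_charConj (r / √n))
        ((hasDerivAt_id r).div_const _)
    have h2 : HasDerivAt (fun r : ℝ => ((Real.exp (r ^ 2 / 2) : ℝ) : ℂ))
        ((Real.exp (r ^ 2 / 2) * r : ℝ) : ℂ) r := by
      refine HasDerivAt.ofReal_comp (HasDerivAt.exp ?_)
      simpa using (hasDerivAt_pow 2 r).div_const 2
    refine (((h1.pow n).mul h2).sub_const 1).congr_deriv ?_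
    obtain ⟨k, rfl⟩ := Nat.exists_eq_add_of_le' hn
    simp only [Complex.real_smul, Nat.add_sub_cancel, Pi.pow_apply, Nat.succ_eq_add_one]
    generalize charConj P v (r / √((k + 1 : ℕ) : ℝ)) = F
    generalize d (r / √((k + 1 : ℕ) : ℝ)) = D
    have hss' : ((√((k + 1 : ℕ) : ℝ) : ℝ) : ℂ) * (√((k + 1 : ℕ) : ℝ) : ℝ) = ((k + 1 : ℕ) : ℂ) := by
      exact_mod_cast congrArg (fun x : ℝ => (x : ℂ)) hss
    have hs' : ((√((k + 1 : ℕ) : ℝ) : ℝ) : ℂ) ≠ 0 := by exact_mod_cast hs.ne'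
    rw [← hss']
    generalize √((k + 1 : ℕ) : ℝ) = q at hs' ⊢
    push_cast
    field_simp
    ring
  set L := T / √n with hL
  set K := Real.exp (1 / n * t ^ 2 / 2) with hK
  set B : ℝ → ℝ := fun r => K * (L * r ^ 3 / 6 + r ^ 4 / (8 * n) +
    (E - 1) / t ^ 3 * (L * r ^ 6 / 12 + r ^ 7 / (14 * n))) with hB
  set B' : ℝ → ℝ := fun r => K * (L * r ^ 2 / 2 + r ^ 3 / (2 * n) +
    (E - 1) / t ^ 3 * (L * r ^ 5 / 2 + r ^ 6 / (2 * n))) with hB'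
  have key := image_norm_le_of_norm_deriv_right_le_deriv_boundary (a := 0) (b := t) (f := G)
    (B := B) (B' := B') (fun r _ => (hG' r).continuousAt.continuousWithinAt)
    (fun r _ => (hG' r).hasDerivWithinAt) ?_ ?_ ?_
  · have kt := key (right_mem_Icc.2 ht.le)
    have e1 : charConj P v (t / √n) ^ n - (Real.exp (-(t ^ 2) / 2) : ℝ) =
        (Real.exp (-(t ^ 2) / 2) : ℝ) * G t := by
      have : ((Real.exp (-(t ^ 2) / 2) : ℝ) : ℂ) * (Real.exp (t ^ 2 / 2) : ℝ) = 1 := by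
        rw [← Complex.ofReal_mul, ← Real.exp_add]
        simp [neg_div]
      simp only [hG]
      linear_combination (-charConj P v (t / √n) ^ n) * this
    rw [e1, norm_mul, Complex.norm_real, norm_of_nonneg (exp_pos _).le]
    refine (mul_le_mul_of_nonneg_left kt (exp_pos _).le).trans ?_
    have e2 : Real.exp (-((1 - 1 / n) * t ^ 2 / 2)) = Real.exp (-(t ^ 2) / 2) * K := by
      rw [hK, ← Real.exp_add]
      ring_nf
    rw [e2, mul_assoc]
    refine mul_le_mul_of_nonneg_left (mul_le_mul_of_nonneg_left ?_ (exp_pos _).le) (exp_pos _).le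
    have e3 : (E - 1) / t ^ 3 * (L * t ^ 6 / 12 + t ^ 7 / (14 * n)) =
        (E - 1) * (L * t ^ 3 / 12 + t ^ 4 / (14 * n)) := by
      field_simp
    rw [e3]
    have e4 : t ^ 4 / (8 * n) ≤ t ^ 4 / (7 * n) := by gcongr; norm_num
    have e5 : t ^ 4 / (14 * n) = t ^ 4 / (7 * n) / 2 := by field_simp; norm_num
    rw [e5]
    nlinarith
  · have h0 : charConj P v 0 = 1 := by
      simp only [charConj, zero_mul, neg_zero, Complex.ofReal_zero, Complex.exp_zero, mul_one]
      rw [← Complex.ofReal_sum, h.sum, Complex.ofReal_one]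
    simp [hG, hB, h0]
  · intro r
    have p : ∀ k : ℕ, HasDerivAt (fun r : ℝ => r ^ k) (k * r ^ (k - 1)) r :=
      fun k => hasDerivAt_pow k r
    have := (((((p 3).const_mul L).div_const 6).add ((p 4).div_const (8 * n))).add
      (((((p 6).const_mul L).div_const 12).add ((p 7).div_const (14 * n))).const_mul
        ((E - 1) / t ^ 3))).const_mul K
    refine this.congr_deriv ?_
    simp only [hB']
    push_cast
    field_simp
    ring
  · intro r hr
    have hr0 := hr.1
    rw [norm_mul, norm_mul, norm_mul, norm_pow, Complex.norm_real, Complex.norm_real,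
      norm_of_nonneg hs.le, norm_of_nonneg (exp_pos _).le]
    have b1 := h.norm_deriv_add_le (s := r / √n) (by positivity)
    have b2 := h.norm_charConj_pow_le hn (n - 1) hr0
    have b3 := exp_cube_le (c := c) hr0 hr.2.le ht
    have hq : (((n - 1 : ℕ) : ℝ) / n) = 1 - 1 / n := by
      rw [Nat.cast_sub hn]; field_simp; simp
    rw [hq] at b2
    have b4 : Real.exp ((1 - 1 / n) * (-r ^ 2 / 2 + (T + 1) / √n * r ^ 3 / 10)) *
        Real.exp (r ^ 2 / 2) ≤ K * Real.exp (c * r ^ 3) := by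
      rw [hK, ← Real.exp_add, ← Real.exp_add]
      apply exp_le_exp.2
      have e6 : (T + 1) / √n * r ^ 3 / 10 = c * r ^ 3 := by simp only [hc]; ring
      rw [e6]
      have i1 : 0 ≤ (1 : ℝ) / n * (c * r ^ 3) := by positivity
      have i2 : 0 ≤ (1 : ℝ) / n * (t ^ 2 - r ^ 2) :=
        mul_nonneg (by positivity) (by nlinarith [hr.2])
      linarith
    have e7 : √(n : ℝ) * (T * (r / √n) ^ 2 / 2 + (r / √n) ^ 3 / 2) =
        L * r ^ 2 / 2 + r ^ 3 / (2 * n) := by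
      simp only [hL]
      generalize hq : √(n : ℝ) = q at hss hs
      rw [← hss]
      field_simp
    set F := ‖charConj P v (r / √n)‖ ^ (n - 1)
    have b1' := mul_le_mul_of_nonneg_left b1 hs.le
    rw [e7] at b1'
    have n1 : 0 ≤ L * r ^ 2 / 2 + r ^ 3 / (2 * n) := by positivity
    calc √n * F * Real.exp (r ^ 2 / 2) * ‖d (r / √n) + (r / √n : ℝ) * charConj P v (r / √n)‖
        = (F * Real.exp (r ^ 2 / 2)) *
          (√n * ‖d (r / √n) + (r / √n : ℝ) * charConj P v (r / √n)‖) := by ring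
      _ ≤ (K * (1 + (r / t) ^ 3 * (E - 1))) * (L * r ^ 2 / 2 + r ^ 3 / (2 * n)) := by
          refine mul_le_mul ?_ b1' (by positivity)
            (mul_nonneg (exp_pos _).le (add_nonneg zero_le_one
              (mul_nonneg (by positivity) (sub_nonneg.2 hE1))))
          exact ((mul_le_mul_of_nonneg_right b2 (exp_pos _).le).trans b4).trans
            (mul_le_mul_of_nonneg_left b3 (exp_pos _).le)
      _ = B' r := by
          simp only [hB']
          field_simp

end

lemma integrableOn_pow_mul_exp_neg {b : ℝ} (hb : 0 < b) (k : ℕ) :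
    IntegrableOn (fun t : ℝ => t ^ k * Real.exp (-(b * t ^ 2 / 2))) (Ioi 0) := by
  have := integrableOn_rpow_mul_exp_neg_mul_sq (b := b / 2) (by positivity) (s := k)
    (by have : (0 : ℝ) ≤ k := k.cast_nonneg
        linarith)
  refine this.congr_fun (fun t _ => ?_) measurableSet_Ioi
  simp only [rpow_natCast]
  ring_nf

lemma integral_pow_mul_exp_neg {b : ℝ} (hb : 0 < b) (k : ℕ) :
    ∫ t in Ioi (0 : ℝ), t ^ k * Real.exp (-(b * t ^ 2 / 2)) =
      (b / 2) ^ (-((k : ℝ) + 1) / 2) * (1 / 2) * Gamma ((k + 1) / 2) := by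
  rw [← integral_rpow_mul_exp_neg_mul_rpow (p := 2) (q := k) (b := b / 2) (by norm_num)
    (by have : (0 : ℝ) ≤ k := k.cast_nonneg
        linarith) (by positivity)]
  refine setIntegral_congr_fun measurableSet_Ioi fun t _ => ?_
  simp only [rpow_natCast, rpow_two]
  ring_nf

lemma integral_sq_mul_exp_neg {b : ℝ} (hb : 0 < b) :
    ∫ t in Ioi (0 : ℝ), t ^ 2 * Real.exp (-(b * t ^ 2 / 2)) = √(π / 2) / (b * √b) := by
  have hg := Real.Gamma_nat_add_half 1
  norm_num at hg
  rw [integral_pow_mul_exp_neg hb, show -(((2 : ℕ) : ℝ) + 1) / 2 = -(1 + 1 / 2) by norm_num,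
    rpow_neg (by positivity), rpow_add (by positivity), ← sqrt_eq_rpow, rpow_one,
    show (((2 : ℕ) : ℝ) + 1) / 2 = 3 / 2 by norm_num, hg, sqrt_div' _ (by norm_num),
    sqrt_div' _ (by norm_num)]
  have h2 : √(2 : ℝ) * √2 = 2 := mul_self_sqrt (by norm_num)
  have := sqrt_pos.2 hb
  field_simp
  nlinarith

lemma integral_cube_mul_exp_neg {b : ℝ} (hb : 0 < b) :
    ∫ t in Ioi (0 : ℝ), t ^ 3 * Real.exp (-(b * t ^ 2 / 2)) = 2 / b ^ 2 := by
  rw [integral_pow_mul_exp_neg hb, show -(((3 : ℕ) : ℝ) + 1) / 2 = -(2 : ℕ) by norm_num,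
    rpow_neg (by positivity), rpow_natCast,
    show (((3 : ℕ) : ℝ) + 1) / 2 = 2 by norm_num, Gamma_two]
  field_simp

lemma integral_fourth_mul_exp_neg {b : ℝ} (hb : 0 < b) :
    ∫ t in Ioi (0 : ℝ), t ^ 4 * Real.exp (-(b * t ^ 2 / 2)) = 3 * √(π / 2) / (b ^ 2 * √b) := by
  have hg := Real.Gamma_nat_add_half 2
  norm_num at hg
  rw [integral_pow_mul_exp_neg hb, show -(((4 : ℕ) : ℝ) + 1) / 2 = -((2 : ℕ) + 1 / 2) by norm_num,
    rpow_neg (by positivity), rpow_add (by positivity), ← sqrt_eq_rpow, rpow_natCast,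
    show (((4 : ℕ) : ℝ) + 1) / 2 = 5 / 2 by norm_num, hg, sqrt_div' _ (by norm_num),
    sqrt_div' _ (by norm_num)]
  have h2 : √(2 : ℝ) * √2 = 2 := mul_self_sqrt (by norm_num)
  have := sqrt_pos.2 hb
  field_simp
  try nlinarith

lemma charDiff_iid {α : Type*} [Fintype α] (P v : α → ℝ) (n : ℕ) (t : ℝ) :
    charDiff Finset.univ (fun z : Fin n → α => ∏ i, P (z i)) (fun z => (∑ i, v (z i)) / √n) t =
      charConj P v (t / √n) ^ n - (Real.exp (-(t ^ 2) / 2) : ℝ) := by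
  rw [charDiff, charConj, Fintype.sum_pow]
  congr 1
  refine Finset.sum_congr rfl fun z _ => ?_
  rw [Finset.prod_mul_distrib, ← Complex.exp_sum, ← Finset.sum_mul]
  congr 2
  · push_cast; rfl
  · congr 1
    rw [← Complex.ofReal_sum]
    congr 1
    rw [Finset.sum_neg_distrib, ← Finset.mul_sum]
    ring

/-- Small-frequency majorant for the difference of characteristic functions. -/
noncomputable def smallFreq (L n U a t : ℝ) : ℝ :=
  (L * t ^ 2 / 6 + t ^ 3 / (7 * n)) * (Real.exp (-(a * t ^ 2 / 2)) +
    t / U * (Real.exp (-((a - 0.42) * t ^ 2 / 2)) - Real.exp (-(a * t ^ 2 / 2))))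

section
variable {α : Type*} [Fintype α] {P v : α → ℝ}

lemma Standardized.norm_sub_le_small (h : Standardized P v) {n : ℕ} (hn : 0 < n) {U : ℝ}
    (hU : U = 4.2 / ((∑ a, P a * |v a| ^ 3 + 1) / √n)) {t : ℝ} (ht : 0 < t) (htU : t ≤ U / 2) :
    ‖charConj P v (t / √n) ^ n - (Real.exp (-(t ^ 2) / 2) : ℝ)‖ ≤
      t * smallFreq ((∑ a, P a * |v a| ^ 3) / √n) n U (1 - 1 / n) t := by
  have h0 := h.norm_charConj_pow_sub_le hn ht
  set T := ∑ a, P a * |v a| ^ 3 with hT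
  have hT1 : 1 ≤ T := h.one_le_third
  have hn' : (0 : ℝ) < n := by exact_mod_cast hn
  have hs : 0 < √(n : ℝ) := sqrt_pos.2 hn'
  have hU0 : 0 < U := by rw [hU]; positivity
  have hc : (T + 1) / √n / 10 = 0.42 / U := by
    rw [hU]; field_simp; norm_num
  rw [hc] at h0
  refine h0.trans ?_
  have hE : Real.exp (0.42 / U * t ^ 3) ≤ 1 + 2 * (t / U) * (Real.exp (0.42 * t ^ 2 / 2) - 1) := by
    have hq : 2 * (t / U) ≤ 1 := by
      rw [← mul_div_assoc, div_le_one hU0]; linarith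
    have := convexOn_exp.2 (mem_univ 0) (mem_univ (0.42 * t ^ 2 / 2)) (sub_nonneg.2 hq)
      (by positivity : 0 ≤ 2 * (t / U)) (by ring)
    simp only [smul_eq_mul, mul_zero, zero_add, Real.exp_zero, mul_one] at this
    have e : 2 * (t / U) * (0.42 * t ^ 2 / 2) = 0.42 / U * t ^ 3 := by field_simp
    rw [e] at this
    linarith
  have hb : Real.exp (-((1 - 1 / n - 0.42) * t ^ 2 / 2)) =
      Real.exp (-((1 - 1 / n) * t ^ 2 / 2)) * Real.exp (0.42 * t ^ 2 / 2) := by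
    rw [← Real.exp_add]; ring_nf
  have hw : 0 ≤ T / √n * t ^ 3 / 6 + t ^ 4 / (7 * n) := by positivity
  set w := T / √n * t ^ 3 / 6 + t ^ 4 / (7 * n) with hwd
  set e := Real.exp (-((1 - 1 / (n : ℝ)) * t ^ 2 / 2))
  have he : 0 < e := exp_pos _
  have hfin : t * smallFreq (T / √n) n U (1 - 1 / n) t =
      w * (e + t / U * (e * Real.exp (0.42 * t ^ 2 / 2) - e)) := by
    have hed : Real.exp (-((1 - 1 / (n : ℝ)) * t ^ 2 / 2)) = e := rfl
    rw [smallFreq, hb, hed, hwd]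
    clear_value e
    field_simp
  rw [hfin]
  calc _ = e * w * ((1 + Real.exp (0.42 / U * t ^ 3)) / 2) := by ring
    _ ≤ e * w * ((1 + (1 + 2 * (t / U) * (Real.exp (0.42 * t ^ 2 / 2) - 1))) / 2) := by gcongr
    _ = _ := by ring

lemma Standardized.norm_sub_le_mid (h : Standardized P v) {n : ℕ} (hn : 0 < n) {U : ℝ}
    (hU : U = 4.2 / ((∑ a, P a * |v a| ^ 3 + 1) / √n)) {t : ℝ} (ht : U / 2 ≤ t) (htU : t ≤ U) :
    ‖charConj P v (t / √n) ^ n - (Real.exp (-(t ^ 2) / 2) : ℝ)‖ ≤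
      Real.exp (-(0.0725 * U ^ 2)) + Real.exp (-(0.125 * U ^ 2)) := by
  set T := ∑ a, P a * |v a| ^ 3 with hT
  have hT1 : 1 ≤ T := h.one_le_third
  have hn' : (0 : ℝ) < n := by exact_mod_cast hn
  have hs : 0 < √(n : ℝ) := sqrt_pos.2 hn'
  have hU0 : 0 < U := by rw [hU]; positivity
  have hc : (T + 1) / √n = 4.2 / U := by
    rw [hU]; field_simp
  have ht0 : 0 < t := by linarith
  refine (norm_sub_le _ _).trans (add_le_add ?_ ?_)
  · rw [norm_pow]
    refine (h.norm_charConj_pow_le hn n ht0.le).trans (exp_le_exp.2 ?_)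
    rw [← hT, hc, div_self hn'.ne', one_mul]
    obtain ⟨y, rfl⟩ : ∃ y, t = y * U := ⟨t / U, by field_simp⟩
    have y1 : 1 / 2 ≤ y := by by_contra! hh; nlinarith
    have y2 : y ≤ 1 := by by_contra! hh; nlinarith
    have e : 4.2 / U * (y * U) ^ 3 / 10 = 0.42 * y ^ 3 * U ^ 2 := by field_simp; norm_num
    rw [e]
    have : 0.145 ≤ y ^ 2 - 0.84 * y ^ 3 := by
      nlinarith [mul_nonneg (sub_nonneg.2 y1) (sub_nonneg.2 y2),
        mul_nonneg (mul_nonneg (sub_nonneg.2 y1) (sub_nonneg.2 y2)) (by linarith : 0 ≤ y)]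
    nlinarith [mul_nonneg (sub_nonneg.2 this) (sq_nonneg U)]
  · rw [Complex.norm_real, norm_of_nonneg (exp_pos _).le]
    exact exp_le_exp.2 (by nlinarith)

lemma Standardized.norm_sub_le_large (h : Standardized P v) {n : ℕ} {U : ℝ} (hU : 0 < U)
    {t : ℝ} (ht : U ≤ t) :
    ‖charConj P v (t / √n) ^ n - (Real.exp (-(t ^ 2) / 2) : ℝ)‖ ≤
      1 + Real.exp (-(0.5 * U ^ 2)) := by
  refine (norm_sub_le _ _).trans (add_le_add ?_ ?_)
  · rw [norm_pow]
    exact pow_le_one₀ (norm_nonneg _) (h.norm_charConj_le_one _)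
  · rw [Complex.norm_real, norm_of_nonneg (exp_pos _).le]
    exact exp_le_exp.2 (by nlinarith)

end

lemma smallFreq_eq (L n U a : ℝ) : smallFreq L n U a = fun t =>
    (L / 6) * (t ^ 2 * Real.exp (-(a * t ^ 2 / 2))) +
    (1 / (7 * n)) * (t ^ 3 * Real.exp (-(a * t ^ 2 / 2))) +
    ((L / (6 * U)) * (t ^ 3 * Real.exp (-((a - 0.42) * t ^ 2 / 2))) -
      (L / (6 * U)) * (t ^ 3 * Real.exp (-(a * t ^ 2 / 2)))) +
    ((1 / (7 * n * U)) * (t ^ 4 * Real.exp (-((a - 0.42) * t ^ 2 / 2))) -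
      (1 / (7 * n * U)) * (t ^ 4 * Real.exp (-(a * t ^ 2 / 2)))) := by
  funext t
  rw [smallFreq]
  simp only [div_eq_mul_inv, mul_inv]
  ring

lemma integrableOn_smallFreq (L n U : ℝ) {a : ℝ} (ha : 0.42 < a) :
    IntegrableOn (smallFreq L n U a) (Ioi 0) := by
  have i1 := fun k => integrableOn_pow_mul_exp_neg (b := a) (by linarith) k
  have i2 := fun k => integrableOn_pow_mul_exp_neg (b := a - 0.42) (by linarith) k
  rw [smallFreq_eq]
  exact ((((i1 2).const_mul _).add ((i1 3).const_mul _)).add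
    (((i2 3).const_mul _).sub ((i1 3).const_mul _))).add
    (((i2 4).const_mul _).sub ((i1 4).const_mul _))

lemma integral_linear_comb {μ : Measure ℝ} {f₁ f₂ f₃ f₄ f₅ f₆ : ℝ → ℝ} (h₁ : Integrable f₁ μ)
    (h₂ : Integrable f₂ μ) (h₃ : Integrable f₃ μ) (h₄ : Integrable f₄ μ) (h₅ : Integrable f₅ μ)
    (h₆ : Integrable f₆ μ) (c₁ c₂ c₃ c₄ c₅ c₆ : ℝ) :
    ∫ t, (c₁ * f₁ t + c₂ * f₂ t + (c₃ * f₃ t - c₄ * f₄ t) + (c₅ * f₅ t - c₆ * f₆ t)) ∂μ =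
      c₁ * ∫ t, f₁ t ∂μ + c₂ * ∫ t, f₂ t ∂μ + (c₃ * ∫ t, f₃ t ∂μ - c₄ * ∫ t, f₄ t ∂μ) +
        (c₅ * ∫ t, f₅ t ∂μ - c₆ * ∫ t, f₆ t ∂μ) := by
  have g₁ : Integrable (fun t => c₁ * f₁ t + c₂ * f₂ t) μ :=
    (h₁.const_mul c₁).add (h₂.const_mul c₂)
  have g₂ : Integrable (fun t => c₃ * f₃ t - c₄ * f₄ t) μ :=
    (h₃.const_mul c₃).sub (h₄.const_mul c₄)
  have g₃ : Integrable (fun t => c₅ * f₅ t - c₆ * f₆ t) μ :=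
    (h₅.const_mul c₅).sub (h₆.const_mul c₆)
  have g₄ : Integrable (fun t => c₁ * f₁ t + c₂ * f₂ t + (c₃ * f₃ t - c₄ * f₄ t)) μ := g₁.add g₂
  rw [integral_add g₄ g₃, integral_add g₁ g₂, integral_add (h₁.const_mul c₁) (h₂.const_mul c₂),
    integral_sub (h₃.const_mul c₃) (h₄.const_mul c₄),
    integral_sub (h₅.const_mul c₅) (h₆.const_mul c₆)]
  simp only [integral_const_mul]

lemma integral_smallFreq_le {L n U a : ℝ} (hn : 0 < n) (hU : 0 < U) (ha : 0.42 < a) :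
    ∫ t in Ioi 0, smallFreq L n U a t ≤
      L / 6 * (√(π / 2) / (a * √a) + 2 / U * 0.42 *
        (1 / (a * (a - 0.42) ^ 2) + 1 / (a ^ 2 * (a - 0.42)))) +
      1 / (7 * n) * (2 / a ^ 2 + 3 * √(π / 2) / U / ((a - 0.42) ^ 2 * √(a - 0.42))) := by
  have ha0 : 0 < a := by linarith
  have hb0 : 0 < a - 0.42 := by linarith
  have i1 := fun k => integrableOn_pow_mul_exp_neg ha0 k
  have i2 := fun k => integrableOn_pow_mul_exp_neg hb0 k
  rw [smallFreq_eq, integral_linear_comb (i1 2) (i1 3) (i2 3) (i1 3) (i2 4) (i1 4)]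
  rw [integral_sq_mul_exp_neg ha0, integral_cube_mul_exp_neg ha0, integral_cube_mul_exp_neg hb0,
    integral_fourth_mul_exp_neg ha0, integral_fourth_mul_exp_neg hb0]
  have e : L / (6 * U) * (2 / (a - 0.42) ^ 2) - L / (6 * U) * (2 / a ^ 2) =
      L / 6 * (2 / U * 0.42 * (1 / (a * (a - 0.42) ^ 2) + 1 / (a ^ 2 * (a - 0.42)))) := by
    have h1 := hb0.ne'
    field_simp
    ring
  have p : 0 ≤ 1 / (7 * n * U) * (3 * √(π / 2) / (a ^ 2 * √a)) := by positivity
  have e2 : 1 / (7 * n * U) * (3 * √(π / 2) / ((a - 0.42) ^ 2 * √(a - 0.42))) =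
      1 / (7 * n) * (3 * √(π / 2) / U / ((a - 0.42) ^ 2 * √(a - 0.42))) := by
    generalize (a - 0.42) ^ 2 * √(a - 0.42) = w
    simp only [div_eq_mul_inv, mul_inv]
    ring
  rw [e2]
  linarith

lemma smallFreq_nonneg {L n U a t : ℝ} (hL : 0 ≤ L) (hn : 0 < n) (hU : 0 < U) (ht : 0 ≤ t) :
    0 ≤ smallFreq L n U a t := by
  unfold smallFreq
  refine mul_nonneg (by positivity) (add_nonneg (exp_pos _).le (mul_nonneg (by positivity)
    (sub_nonneg.2 (exp_le_exp.2 ?_))))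
  nlinarith [sq_nonneg t]

/-- Bound for the integrated difference of characteristic functions. -/
noncomputable def freqBound (L n U a : ℝ) : ℝ :=
  L / 6 * (√(π / 2) / (a * √a) + 2 / U * 0.42 *
        (1 / (a * (a - 0.42) ^ 2) + 1 / (a ^ 2 * (a - 0.42)))) +
      1 / (7 * n) * (2 / a ^ 2 + 3 * √(π / 2) / U / ((a - 0.42) ^ 2 * √(a - 0.42))) +
    Real.log 2 * (Real.exp (-(0.0725 * U ^ 2)) + Real.exp (-(0.125 * U ^ 2)))

lemma integral_inv_sq {a b : ℝ} (ha : 0 < a) (hab : a ≤ b) :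
    ∫ t in a..b, 1 / t ^ 2 = 1 / a - 1 / b := by
  have hd : ∀ x ∈ uIcc a b, HasDerivAt (fun t : ℝ => -(t⁻¹)) (1 / x ^ 2) x := by
    intro x hx
    rw [uIcc_of_le hab] at hx
    have := (hasDerivAt_inv (ha.trans_le hx.1).ne').neg
    refine this.congr_deriv ?_
    rw [neg_neg, one_div]
  rw [intervalIntegral.integral_eq_sub_of_hasDerivAt hd]
  · rw [one_div, one_div]; ring
  · refine ContinuousOn.intervalIntegrable fun x hx => ?_
    rw [uIcc_of_le hab] at hx
    have : x ≠ 0 := (ha.trans_le hx.1).ne'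
    exact ContinuousAt.continuousWithinAt (by fun_prop (disch := positivity))

/-- Majorant used in the smoothing inequality. -/
noncomputable def freqMajorant (L n U U' a K C t : ℝ) : ℝ :=
  smallFreq L n U a t + ((Icc (U / 2) U).indicator (fun t => K * (1 / t)) t +
    (Ioc U U').indicator (fun t => C * (1 / t ^ 2)) t)

section
variable {L n U U' a K C : ℝ}

lemma integrableOn_inv_Icc (hU : 0 < U) : IntegrableOn (fun t => K * (1 / t)) (Icc (U / 2) U) := by
  refine ContinuousOn.integrableOn_compact isCompact_Icc fun x hx => ?_
  have : 0 < x := by linarith [hx.1]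
  exact ContinuousAt.continuousWithinAt (by fun_prop (disch := positivity))

lemma integrableOn_inv_sq_Ioc (hU : 0 < U) :
    IntegrableOn (fun t => C * (1 / t ^ 2)) (Ioc U U') := by
  refine IntegrableOn.mono_set (ContinuousOn.integrableOn_compact isCompact_Icc fun x hx => ?_)
    Ioc_subset_Icc_self
  have : 0 < x := by linarith [hx.1]
  exact ContinuousAt.continuousWithinAt (by fun_prop (disch := positivity))

lemma integrableOn_freqMajorant (hU : 0 < U) (ha : 0.42 < a) :
    IntegrableOn (freqMajorant L n U U' a K C) (Ioi 0) := by
  refine (integrableOn_smallFreq L n U ha).add (Integrable.add ?_ ?_)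
  · exact ((integrableOn_inv_Icc hU).integrable_indicator measurableSet_Icc).integrableOn
  · exact ((integrableOn_inv_sq_Ioc hU).integrable_indicator measurableSet_Ioc).integrableOn

lemma integral_freqMajorant (hU : 0 < U) (hUU : U ≤ U') (ha : 0.42 < a) :
    ∫ t in Ioi 0, freqMajorant L n U U' a K C t =
      (∫ t in Ioi 0, smallFreq L n U a t) + (K * Real.log 2 + C * (1 / U - 1 / U')) := by
  have i1 : Integrable ((Icc (U / 2) U).indicator (fun t => K * (1 / t))) :=
    (integrableOn_inv_Icc hU).integrable_indicator measurableSet_Icc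
  have i2 : Integrable ((Ioc U U').indicator (fun t => C * (1 / t ^ 2))) :=
    (integrableOn_inv_sq_Ioc hU).integrable_indicator measurableSet_Ioc
  have i3 : IntegrableOn (fun t => (Icc (U / 2) U).indicator (fun t => K * (1 / t)) t +
    (Ioc U U').indicator (fun t => C * (1 / t ^ 2)) t) (Ioi 0) :=
    i1.integrableOn.add i2.integrableOn
  simp only [freqMajorant]
  rw [integral_add (integrableOn_smallFreq L n U ha) i3,
    integral_add i1.integrableOn i2.integrableOn, setIntegral_indicator measurableSet_Icc,
    setIntegral_indicator measurableSet_Ioc,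
    inter_eq_right.2 (show Icc (U / 2) U ⊆ Ioi 0 from fun x hx => by
      have := hx.1; rw [mem_Ioi]; linarith),
    inter_eq_right.2 (show Ioc U U' ⊆ Ioi 0 from fun x hx => by
      have := hx.1; rw [mem_Ioi]; linarith),
    integral_Icc_eq_integral_Ioc, ← intervalIntegral.integral_of_le (by linarith),
    ← intervalIntegral.integral_of_le hUU, intervalIntegral.integral_const_mul,
    intervalIntegral.integral_const_mul, integral_inv_sq hU hUU,
    integral_one_div_of_pos (by linarith) hU, show U / (U / 2) = 2 by field_simp]

lemma freqMajorant_nonneg (hL : 0 ≤ L) (hn : 0 < n) (hU : 0 < U) (hK : 0 ≤ K) (hC : 0 ≤ C) {t : ℝ}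
    (ht : 0 < t) : 0 ≤ freqMajorant L n U U' a K C t := by
  refine add_nonneg (smallFreq_nonneg hL hn hU ht.le) (add_nonneg ?_ ?_)
  · exact indicator_nonneg (fun x hx => by have : 0 < x := by linarith [hx.1]
                                           positivity) _
  · exact indicator_nonneg (fun x hx => by positivity) _

end

lemma averaged_smoothing_iid {α : Type*} [Fintype α] {P v : α → ℝ} (h : Standardized P v)
    {n : ℕ} (hn : 0 < n) (hn' : (1 : ℝ) / n ≤ 0.11) {U U' : ℝ}
    (hU : U = 4.2 / ((∑ a, P a * |v a| ^ 3 + 1) / √n)) (hUU : U ≤ U') {m : ℝ} (hm : 0 < m) (x : ℝ) :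
    ∑ z : Fin n → α, (∏ i, P (z i)) * max 0 (1 - Real.exp (-((x - (∑ i, v (z i)) / √n) / m))) ≤
      (∫ y in Ioi 0, Real.exp (-y) * gaussPhi (x - m * y)) + √(π / 2) / U' +
        1.04 / π * (freqBound ((∑ a, P a * |v a| ^ 3) / √n) n U (1 - 1 / n) +
          (1 + Real.exp (-(0.5 * U ^ 2))) / m * (1 / U - 1 / U')) := by
  have s1 := @Standardized.norm_sub_le_small α _ P v h n hn U hU
  have s2 := @Standardized.norm_sub_le_mid α _ P v h n hn U hU
  have hT1 : 1 ≤ ∑ a, P a * |v a| ^ 3 := h.one_le_third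
  set T := ∑ a, P a * |v a| ^ 3 with hT
  have hn0 : (0 : ℝ) < n := by exact_mod_cast hn
  have hs : 0 < √(n : ℝ) := sqrt_pos.2 hn0
  have hU0 : 0 < U := by rw [hU]; positivity
  have hU0' : 0 < U' := hU0.trans_le hUU
  have s3 := @Standardized.norm_sub_le_large α _ P v h n U hU0
  have ha : 0.42 < 1 - 1 / (n : ℝ) := by linarith
  set K := Real.exp (-(0.0725 * U ^ 2)) + Real.exp (-(0.125 * U ^ 2)) with hK
  set C := (1 + Real.exp (-(0.5 * U ^ 2))) / m with hC
  have hK0 : 0 < K := by positivity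
  have hC0 : 0 < C := by positivity
  set b : ℝ → ℝ := freqMajorant (T / √n) n U U' (1 - 1 / n) K C with hb
  have hbi : IntegrableOn b (Ioi 0) := integrableOn_freqMajorant hU0 ha
  have hb0 : ∀ t, 0 < t → 0 ≤ b t := fun t ht =>
    freqMajorant_nonneg (by positivity) hn0 hU0 hK0.le hC0.le ht
  have hii : IntervalIntegrable b volume 0 U' :=
    (intervalIntegrable_iff_integrableOn_Ioc_of_le hU0'.le).2 (hbi.mono_set Ioc_subset_Ioi_self)
  have key := averaged_smoothing Finset.univ (fun z : Fin n → α => ∏ i, P (z i))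
    (fun z => (∑ i, v (z i)) / √n) (fun z _ => Finset.prod_nonneg fun i _ => h.nonneg _)
    (by rw [← Fintype.sum_pow, h.sum, one_pow]) hU0' hm x (B := fun u => 1.04 / π * (U' * b (U' * u)))
    ?_ ?_
  · refine key.trans ?_
    rw [add_assoc, add_assoc]
    refine add_le_add le_rfl (add_le_add le_rfl ?_)
    rw [intervalIntegral.integral_const_mul]
    refine mul_le_mul_of_nonneg_left ?_ (by positivity)
    rw [intervalIntegral.integral_const_mul, intervalIntegral.mul_integral_comp_mul_left, mul_zero,
      mul_one, intervalIntegral.integral_of_le hU0'.le]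
    calc _ ≤ ∫ t in Ioi 0, b t := setIntegral_mono_set hbi
          ((ae_restrict_iff' measurableSet_Ioi).2 (Eventually.of_forall fun t ht => hb0 t ht))
          Ioc_subset_Ioi_self.eventuallyLE
      _ = _ := integral_freqMajorant hU0 hUU ha
      _ ≤ _ := by
        have := integral_smallFreq_le (L := T / √n) hn0 hU0 ha
        rw [freqBound, ← hK, mul_comm K]
        linarith
  · refine (IntervalIntegrable.const_mul ?_ _).const_mul _
    have := hii.comp_mul_left (c := U')
    rwa [zero_div, div_self hU0'.ne'] at this
  · intro u hu
    have ht : 0 < U' * u := mul_pos hU0' hu.1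
    rw [charDiff_iid]
    set t := U' * u with ht_def
    have hu0 := hu.1
    have e : 1.04 / (π * u) = 1.04 / π * (U' * (1 / t)) := by
      rw [ht_def]; field_simp
    set D := ‖charConj P v (t / √n) ^ n - (Real.exp (-(t ^ 2) / 2) : ℝ)‖ with hD
    rw [e, mul_assoc, mul_div_assoc, mul_assoc, mul_div_assoc, mul_div_assoc]
    refine mul_le_mul_of_nonneg_left (mul_le_mul_of_nonneg_left ?_ hU0'.le) (by positivity)
    have hsq : 1 ≤ √(1 + (m * t) ^ 2) := one_le_sqrt.2 (by nlinarith [sq_nonneg (m * t)])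
    have hsq' : m * t ≤ √(1 + (m * t) ^ 2) := le_sqrt_of_sq_le (by linarith)
    have q0 : 0 ≤ smallFreq (T / √n) n U (1 - 1 / n) t :=
      smallFreq_nonneg (by positivity) hn0 hU0 ht.le
    have q1 : 0 ≤ (Icc (U / 2) U).indicator (fun t => K * (1 / t)) t :=
      indicator_nonneg (fun x hx => by have : 0 < x := by linarith [hx.1]
                                       positivity) _
    have q2 : 0 ≤ (Ioc U U').indicator (fun t => C * (1 / t ^ 2)) t :=
      indicator_nonneg (fun x hx => by positivity) _
    have hle : D / √(1 + (m * t) ^ 2) ≤ D := div_le_self (norm_nonneg _) hsq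
    change 1 / t * (D / √(1 + (m * t) ^ 2)) ≤ smallFreq (T / √n) n U (1 - 1 / n) t + (_ + _)
    rcases le_or_gt t (U / 2) with h1 | h1
    · have := s1 ht h1
      rw [← hD] at this
      calc 1 / t * (D / √(1 + (m * t) ^ 2)) ≤ 1 / t * (t * smallFreq (T / √n) n U (1 - 1 / n) t) :=
            mul_le_mul_of_nonneg_left (hle.trans this) (by positivity)
        _ = smallFreq (T / √n) n U (1 - 1 / n) t := by field_simp
        _ ≤ _ := by linarith
    rcases le_or_gt t U with h2 | h2
    · have := s2 h1.le h2
      rw [← hD] at this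
      calc 1 / t * (D / √(1 + (m * t) ^ 2)) ≤ 1 / t * K :=
            mul_le_mul_of_nonneg_left (hle.trans this) (by positivity)
        _ = (Icc (U / 2) U).indicator (fun t => K * (1 / t)) t := by
            rw [indicator_of_mem (by exact ⟨h1.le, h2⟩)]; ring
        _ ≤ _ := by linarith
    · have := s3 h2.le
      rw [← hD] at this
      have htU : t ≤ U' := by rw [ht_def]; nlinarith [hu.2]
      calc 1 / t * (D / √(1 + (m * t) ^ 2)) ≤ 1 / t * ((1 + Real.exp (-(0.5 * U ^ 2))) / (m * t)) := by
            gcongr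
        _ = (Ioc U U').indicator (fun t => C * (1 / t ^ 2)) t := by
            rw [indicator_of_mem (by exact ⟨h2, htU⟩), hC]; field_simp
        _ ≤ _ := by linarith

section
variable {α : Type*} [Fintype α] {P v : α → ℝ}

lemma averaged_smoothing_near (h : Standardized P v)
    {n : ℕ} (hn : 0 < n) (hn' : (1 : ℝ) / n ≤ 0.11) {U : ℝ}
    (hU : U = 4.2 / ((∑ a, P a * |v a| ^ 3 + 1) / √n)) {m : ℝ} (hm : 0 < m) (x : ℝ) :
    ∑ z : Fin n → α, (∏ i, P (z i)) * max 0 (1 - Real.exp (-((x - (∑ i, v (z i)) / √n) / m))) ≤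
      (∫ y in Ioi 0, Real.exp (-y) * gaussPhi (x - m * y)) + √(π / 2) / U +
        1.04 / π * freqBound ((∑ a, P a * |v a| ^ 3) / √n) n U (1 - 1 / n) := by
  simpa using averaged_smoothing_iid h hn hn' hU le_rfl hm x

lemma averaged_smoothing_far (h : Standardized P v)
    {n : ℕ} (hn : 0 < n) (hn' : (1 : ℝ) / n ≤ 0.11) {U : ℝ}
    (hU : U = 4.2 / ((∑ a, P a * |v a| ^ 3 + 1) / √n)) {m : ℝ} (hm : 0 < m) (x : ℝ) :
    ∑ z : Fin n → α, (∏ i, P (z i)) * max 0 (1 - Real.exp (-((x - (∑ i, v (z i)) / √n) / m))) ≤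
      (∫ y in Ioi 0, Real.exp (-y) * gaussPhi (x - m * y)) +
        1.04 / π * (freqBound ((∑ a, P a * |v a| ^ 3) / √n) n U (1 - 1 / n) +
          (1 + Real.exp (-(0.5 * U ^ 2))) / (m * U)) := by
  have e := fun U' hUU => averaged_smoothing_iid (U' := U') h hn hn' hU hUU hm x
  have hi : Tendsto (fun U' : ℝ => U'⁻¹) atTop (𝓝 0) := tendsto_inv_atTop_zero
  have ht := ((hi.const_mul (√(π / 2))).const_add
    (∫ y in Ioi 0, Real.exp (-y) * gaussPhi (x - m * y))).add
    ((((hi.const_sub U⁻¹).const_mul ((1 + Real.exp (-(0.5 * U ^ 2))) / m)).const_add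
      (freqBound ((∑ a, P a * |v a| ^ 3) / √n) n U (1 - 1 / n))).const_mul (1.04 / π))
  refine (ge_of_tendsto ht ((eventually_ge_atTop U).mono fun U' hU' => ?_)).trans (le_of_eq ?_)
  · refine (e U' hU').trans (le_of_eq ?_)
    simp only [div_eq_mul_inv, one_mul]
  · simp only [mul_zero, add_zero, sub_zero, div_eq_mul_inv, mul_inv]
    ring

end

lemma card_length_le {β : Type*} [Fintype β] {f : β → List Bool} (hf : Function.Injective f)
    (k : ℕ) (S : Finset β) (hS : ∀ x ∈ S, (f x).length ≤ k) : S.card ≤ 2 ^ (k + 1) := by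
  classical
  have h1 : S.image f ⊆ (Finset.range (k + 1)).biUnion fun i =>
      (Finset.univ : Finset (List.Vector Bool i)).image List.Vector.toList := by
    intro l hl
    obtain ⟨x, hx, rfl⟩ := Finset.mem_image.1 hl
    simp only [Finset.mem_biUnion, Finset.mem_range, Finset.mem_image, Finset.mem_univ, true_and]
    exact ⟨(f x).length, by have := hS x hx; omega, ⟨f x, rfl⟩, rfl⟩
  rw [← Finset.card_image_of_injective S hf]
  refine (Finset.card_le_card h1).trans (Finset.card_biUnion_le.trans ?_)
  calc ∑ i ∈ Finset.range (k + 1), ((Finset.univ : Finset (List.Vector Bool i)).image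
        List.Vector.toList).card ≤ ∑ i ∈ Finset.range (k + 1), 2 ^ i := by
        refine Finset.sum_le_sum fun i _ => Finset.card_image_le.trans ?_
        rw [Finset.card_univ, card_vector, Fintype.card_bool]
    _ ≤ 2 ^ (k + 1) := by
      have := Nat.geomSum_eq (le_refl 2) (k + 1)
      rw [this]
      simp

lemma prob_length_le {β : Type*} [Fintype β] {p : β → ℝ}
    {f : β → List Bool} (hf : Function.Injective f) {c M : ℝ} (hM : 0 ≤ M) :
    ∑ x, p x - prob p {x | c < ((f x).length : ℝ)} ≤
      2 * (2 : ℝ) ^ c * M + ∑ x, max 0 (p x - M) := by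
  classical
  rw [prob, tsum_fintype, ← Finset.sum_sub_distrib]
  set S : Finset β := Finset.univ.filter fun x => ((f x).length : ℝ) ≤ c with hS
  have hcard : (S.card : ℝ) ≤ 2 * (2 : ℝ) ^ c := by
    by_cases hc : 0 ≤ c
    · have := card_length_le hf ⌊c⌋₊ S fun x hx => Nat.le_floor (Finset.mem_filter.1 hx).2
      calc (S.card : ℝ) ≤ ((2 ^ (⌊c⌋₊ + 1) : ℕ) : ℝ) := by exact_mod_cast this
        _ = 2 * (2 : ℝ) ^ (⌊c⌋₊ : ℝ) := by rw [rpow_natCast]; push_cast; ring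
        _ ≤ _ := by
          have := rpow_le_rpow_of_exponent_le (one_le_two (α := ℝ)) (Nat.floor_le hc)
          linarith
    · have : S = ∅ := by
        rw [hS, Finset.filter_eq_empty_iff]
        intro x _
        have : (0 : ℝ) ≤ (f x).length := Nat.cast_nonneg _
        linarith
      rw [this]
      simp only [Finset.card_empty, Nat.cast_zero]
      positivity
  have e : ∀ x, p x - ({x | c < ((f x).length : ℝ)} : Set β).indicator p x ≤
      (if ((f x).length : ℝ) ≤ c then M else 0) + max 0 (p x - M) := by
    intro x
    by_cases hx : ((f x).length : ℝ) ≤ c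
    · rw [indicator_of_notMem (by simpa using hx), if_pos hx]
      linarith [le_max_right 0 (p x - M)]
    · rw [indicator_of_mem (by simpa using hx), if_neg hx]
      linarith [le_max_left 0 (p x - M)]
  refine (Finset.sum_le_sum fun x _ => e x).trans ?_
  rw [Finset.sum_add_distrib, ← Finset.sum_filter, Finset.sum_const, nsmul_eq_mul]
  exact add_le_add (mul_le_mul_of_nonneg_right hcard hM) le_rfl

lemma le_RStar {β : Type*} [Fintype β] {p : β → ℝ} {n : ℕ} (hn : 0 < n) {ε b : ℝ} (hε : 0 ≤ ε)
    (h : ∀ R < b, ∀ f : β → List Bool, Function.Injective f →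
      ε < prob p {x | (n : ℝ) * R < ((f x).length : ℝ)}) : b ≤ RStar p n ε := by
  refine le_csInf ?_ ?_
  · obtain ⟨f, hf⟩ : ∃ f : β → List Bool, Function.Injective f :=
      ⟨fun x => Infinite.natEmbedding (List Bool) (Fintype.equivFin β x), fun x y hxy =>
        (Fintype.equivFin β).injective (Fin.ext ((Infinite.natEmbedding (List Bool)).injective hxy))⟩
    refine ⟨∑ x, ((f x).length : ℝ), f, hf, ?_⟩
    have : {x | (n : ℝ) * ∑ x, ((f x).length : ℝ) < ((f x).length : ℝ)} = ∅ := by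
      ext x
      simp only [mem_ofPred_eq, mem_empty_iff_false, iff_false, not_lt]
      have h1 : ((f x).length : ℝ) ≤ ∑ x, ((f x).length : ℝ) :=
        Finset.single_le_sum (f := fun x => ((f x).length : ℝ)) (fun i _ => Nat.cast_nonneg _)
          (Finset.mem_univ x)
      have h2 : (1 : ℝ) ≤ n := by exact_mod_cast hn
      have h3 : (0 : ℝ) ≤ (f x).length := Nat.cast_nonneg _
      nlinarith
    rw [this, prob]
    simpa using hε
  · rintro R ⟨f, hf, hR⟩
    by_contra! hb
    exact absurd hR (not_le.2 (h R hb f hf))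

/-- Standardized information of a letter. -/
noncomputable def stdInfo {𝒜 : Type*} [Fintype 𝒜] (P : 𝒜 → ℝ) (a : 𝒜) : ℝ :=
  (Real.logb 2 (1 / P a) - entBits P) / √(varent P)

section
variable {𝒜 : Type*} [Fintype 𝒜] {P : 𝒜 → ℝ}

lemma standardized_stdInfo (hP0 : ∀ a, 0 ≤ P a) (hP1 : ∑ a, P a = 1) (hvar : 0 < varent P) :
    Standardized P (stdInfo P) := by
  refine ⟨hP0, hP1, ?_, ?_⟩
  · simp only [stdInfo, mul_div_assoc', mul_sub]
    rw [← Finset.sum_div, Finset.sum_sub_distrib, ← Finset.sum_mul, hP1, one_mul, ← entBits,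
      sub_self, zero_div]
  · simp only [stdInfo, div_pow, mul_div_assoc', sq_sqrt hvar.le]
    rw [← Finset.sum_div, ← varent, div_self hvar.ne']

lemma third_stdInfo : ∑ a, P a * |stdInfo P a| ^ 3 = mu3 P / √(varent P) ^ 3 := by
  simp only [stdInfo, abs_div, div_pow, mul_div_assoc', abs_of_nonneg (sqrt_nonneg _)]
  rw [← Finset.sum_div, ← mu3]

lemma max_iidPn_sub_le (hP0 : ∀ a, 0 ≤ P a) (hvar : 0 < varent P) {n : ℕ} (hn : 0 < n)
    (x : ℝ) (z : Fin n → 𝒜) :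
    max 0 (iidPn P n z - (2 : ℝ) ^ (-(n * entBits P + √(varent P) * √n * x))) ≤
      (∏ i, P (z i)) * max 0 (1 - Real.exp (-((x - (∑ i, stdInfo P (z i)) / √n) /
        (1 / (√(varent P) * √n * Real.log 2))))) := by
  have hp : 0 ≤ iidPn P n z := Finset.prod_nonneg fun i _ => hP0 _
  have hM : 0 < (2 : ℝ) ^ (-(n * entBits P + √(varent P) * √n * x)) := by positivity
  rcases hp.eq_or_lt with h0 | h0
  · rw [← h0, max_eq_left (by linarith)]
    change 0 ≤ iidPn P n z * _
    rw [← h0, zero_mul]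
  · have hpos : ∀ i, 0 < P (z i) := by
      intro i
      refine (hP0 _).lt_of_ne fun h => h0.ne' ?_
      exact Finset.prod_eq_zero (Finset.mem_univ i) h.symm
    have hn' : 0 < √(n : ℝ) := sqrt_pos.2 (by exact_mod_cast hn)
    have hσ : 0 < √(varent P) := sqrt_pos.2 hvar
    have hl : 0 < Real.log 2 := log_pos one_lt_two
    have hss : √(n : ℝ) * √n = n := mul_self_sqrt n.cast_nonneg
    have e1 : iidPn P n z = Real.exp (∑ i, Real.log (P (z i))) := by
      rw [iidPn, Real.exp_sum]
      exact Finset.prod_congr rfl fun i _ => (Real.exp_log (hpos i)).symm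
    have e2 : ∑ i, stdInfo P (z i) =
        (-(∑ i, Real.log (P (z i))) / Real.log 2 - n * entBits P) / √(varent P) := by
      simp only [stdInfo]
      rw [← Finset.sum_div, Finset.sum_sub_distrib, Finset.sum_const, Finset.card_univ,
        Fintype.card_fin, nsmul_eq_mul, ← Finset.sum_neg_distrib, Finset.sum_div]
      simp only [one_div, Real.logb, Real.log_inv]
    have e3 : (2 : ℝ) ^ (-(n * entBits P + √(varent P) * √n * x)) = iidPn P n z *
        Real.exp (-((x - (∑ i, stdInfo P (z i)) / √n) /
        (1 / (√(varent P) * √n * Real.log 2)))) := by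
      rw [e1, ← Real.exp_add, rpow_def_of_pos two_pos, e2]
      congr 1
      generalize √(n : ℝ) = q at hss hn' ⊢
      field_simp
      ring
    change _ ≤ iidPn P n z * _
    rw [mul_max_of_nonneg _ _ hp, mul_zero, mul_sub, mul_one, e3]

lemma rate_le_RStar (hP0 : ∀ a, 0 ≤ P a) (hP1 : ∑ a, P a = 1) (hvar : 0 < varent P)
    {ε : ℝ} (hε : 0 ≤ ε) {n : ℕ} (hn : 0 < n) {y x b : ℝ}
    (hb : n * b = n * entBits P + √(varent P) * √n * y - Real.logb 2 n / 2)
    (h : 2 / √n * Real.exp ((y - x) / (1 / (√(varent P) * √n * Real.log 2))) +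
      ∑ z : Fin n → 𝒜, (∏ i, P (z i)) *
        max 0 (1 - Real.exp (-((x - (∑ i, stdInfo P (z i)) / √n) /
        (1 / (√(varent P) * √n * Real.log 2))))) < 1 - ε) :
    b ≤ RStar (iidPn P n) n ε := by
  refine le_RStar hn hε fun R hR f hf => ?_
  have hn0 : (0 : ℝ) < n := by exact_mod_cast hn
  have hn' : 0 < √(n : ℝ) := sqrt_pos.2 hn0
  have h1 := prob_length_le (p := iidPn P n) hf (c := n * R)
    (M := (2 : ℝ) ^ (-(n * entBits P + √(varent P) * √n * x))) (by positivity)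
  have h2 := Finset.sum_le_sum fun z (_ : z ∈ Finset.univ) => max_iidPn_sub_le hP0 hvar hn x z
  have h3 : ∑ z : Fin n → 𝒜, iidPn P n z = 1 := by
    simp only [iidPn]
    rw [← Fintype.sum_pow, hP1, one_pow]
  have h4 : 2 * (2 : ℝ) ^ (n * R) * (2 : ℝ) ^ (-(n * entBits P + √(varent P) * √n * x)) ≤
      2 / √n * Real.exp ((y - x) / (1 / (√(varent P) * √n * Real.log 2))) := by
    have h5 : (2 : ℝ) ^ (n * R) ≤ (2 : ℝ) ^ (n * b) :=
      rpow_le_rpow_of_exponent_le one_le_two (by nlinarith)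
    calc _ ≤ 2 * (2 : ℝ) ^ (n * b) * (2 : ℝ) ^ (-(n * entBits P + √(varent P) * √n * x)) := by
          gcongr
      _ = 2 * (2 : ℝ) ^ (-(Real.logb 2 n / 2) + √(varent P) * √n * (y - x)) := by
          rw [mul_assoc, ← rpow_add two_pos, hb]
          congr 2
          ring
      _ = 2 / √n * Real.exp ((y - x) / (1 / (√(varent P) * √n * Real.log 2))) := by
          rw [rpow_add two_pos, rpow_neg two_pos.le, show Real.logb 2 n / 2 =
            Real.logb 2 n * (1 / 2) by ring, rpow_mul two_pos.le,
            rpow_logb two_pos (by norm_num) hn0, ← sqrt_eq_rpow, rpow_def_of_pos two_pos]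
          have h6 : Real.log 2 * (√(varent P) * √n * (y - x)) =
              (y - x) / (1 / (√(varent P) * √n * Real.log 2)) := by
            rw [one_div, div_inv_eq_mul]
            ring
          rw [h6, div_eq_mul_inv 2]
          ring
  rw [h3] at h1
  linarith

end

lemma hasDerivAt_gaussPhi (x : ℝ) : HasDerivAt gaussPhi (gaussPdf x) x := by
  have h : gaussPhi = fun x => gaussPhi 0 + ∫ t in (0 : ℝ)..x, gaussPdf t := by
    ext x
    have := intervalIntegral.integral_Iic_sub_Iic (μ := volume) (f := gaussPdf) (a := 0) (b := x)
      integrable_gaussPdf.integrableOn integrable_gaussPdf.integrableOn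
    rw [← this, gaussPhi, gaussPhi]
    ring
  rw [h]
  exact (intervalIntegral.integral_hasDerivAt_right
    (continuous_gaussPdf.intervalIntegrable _ _)
    (continuous_gaussPdf.stronglyMeasurableAtFilter _ _) continuous_gaussPdf.continuousAt).const_add _

lemma gaussPhi_add_gaussQ (x : ℝ) : gaussPhi x + gaussQ x = 1 := by
  rw [gaussPhi, gaussQ, ← compl_Iic, integral_add_compl measurableSet_Iic integrable_gaussPdf,
    integral_gaussPdf]

lemma gaussQ_zero : gaussQ 0 = 1 / 2 := by
  have h1 := gaussPhi_add_gaussQ 0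
  have h2 : gaussPhi 0 = gaussQ 0 := by
    have := integral_comp_neg_Iic (0 : ℝ) gaussPdf
    simp only [gaussPdf_neg, neg_zero] at this
    exact this
  linarith

lemma gaussQ_eq (x : ℝ) : gaussQ x = 1 - gaussPhi x := by
  linarith [gaussPhi_add_gaussQ x]

lemma tendsto_gaussQ_atTop : Tendsto gaussQ atTop (𝓝 0) := by
  have h : Tendsto (fun x => ∫ t in (0 : ℝ)..x, gaussPdf t) atTop (𝓝 (∫ t in Ioi 0, gaussPdf t)) :=
    intervalIntegral_tendsto_integral_Ioi 0 integrable_gaussPdf.integrableOn tendsto_id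
  have h2 : gaussQ = fun x => gaussQ 0 - ∫ t in (0 : ℝ)..x, gaussPdf t := by
    ext x
    have := intervalIntegral.integral_Iic_sub_Iic (μ := volume) (f := gaussPdf) (a := 0) (b := x)
      integrable_gaussPdf.integrableOn integrable_gaussPdf.integrableOn
    change gaussPhi x - gaussPhi 0 = _ at this
    rw [← this, gaussQ_eq, gaussQ_eq]
    ring
  rw [h2]
  simpa [gaussQ] using h.const_sub (gaussQ 0)

lemma gaussQ_gaussQinv {ε : ℝ} (h0 : 0 < ε) (h1 : ε < 1 / 2) : gaussQ (gaussQinv ε) = ε := by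
  refine Function.invFun_eq (f := gaussQ) ?_
  obtain ⟨b, hb, hb0⟩ := ((tendsto_gaussQ_atTop.eventually_lt_const h0).and
    (eventually_ge_atTop 0)).exists
  have hc : Continuous gaussQ := by
    have : gaussQ = fun x => 1 - gaussPhi x := funext gaussQ_eq
    rw [this]
    exact continuous_const.sub
      (continuous_iff_continuousAt.2 fun x => (hasDerivAt_gaussPhi x).continuousAt)
  obtain ⟨x, -, hx⟩ := intermediate_value_Icc' hb0 hc.continuousOn
    (show ε ∈ Icc (gaussQ b) (gaussQ 0) from ⟨hb.le, by rw [gaussQ_zero]; exact h1.le⟩)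
  exact ⟨x, hx⟩

lemma gaussPhi_gaussQinv {ε : ℝ} (h0 : 0 < ε) (h1 : ε < 1 / 2) : gaussPhi (gaussQinv ε) = 1 - ε := by
  linarith [gaussPhi_add_gaussQ (gaussQinv ε), gaussQ_gaussQinv h0 h1]

lemma gaussQinv_pos {ε : ℝ} (h0 : 0 < ε) (h1 : ε < 1 / 2) : 0 < gaussQinv ε := by
  by_contra! h
  have h2 := monotone_gaussPhi h
  have h3 := gaussPhi_add_gaussQ 0
  rw [gaussQ_zero] at h3
  rw [gaussPhi_gaussQinv h0 h1] at h2
  linarith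

lemma gaussPdf_sub (l p : ℝ) : gaussPdf (l - p) = gaussPdf l * Real.exp (l * p - p ^ 2 / 2) := by
  rw [gaussPdf, gaussPdf, div_mul_eq_mul_div, ← Real.exp_add]
  congr 2
  ring

lemma gaussPhi_sub_le {l p : ℝ} (hp : 0 ≤ p) :
    gaussPhi (l - p) ≤ gaussPhi l - gaussPdf l * (p + l * p ^ 2 / 2 - p ^ 3 / 6) := by
  have hd : ∀ s, HasDerivAt (fun s => gaussPhi (l - s) +
      gaussPdf l * (s + l * s ^ 2 / 2 - s ^ 3 / 6))
      (-gaussPdf (l - s) + gaussPdf l * (1 + l * s - s ^ 2 / 2)) s := by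
    intro s
    have h1 : HasDerivAt (fun s => gaussPhi (l - s)) (gaussPdf (l - s) * (-1)) s :=
      (hasDerivAt_gaussPhi (l - s)).comp s ((hasDerivAt_id s).const_sub l)
    have h2 : HasDerivAt (fun s : ℝ => s + l * s ^ 2 / 2 - s ^ 3 / 6)
        (1 + l * (2 * s) / 2 - 3 * s ^ 2 / 6) s := by
      have := ((hasDerivAt_id s).add (((hasDerivAt_pow 2 s).const_mul l).div_const 2)).sub
        ((hasDerivAt_pow 3 s).div_const 6)
      convert! this using 1
      norm_num
    convert! h1.add (h2.const_mul (gaussPdf l)) using 1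
    ring
  have ha : AntitoneOn (fun s => gaussPhi (l - s) +
      gaussPdf l * (s + l * s ^ 2 / 2 - s ^ 3 / 6)) (Ici 0) := by
    refine antitoneOn_of_deriv_nonpos (convex_Ici 0)
      (fun s _ => (hd s).continuousAt.continuousWithinAt)
      (fun s _ => (hd s).differentiableAt.differentiableWithinAt) fun s _ => ?_
    rw [(hd s).deriv, gaussPdf_sub]
    have := mul_le_mul_of_nonneg_left (Real.add_one_le_exp (l * s - s ^ 2 / 2)) (gaussPdf_pos l).le
    linarith
  have := ha (self_mem_Ici) (show p ∈ Ici 0 from hp) hp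
  simp only [sub_zero] at this
  linarith

lemma integrableOn_pow_mul_exp_neg_id (k : ℕ) :
    IntegrableOn (fun y : ℝ => y ^ k * Real.exp (-y)) (Ioi 0) := by
  have := Real.GammaIntegral_convergent (s := k + 1) (by positivity)
  refine this.congr_fun (fun y _ => ?_) measurableSet_Ioi
  simp [mul_comm]

lemma integral_quadratic_mul_exp_neg (a b c : ℝ) :
    IntegrableOn (fun y : ℝ => (a + b * y + c * y ^ 2) * Real.exp (-y)) (Ioi 0) ∧
    ∫ y in Ioi (0 : ℝ), (a + b * y + c * y ^ 2) * Real.exp (-y) = a + b + 2 * c := by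
  have hI : IntegrableOn (fun y : ℝ => (a + b * y + c * y ^ 2) * Real.exp (-y)) (Ioi 0) := by
    have := (((integrableOn_pow_mul_exp_neg_id 0).const_mul a).add
      ((integrableOn_pow_mul_exp_neg_id 1).const_mul b)).add
      ((integrableOn_pow_mul_exp_neg_id 2).const_mul c)
    refine IntegrableOn.congr_fun this (fun y _ => ?_) measurableSet_Ioi
    simp only [Pi.add_apply]
    ring
  refine ⟨hI, ?_⟩
  have ht : ∀ k : ℕ, Tendsto (fun y : ℝ => y ^ k * Real.exp (-y)) atTop (𝓝 0) :=
    Real.tendsto_pow_mul_exp_neg_atTop_nhds_zero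
  have hd : ∀ y : ℝ, HasDerivAt (fun y => -((a + b + 2 * c) * (y ^ 0 * Real.exp (-y)) +
      (b + 2 * c) * (y ^ 1 * Real.exp (-y)) + c * (y ^ 2 * Real.exp (-y))))
      ((a + b * y + c * y ^ 2) * Real.exp (-y)) y := by
    intro y
    have he : HasDerivAt (fun y : ℝ => Real.exp (-y)) (-Real.exp (-y)) y := by
      simpa using (hasDerivAt_neg y).exp
    have := (((((hasDerivAt_pow 0 y).mul he).const_mul (a + b + 2 * c)).add
      (((hasDerivAt_pow 1 y).mul he).const_mul (b + 2 * c))).add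
      (((hasDerivAt_pow 2 y).mul he).const_mul c)).neg
    convert! this using 1
    push_cast
    ring
  have := integral_Ioi_of_hasDerivAt_of_tendsto' (fun y _ => hd y) hI
    (((((ht 0).const_mul (a + b + 2 * c)).add ((ht 1).const_mul (b + 2 * c))).add
      ((ht 2).const_mul c)).neg)
  rw [this]
  simp

/-- Integration by parts for the exponentially averaged Gaussian distribution function. -/
lemma integral_exp_neg_mul_gaussPhi (x m : ℝ) :
    IntegrableOn (fun y => Real.exp (-y) * gaussPdf (x - m * y)) (Ioi 0) ∧
    ∫ y in Ioi (0 : ℝ), Real.exp (-y) * gaussPhi (x - m * y) =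
      gaussPhi x - m * ∫ y in Ioi (0 : ℝ), Real.exp (-y) * gaussPdf (x - m * y) := by
  have hI : IntegrableOn (fun y => Real.exp (-y) * gaussPdf (x - m * y)) (Ioi 0) := by
    refine integrableOn_exp_neg.mul_bdd (c := 1 / √(2 * π))
      (continuous_gaussPdf.comp (by fun_prop)).aestronglyMeasurable
      (Eventually.of_forall fun y => ?_)
    rw [norm_of_nonneg (gaussPdf_pos _).le]
    exact gaussPdf_le _
  refine ⟨hI, ?_⟩
  have hd : ∀ y : ℝ, HasDerivAt (fun y => -(Real.exp (-y) * gaussPhi (x - m * y)))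
      (Real.exp (-y) * gaussPhi (x - m * y) + m * (Real.exp (-y) * gaussPdf (x - m * y))) y := by
    intro y
    have he : HasDerivAt (fun y : ℝ => Real.exp (-y)) (-Real.exp (-y)) y := by
      simpa using (hasDerivAt_neg y).exp
    have hp : HasDerivAt (fun y => gaussPhi (x - m * y)) (gaussPdf (x - m * y) * (-(m * 1))) y :=
      (hasDerivAt_gaussPhi _).comp y (((hasDerivAt_id y).const_mul m).const_sub x)
    convert! (he.mul hp).neg using 1
    ring
  have hlim : Tendsto (fun y => -(Real.exp (-y) * gaussPhi (x - m * y))) atTop (𝓝 (-0)) := by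
    refine Tendsto.neg (squeeze_zero (fun y => mul_nonneg (Real.exp_pos _).le (gaussPhi_nonneg _))
      (fun y => mul_le_of_le_one_right (Real.exp_pos _).le (gaussPhi_le_one _)) ?_)
    exact Real.tendsto_exp_neg_atTop_nhds_zero
  have h1 := integral_Ioi_of_hasDerivAt_of_tendsto' (fun y _ => hd y)
    ((integrableOn_exp_neg_mul_gaussPhi x m).add (hI.const_mul m)) hlim
  rw [integral_add (integrableOn_exp_neg_mul_gaussPhi x m) (hI.const_mul m),
    integral_const_mul] at h1
  simp only [neg_zero, Real.exp_zero, mul_zero, sub_zero, one_mul, zero_sub, neg_neg] at h1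
  linarith

/-- Gain of the exponentially averaged Gaussian distribution function over its value at `l`. -/
lemma integral_exp_neg_mul_gaussPhi_le (l : ℝ) {d m : ℝ} (hd : 0 ≤ d) (hm : 0 < m) :
    ∫ y in Ioi (0 : ℝ), Real.exp (-y) * gaussPhi (l - d - m * y) ≤
      gaussPhi l - gaussPdf l * (d + l * d ^ 2 / 2 - d ^ 3 / 6 +
        m * Real.exp (l * (d + m) - (d ^ 2 + 2 * d * m + 2 * m ^ 2) / 2)) := by
  obtain ⟨hI, h1⟩ := integral_exp_neg_mul_gaussPhi (l - d) m
  have h2 := gaussPhi_sub_le (l := l) hd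
  set f0 := l * (d + m) - (d ^ 2 + 2 * d * m + 2 * m ^ 2) / 2 with hf0
  obtain ⟨hJ, h3⟩ := integral_quadratic_mul_exp_neg
    (gaussPdf l * Real.exp f0 * (1 + l * d - d ^ 2 / 2 - f0))
    (gaussPdf l * Real.exp f0 * (l * m - d * m)) (gaussPdf l * Real.exp f0 * (-(m ^ 2 / 2)))
  have h4 : gaussPdf l * Real.exp f0 ≤
      ∫ y in Ioi (0 : ℝ), Real.exp (-y) * gaussPdf (l - d - m * y) := by
    calc _ = _ := by
          rw [← sub_eq_zero]
          rw [show gaussPdf l * Real.exp f0 - (gaussPdf l * Real.exp f0 *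
            (1 + l * d - d ^ 2 / 2 - f0) + gaussPdf l * Real.exp f0 * (l * m - d * m) +
            2 * (gaussPdf l * Real.exp f0 * (-(m ^ 2 / 2)))) = gaussPdf l * Real.exp f0 *
            (f0 - (l * (d + m) - (d ^ 2 + 2 * d * m + 2 * m ^ 2) / 2)) by ring, hf0]
          ring
      _ = _ := h3.symm
      _ ≤ _ := by
          refine setIntegral_mono hJ hI fun y => ?_
          change _ ≤ Real.exp (-y) * gaussPdf (l - d - m * y)
          rw [show l - d - m * y = l - (d + m * y) by ring, gaussPdf_sub]
          have h5 := Real.add_one_le_exp (l * (d + m * y) - (d + m * y) ^ 2 / 2 - f0)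
          rw [Real.exp_sub, le_div_iff₀ (Real.exp_pos _)] at h5
          have h6 := mul_le_mul_of_nonneg_left h5
            (mul_nonneg (gaussPdf_pos l).le (Real.exp_pos (-y)).le)
          refine le_trans (le_of_eq ?_) (h6.trans (le_of_eq ?_)) <;> ring
  rw [h1]
  nlinarith [mul_le_mul_of_nonneg_left h4 hm.le]

lemma exp_neg_le_inv_sq {x : ℝ} (hx : 0 < x) : Real.exp (-x) ≤ 0.54135 / x ^ 2 := by
  have h1 := Real.add_one_le_exp (x / 2 - 1)
  have h2 : Real.exp (x / 2 - 1) ^ 2 = Real.exp x * Real.exp (-2) := by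
    rw [← Real.exp_nat_mul, ← Real.exp_add]
    congr 1
    push_cast
    ring
  have h3 : Real.exp (-2) ≤ 0.135336 := by
    have : Real.exp (-2) = (Real.exp 1 ^ 2)⁻¹ := by
      rw [← Real.exp_nat_mul, ← Real.exp_neg]
      norm_num
    rw [this, inv_le_comm₀ (by positivity) (by norm_num)]
    have := Real.exp_one_gt_d9
    nlinarith
  have h4 : (x / 2) ^ 2 ≤ Real.exp x * Real.exp (-2) := by
    rw [← h2]
    exact pow_le_pow_left₀ (by linarith) (by linarith) 2
  rw [le_div_iff₀ (by positivity)]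
  have h5 : Real.exp (-x) * Real.exp x = 1 := by rw [← Real.exp_add]; simp
  nlinarith [Real.exp_pos (-x), mul_le_mul_of_nonneg_left h4 (Real.exp_pos (-x)).le]

lemma sqrt_pi_div_two_le : √(π / 2) ≤ 1.25332 := by
  rw [sqrt_le_left (by norm_num)]
  nlinarith [Real.pi_lt_d6]

lemma one_div_pi_le : 1 / π ≤ 0.31831 := by
  rw [div_le_iff₀ pi_pos]
  nlinarith [Real.pi_gt_d6]

/-- Elementary bounds for the negative powers of `1 - x` and `0.58 - x` in `freqBound`. -/
lemma inv_bounds {x : ℝ} (h0 : 0 ≤ x) (h1 : x ≤ 0.1043) :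
    1 / ((1 - x) * √(1 - x)) ≤ 1 + 1.8 * x ∧
    1 / ((1 - x) * (1 - x - 0.42) ^ 2) + 1 / ((1 - x) ^ 2 * (1 - x - 0.42)) ≤ 4.7 + 28 * x ∧
    2 / (1 - x) ^ 2 ≤ 2 + 5 * x ∧
    1 / ((1 - x - 0.42) ^ 2 * √(1 - x - 0.42)) ≤ 3.91 + 24.2 * x := by
  have ha : 0 < 1 - x := by linarith
  have hb : 0 < 1 - x - 0.42 := by linarith
  refine ⟨?_, ?_, ?_, ?_⟩
  · have hs : 1 - 0.53 * x ≤ √(1 - x) := by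
      apply le_sqrt_of_sq_le
      nlinarith
    rw [div_le_iff₀ (by positivity)]
    have : (1 - x) * (1 - 0.53 * x) ≤ (1 - x) * √(1 - x) := by gcongr
    nlinarith [mul_nonneg h0 (sub_nonneg.2 h1), mul_nonneg (mul_nonneg h0 h0) (sub_nonneg.2 h1)]
  · have e : 1 / ((1 - x) * (1 - x - 0.42) ^ 2) + 1 / ((1 - x) ^ 2 * (1 - x - 0.42)) =
      (1.58 - 2 * x) / ((1 - x) ^ 2 * (1 - x - 0.42) ^ 2) := by
      field_simp
      ring
    rw [e, div_le_iff₀ (by positivity)]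
    nlinarith [mul_nonneg h0 (sub_nonneg.2 h1), mul_nonneg (mul_nonneg h0 h0) (sub_nonneg.2 h1), mul_nonneg (mul_nonneg h0 (mul_nonneg h0 h0)) (sub_nonneg.2 h1), mul_nonneg (mul_nonneg (mul_nonneg h0 h0) (mul_nonneg h0 h0)) (sub_nonneg.2 h1)]
  · rw [div_le_iff₀ (by positivity)]
    nlinarith [mul_nonneg h0 (sub_nonneg.2 h1), mul_nonneg (mul_nonneg h0 h0) (sub_nonneg.2 h1)]
  · have hs : 0.7615 - 0.69 * x ≤ √(1 - x - 0.42) := by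
      apply le_sqrt_of_sq_le
      nlinarith
    rw [div_le_iff₀ (by positivity)]
    have : (1 - x - 0.42) ^ 2 * (0.7615 - 0.69 * x) ≤ (1 - x - 0.42) ^ 2 * √(1 - x - 0.42) := by
      gcongr
    have h3 : 1 ≤ (3.91 + 24.2 * x) * ((1 - x - 0.42) ^ 2 * (0.7615 - 0.69 * x)) := by
      nlinarith [mul_nonneg h0 (sub_nonneg.2 h1), mul_nonneg (mul_nonneg h0 h0) (sub_nonneg.2 h1), mul_nonneg (mul_nonneg h0 (mul_nonneg h0 h0)) (sub_nonneg.2 h1)]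
    nlinarith [mul_le_mul_of_nonneg_left this (show 0 ≤ 3.91 + 24.2 * x by linarith)]

/-- Polynomial majorant of the normalized frequency-domain error. -/
noncomputable def freqPoly (τ θ : ℝ) : ℝ :=
  (2 - 2 * τ) * (0.06916 + 0.05534 * θ ^ 2) +
  (2 - 2 * τ) * (2 - τ) * (0.05188 * θ + 0.13735 * θ ^ 3) +
  τ ^ 2 * (0.0946 * θ + 0.10512 * θ ^ 3) +
  τ ^ 2 * (2 - τ) * (0.16556 * θ ^ 2 + 0.4556 * θ ^ 4) +
  (2 - τ) ^ 4 * (0.1016 * θ ^ 3)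

lemma freqBound_le {θ τ n U : ℝ} (h0 : 0 < θ) (h1 : θ ≤ 0.48395) (t0 : 0 < τ) (t1 : τ ≤ 2 / 3)
    (hn : 1 / n = τ ^ 2 * θ ^ 2) (hU : U = 4.2 / ((2 - τ) * θ)) :
    1.04 / π * freqBound ((2 - 2 * τ) * θ) n U (1 - 1 / n) ≤ θ * freqPoly τ θ := by
  have hv : 0 < (2 - τ) * θ := mul_pos (by linarith) h0
  have hU0 : 0 < U := by rw [hU]; positivity
  have hUi : 1 / U = (2 - τ) * θ / 4.2 := by rw [hU, one_div_div]
  have hx0 : 0 ≤ 1 / n := by rw [hn]; positivity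
  have hτ2 : τ ^ 2 ≤ 4 / 9 := by nlinarith
  have hx1 : 1 / n ≤ 4 / 9 * θ ^ 2 := by rw [hn]; gcongr
  have hx2 : 1 / n ≤ 0.1043 := by nlinarith
  obtain ⟨b1, b2, b3, b4⟩ := inv_bounds hx0 hx2
  have hs := sqrt_pi_div_two_le
  have hp := one_div_pi_le
  have hp0 : 0 < 1 / π := by positivity
  have hl : Real.log 2 ≤ 0.693148 := by linarith [Real.log_two_lt_d9]
  have hl0 : 0 ≤ Real.log 2 := (Real.log_pos one_lt_two).le
  have e1 := exp_neg_le_inv_sq (show 0 < 0.0725 * U ^ 2 by positivity)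
  have e2 := exp_neg_le_inv_sq (show 0 < 0.125 * U ^ 2 by positivity)
  have e3 : Real.exp (-(0.0725 * U ^ 2)) + Real.exp (-(0.125 * U ^ 2)) ≤
      0.44236 * ((2 - τ) * θ) ^ 4 := by
    have h : (1 / U) ^ 4 = ((2 - τ) * θ / 4.2) ^ 4 := by rw [hUi]
    have g1 : 0.54135 / (0.0725 * U ^ 2) ^ 2 = 0.54135 / 0.0725 ^ 2 * (1 / U) ^ 4 := by
      field_simp
    have g2 : 0.54135 / (0.125 * U ^ 2) ^ 2 = 0.54135 / 0.125 ^ 2 * (1 / U) ^ 4 := by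
      field_simp
    rw [g1, h] at e1
    rw [g2, h] at e2
    refine (add_le_add e1 e2).trans ?_
    rw [← add_mul, div_pow, mul_div_assoc', div_le_iff₀ (by norm_num)]
    nlinarith [pow_pos hv 4]
  have c1 : 0 ≤ 2 - 2 * τ := by linarith
  have c2 : 0 ≤ 2 - τ := by linarith
  have ha : 0 < 1 - 1 / n := by linarith
  have hb : 0 < 1 - 1 / n - 0.42 := by linarith
  have k1 : √(π / 2) / ((1 - 1 / n) * √(1 - 1 / n)) ≤ 1.25332 * (1 + 0.8 * θ ^ 2) := by
    rw [← mul_one_div]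
    exact mul_le_mul hs (by linarith) (by positivity) (by norm_num)
  have k2 : 2 / U * 0.42 * (1 / ((1 - 1 / n) * (1 - 1 / n - 0.42) ^ 2) +
      1 / ((1 - 1 / n) ^ 2 * (1 - 1 / n - 0.42))) ≤
      0.2 * ((2 - τ) * θ) * (4.7 + 28 * (4 / 9) * θ ^ 2) := by
    have : 2 / U * 0.42 = 0.2 * ((2 - τ) * θ) := by
      rw [← mul_one_div, hUi]
      ring
    rw [this]
    exact mul_le_mul_of_nonneg_left (by linarith) (by positivity)
  have k3 : 3 * √(π / 2) / U / ((1 - 1 / n - 0.42) ^ 2 * √(1 - 1 / n - 0.42)) ≤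
      0.89523 * ((2 - τ) * θ) * (3.91 + 24.2 * (4 / 9) * θ ^ 2) := by
    rw [← mul_one_div, ← mul_one_div _ U, hUi]
    refine mul_le_mul ?_ (by linarith) (by positivity) (by positivity)
    have h := mul_le_mul_of_nonneg_right hs hv.le
    calc 3 * √(π / 2) * ((2 - τ) * θ / 4.2) = 3 / 4.2 * (√(π / 2) * ((2 - τ) * θ)) := by ring
      _ ≤ 3 / 4.2 * (1.25332 * ((2 - τ) * θ)) := by gcongr
      _ ≤ _ := by nlinarith only [hv]
  have k4 : 2 / (1 - 1 / n) ^ 2 ≤ 2 + 5 * (4 / 9) * θ ^ 2 := by linarith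
  have h7 : 1 / (7 * n) = τ ^ 2 * θ ^ 2 / 7 := by
    rw [← hn, div_div, mul_comm]
  rw [freqBound, h7]
  calc _ ≤ 1.04 * 0.31831 * ((2 - 2 * τ) * θ / 6 * (1.25332 * (1 + 0.8 * θ ^ 2) +
        0.2 * ((2 - τ) * θ) * (4.7 + 28 * (4 / 9) * θ ^ 2)) + τ ^ 2 * θ ^ 2 / 7 *
        (2 + 5 * (4 / 9) * θ ^ 2 + 0.89523 * ((2 - τ) * θ) * (3.91 + 24.2 * (4 / 9) * θ ^ 2)) +
        0.693148 * (0.44236 * ((2 - τ) * θ) ^ 4)) := by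
        have : 1.04 / π ≤ 1.04 * 0.31831 := by rw [← mul_one_div]; gcongr
        gcongr
    _ ≤ _ := by
        unfold freqPoly
        have p1 : 0 ≤ (2 - 2 * τ) * θ := by positivity
        have p2 : 0 ≤ (2 - 2 * τ) * (2 - τ) * θ := by positivity
        have q1 : 0 ≤ (2 - 2 * τ) * (2 - τ) * θ ^ 2 := by positivity
        have q2 : 0 ≤ (2 - 2 * τ) * (2 - τ) * θ ^ 4 := by positivity
        have q3 : 0 ≤ (2 - 2 * τ) * θ ^ 3 := by positivity
        have q4 : 0 ≤ τ ^ 2 * θ ^ 2 := by positivity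
        have q5 : 0 ≤ τ ^ 2 * θ ^ 4 := by positivity
        have q6 : 0 ≤ τ ^ 2 * (2 - τ) * θ ^ 3 := by positivity
        have q7 : 0 ≤ τ ^ 2 * (2 - τ) * θ ^ 5 := by positivity
        have q8 : 0 ≤ (2 - τ) ^ 4 * θ ^ 4 := by positivity
        linarith

lemma freqPoly_le_linear {τ θ : ℝ} (h0 : 0 < θ) (t0 : 0 < τ) (t1 : τ ≤ 2 / 3) :
    freqPoly τ θ ≤ (2 - 2 * τ) * (0.06916 + 0.05534 * θ ^ 2) +
      (4 - 14 / 3 * τ) * (0.05188 * θ + 0.13735 * θ ^ 3) +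
      2 / 3 * τ * (0.0946 * θ + 0.10512 * θ ^ 3) +
      8 / 9 * τ * (0.16556 * θ ^ 2 + 0.4556 * θ ^ 4) +
      (16 - 520 / 27 * τ) * (0.1016 * θ ^ 3) := by
  have p : 0 ≤ τ * (2 / 3 - τ) := mul_nonneg t0.le (by linarith)
  unfold freqPoly
  gcongr ?_ + ?_ * _ + ?_ * _ + ?_ * _ + ?_ * _
  · exact le_rfl
  · nlinarith
  · nlinarith
  · nlinarith [mul_nonneg p (show (0 : ℝ) ≤ 4 / 3 - τ by linarith)]
  · nlinarith [mul_nonneg p (show (0 : ℝ) ≤ 2 / 3 - τ by linarith), mul_nonneg p (show (0 : ℝ) ≤ 4 / 3 - τ by linarith), mul_nonneg p p, mul_nonneg (mul_nonneg p (show (0 : ℝ) ≤ 2 / 3 - τ by linarith)) t0.le]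

lemma endpoint_zero_le {θ δ : ℝ} (h0 : 0 < θ) (h1 : θ ≤ 0.48395) (d0 : 0 < δ)
    (h : θ * (1 + δ ^ 2 / 8 + δ ^ 4 / 128) ≤ 0.39895 * δ) :
    0.73516 + 0.20752 * θ + 0.11068 * θ ^ 2 + 2.175 * θ ^ 3 ≤
      0.936 + 0.05 * δ + 0.03 * δ ^ 2 := by
  rcases le_total θ 0.4 with h2 | h2
  · have c : 0.73516 + 0.20752 * θ + 0.11068 * θ ^ 2 + 2.175 * θ ^ 3 ≤ 0.736 + 0.5985 * θ := by
      nlinarith [mul_nonneg h0.le (sub_nonneg.2 h2), mul_nonneg (mul_nonneg h0.le h0.le) (sub_nonneg.2 h2)]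
    have w : θ ≤ 0.39895 * δ := by
      have : 0 ≤ θ * (δ ^ 2 / 8 + δ ^ 4 / 128) := by positivity
      nlinarith
    rcases le_total δ 1 with hd | hd
    · nlinarith
    · nlinarith
  · have c : 0.73516 + 0.20752 * θ + 0.11068 * θ ^ 2 + 2.175 * θ ^ 3 ≤
        0.9753 + 1.585 * (θ - 0.4) := by
      nlinarith [mul_nonneg (sub_nonneg.2 h2) (sub_nonneg.2 h1), mul_nonneg h0.le (mul_nonneg (sub_nonneg.2 h2) (sub_nonneg.2 h1))]
    have w : θ * (0.955 + 0.1625 * δ ^ 2) ≤ 0.39895 * δ := by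
      have : 0 ≤ θ * (δ ^ 2 - 2.4) ^ 2 := by positivity
      nlinarith
    have w2 : 1 ≤ δ := by
      have : 0 ≤ θ * (δ ^ 2 / 8 + δ ^ 4 / 128) := by positivity
      nlinarith
    rcases le_total δ 1.77 with hd | hd
    · suffices 1.585 * (0.39895 * δ) ≤ (0.936 + 0.05 * δ + 0.03 * δ ^ 2 - 0.9753 + 0.634) *
          (0.955 + 0.1625 * δ ^ 2) by
        have : 0 < 0.955 + 0.1625 * δ ^ 2 := by positivity
        nlinarith
      nlinarith [mul_nonneg (sub_nonneg.2 w2) (sub_nonneg.2 hd), sq_nonneg (δ - 1.6), sq_nonneg (δ * (δ - 1.6))]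
    · nlinarith

lemma endpoint_two_thirds_le {θ δ : ℝ} (h0 : 0 < θ) (h1 : θ ≤ 0.48395) (d0 : 0 < δ)
    (h : θ * (1 + δ ^ 2 / 8 + δ ^ 4 / 128) ≤ 0.39895 * δ) :
    0.93452 + 0.08817 * θ + 0.13501 * θ ^ 2 + 0.48992 * θ ^ 3 + 0.27 * θ ^ 4 ≤
      0.936 + 0.05 * δ + 0.03 * δ ^ 2 := by
  have w : θ * (1 + δ ^ 2 / 8) ≤ 0.39895 * δ := by
    have : 0 ≤ θ * (δ ^ 4 / 128) := by positivity
    nlinarith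
  have w1 : θ ≤ 0.39895 * δ := by
    have : 0 ≤ θ * (δ ^ 2 / 8) := by positivity
    nlinarith
  have hW : 0 < 1 + δ ^ 2 / 8 := by positivity
  have chord : ∀ p q : ℝ, 0 ≤ p → p ≤ θ → θ ≤ q →
      0.93452 + 0.08817 * θ + 0.13501 * θ ^ 2 + 0.48992 * θ ^ 3 + 0.27 * θ ^ 4 ≤
      0.93452 + 0.08817 * θ + 0.13501 * ((p + q) * θ - p * q) +
      0.48992 * ((p ^ 2 + p * q + q ^ 2) * θ - p * q * (p + q)) +
      0.27 * ((p + q) * (p ^ 2 + q ^ 2) * θ - p * q * (p ^ 2 + p * q + q ^ 2)) := by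
    intro p q hp hpt hq
    have k : 0 ≤ (θ - p) * (q - θ) := mul_nonneg (by linarith) (by linarith)
    have hq0 : 0 ≤ q := by linarith
    have k2 : 0 ≤ (θ - p) * (q - θ) * (θ + p + q) := by positivity
    have k3 : 0 ≤ (θ - p) * (q - θ) * (θ ^ 2 + (p + q) * θ + p ^ 2 + p * q + q ^ 2) := by
      positivity
    linarith
  rcases le_total θ 0.18 with h2 | h2
  · have := chord 0 0.18 le_rfl h0.le h2
    norm_num at this
    nlinarith [sq_nonneg (δ - 0.03)]
  rcases le_total θ 0.3 with h3 | h3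
  · have := chord 0.18 0.3 (by norm_num) h2 h3
    norm_num at this
    suffices 0.2556 * (0.39895 * δ) ≤ (0.936 + 0.05 * δ + 0.03 * δ ^ 2 - 0.9119) *
        (1 + δ ^ 2 / 8) by
      nlinarith
    nlinarith [sq_nonneg (δ - 0.65), sq_nonneg (δ * (δ - 0.65))]
  rcases le_total θ 0.4 with h4 | h4
  · have := chord 0.3 0.4 (by norm_num) h3 h4
    norm_num at this
    suffices 0.4115 * (0.39895 * δ) ≤ (0.936 + 0.05 * δ + 0.03 * δ ^ 2 - 0.8651) *
        (1 + δ ^ 2 / 8) by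
      nlinarith
    nlinarith [sq_nonneg (δ - 1), sq_nonneg (δ * (δ - 1))]
  · have := chord 0.4 0.48395 (by norm_num) h4 h1
    norm_num at this
    rcases le_total δ 1.8 with hd | hd
    · suffices 0.593 * (0.39895 * δ) ≤ (0.936 + 0.05 * δ + 0.03 * δ ^ 2 - 0.7927) *
          (1 + δ ^ 2 / 8) by
        nlinarith
      nlinarith [sq_nonneg (δ - 1.3), sq_nonneg (δ * (δ - 1.3))]
    · nlinarith

lemma lhs_le {τ θ δ : ℝ} (h0 : 0 < θ) (h1 : θ ≤ 0.48395) (t0 : 0 < τ) (t1 : τ ≤ 2 / 3)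
    (d0 : 0 < δ) (h : θ * (1 + δ ^ 2 / 8 + δ ^ 4 / 128) ≤ 0.39895 * δ) :
    (2 - τ) * 0.29842 + freqPoly τ θ + 0.73576 * τ ≤ 0.936 + 0.05 * δ + 0.03 * δ ^ 2 := by
  have e0 := endpoint_zero_le h0 h1 d0 h
  have e1 := endpoint_two_thirds_le h0 h1 d0 h
  have e2 := freqPoly_le_linear h0 t0 t1
  have f0 := mul_le_mul_of_nonneg_left e0 (show 0 ≤ 2 / 3 - τ by linarith)
  have f1 := mul_le_mul_of_nonneg_left e1 t0.le
  have g : ∀ k : ℕ, 0 ≤ τ * θ ^ k ∧ 0 ≤ (2 / 3 - τ) * θ ^ k := fun k =>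
    ⟨by positivity, mul_nonneg (by linarith) (by positivity)⟩
  have g1 := g 1
  have g2 := g 2
  have g3 := g 3
  have g4 := g 4
  obtain ⟨a1, b1⟩ := g1
  obtain ⟨a2, b2⟩ := g2
  obtain ⟨a3, b3⟩ := g3
  obtain ⟨a4, b4⟩ := g4
  nlinarith only [e2, f0, f1, a1, a2, a3, a4, b1, b2, b3, b4, t0, t1]

lemma exp_neg_half_ge : 0.6065 ≤ Real.exp (-0.5) := by
  have h : Real.exp (-0.5) ^ 2 = (Real.exp 1)⁻¹ := by
    rw [← Real.exp_nat_mul, ← Real.exp_neg]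
    norm_num
  have h2 : 0.36787 ≤ (Real.exp 1)⁻¹ := by
    rw [le_inv_comm₀ (by norm_num) (Real.exp_pos _)]
    linarith [Real.exp_one_lt_d9]
  by_contra! h3
  have := Real.exp_pos (-0.5)
  nlinarith

lemma exp_neg_fifth_ge : 0.8187 ≤ Real.exp (-0.2) := by
  have h : Real.exp (-0.2) ^ 5 = (Real.exp 1)⁻¹ := by
    rw [← Real.exp_nat_mul, ← Real.exp_neg]
    norm_num
  have h2 : 0.36787 ≤ (Real.exp 1)⁻¹ := by
    rw [le_inv_comm₀ (by norm_num) (Real.exp_pos _)]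
    linarith [Real.exp_one_lt_d9]
  by_contra! h3
  have := pow_le_pow_left₀ (Real.exp_pos _).le h3.le 5
  norm_num at this h
  linarith

lemma exp_neg_ge_tangent_half {x : ℝ} (hx : x ≤ 1.5) : 0.6065 * (1.5 - x) ≤ Real.exp (-x) := by
  have h := Real.add_one_le_exp (0.5 - x)
  have e : Real.exp (-x) = Real.exp (-0.5) * Real.exp (0.5 - x) := by
    rw [← Real.exp_add]
    congr 1
    ring
  rw [e]
  exact mul_le_mul exp_neg_half_ge (by linarith) (by linarith) (Real.exp_pos _).le

lemma exp_neg_ge_tangent_fifth {x : ℝ} (hx : x ≤ 1.2) : 0.8187 * (1.2 - x) ≤ Real.exp (-x) := by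
  have h := Real.add_one_le_exp (0.2 - x)
  have e : Real.exp (-x) = Real.exp (-0.2) * Real.exp (0.2 - x) := by
    rw [← Real.exp_add]
    congr 1
    ring
  rw [e]
  exact mul_le_mul exp_neg_fifth_ge (by linarith) (by linarith) (Real.exp_pos _).le

/-- Savings in the smoothing error for a long exponential average. -/
noncomputable def farGain (m : ℝ) : ℝ := if m ≤ 0.28 then 0 else 0.39789 - 0.10514 / m

lemma gain_full {δ m : ℝ} (hm : 0 < m) (hm1 : m ≤ 0.78) (h : m ≤ 0.7 * δ) :
    δ * (0.936 + 0.05 * δ + 0.03 * δ ^ 2 - farGain m) <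
      (δ - m) + δ / 2 * (δ - m) ^ 2 / 2 - (δ - m) ^ 3 / 6 + m * (1 - m ^ 2 / 2) := by
  have hd : 0 < δ := by linarith
  have e : (δ - m) + δ / 2 * (δ - m) ^ 2 / 2 - (δ - m) ^ 3 / 6 + m * (1 - m ^ 2 / 2) =
      δ * (1 + δ ^ 2 / 12 - m ^ 2 / 4) - m ^ 2 * m / 3 := by ring
  have h2 : m ^ 2 * m ≤ m ^ 2 * (0.7 * δ) := by gcongr
  have h3 : 0 < 0.0522 - 0.4834 * m ^ 2 + farGain m := by
    unfold farGain
    split_ifs with h4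
    · nlinarith
    · push Not at h4
      have : 0.10514 / m ≤ 0.0522 - 0.4834 * m ^ 2 + 0.39789 - 0.005 := by
        rw [div_le_iff₀ hm]
        nlinarith [mul_nonneg (sub_nonneg.2 h4.le) (sub_nonneg.2 hm1), mul_nonneg hm.le (mul_nonneg (sub_nonneg.2 h4.le) (sub_nonneg.2 hm1))]
      linarith
  have h4 : 0.936 + 0.05 * δ + 0.03 * δ ^ 2 - farGain m <
      1 + δ ^ 2 / 12 - m ^ 2 / 4 - 0.2334 * m ^ 2 := by
    nlinarith [sq_nonneg (δ - 0.469)]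
  rw [e]
  nlinarith [mul_lt_mul_of_pos_left h4 hd, sq_nonneg m]

lemma half_cell_one {m s : ℝ} (h0 : 0.28 ≤ m) (h1 : m ≤ 0.55) (s0 : 0.5 ≤ s) (s1 : s ≤ 1.4286) :
    0 < 0.48244 - 0.8187 * m ^ 2 * (s / 4 + 0.625) + s * (0.14364 - 0.10514 / m) -
      0.05 * m * s ^ 2 - 0.03 * m ^ 2 * s ^ 3 := by
  have hm : 0 < m := by linarith
  have a1 : s ^ 2 ≤ 1.4286 ^ 2 := by gcongr
  have a2 : s ^ 3 ≤ 1.4286 ^ 3 := by gcongr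
  have c : 0.14364 - 0.10514 / m ≤ 0 := by
    rw [sub_nonpos, le_div_iff₀ hm]
    linarith
  have a3 : 1.4286 * (0.14364 - 0.10514 / m) ≤ s * (0.14364 - 0.10514 / m) :=
    mul_le_mul_of_nonpos_right s1 c
  have a4 : m * s ^ 2 ≤ m * 1.4286 ^ 2 := by gcongr
  have a5 : m ^ 2 * s ^ 3 ≤ m ^ 2 * 1.4286 ^ 3 := by gcongr
  have a6 : m ^ 2 * (s / 4 + 0.625) ≤ m ^ 2 * (1.4286 / 4 + 0.625) := by gcongr
  have a7 : 1.4286 * (0.10514 / m) ≤ 0.48244 - 0.8187 * m ^ 2 * (1.4286 / 4 + 0.625) +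
      1.4286 * 0.14364 - 0.05 * m * 1.4286 ^ 2 - 0.03 * m ^ 2 * 1.4286 ^ 3 - 0.01 := by
    rw [mul_div_assoc', div_le_iff₀ hm]
    norm_num
    nlinarith [mul_nonneg (sub_nonneg.2 h0) (sub_nonneg.2 h1), mul_nonneg hm.le (mul_nonneg (sub_nonneg.2 h0) (sub_nonneg.2 h1))]
  linarith

lemma half_cell_two {m s : ℝ} (h0 : 0.55 ≤ m) (h1 : m ≤ 0.78) (s0 : 0.5 ≤ s) (s1 : s ≤ 1.1) :
    0 < 0.40975 - 0.6065 * m ^ 2 * (s / 4 + 0.625) + s * (0.14364 - 0.10514 / m) -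
      0.05 * m * s ^ 2 - 0.03 * m ^ 2 * s ^ 3 := by
  have hm : 0 < m := by linarith
  have a4 : m * s ^ 2 ≤ m * 1.1 ^ 2 := by gcongr
  have a5 : m ^ 2 * s ^ 3 ≤ m ^ 2 * 1.1 ^ 3 := by gcongr
  have a6 : m ^ 2 * (s / 4 + 0.625) ≤ m ^ 2 * (1.1 / 4 + 0.625) := by gcongr
  rcases le_total (0.14364 - 0.10514 / m) 0 with c | c
  · have a3 : 1.1 * (0.14364 - 0.10514 / m) ≤ s * (0.14364 - 0.10514 / m) :=
      mul_le_mul_of_nonpos_right s1 c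
    have a7 : 1.1 * (0.10514 / m) ≤ 0.40975 - 0.6065 * m ^ 2 * (1.1 / 4 + 0.625) +
        1.1 * 0.14364 - 0.05 * m * 1.1 ^ 2 - 0.03 * m ^ 2 * 1.1 ^ 3 - 0.001 := by
      rw [mul_div_assoc', div_le_iff₀ hm]
      norm_num
      nlinarith [mul_nonneg (sub_nonneg.2 h0) (sub_nonneg.2 h1), mul_nonneg hm.le (mul_nonneg (sub_nonneg.2 h0) (sub_nonneg.2 h1))]
    linarith
  · have a3 : 0 ≤ s * (0.14364 - 0.10514 / m) := mul_nonneg (by linarith) c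
    nlinarith

lemma half_cell_three {m s : ℝ} (h0 : 0.55 ≤ m) (h1 : m ≤ 0.78) (s0 : 1.1 ≤ s) (s1 : s ≤ 1.4286) :
    0 < 0.40975 - 0.6065 * m ^ 2 * (s / 4 + 0.625) + s * (0.14364 - 0.10514 / m) -
      0.05 * m * s ^ 2 - 0.03 * m ^ 2 * s ^ 3 + m ^ 2 * ((s - 0.5) ^ 2 * (s + 1) / 12) := by
  have hm : 0 < m := by linarith
  have t : 0.11 + 0.34 * (s - 1.27) ≤ (s - 0.5) ^ 2 * (s + 1) / 12 := by
    nlinarith [mul_nonneg (show 0 ≤ s by linarith) (sq_nonneg (s - 1.27)), sq_nonneg (s - 1.27)]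
  have t' : m ^ 2 * (0.11 + 0.34 * (s - 1.27)) ≤ m ^ 2 * ((s - 0.5) ^ 2 * (s + 1) / 12) := by gcongr
  have a4 : m * s ^ 2 ≤ m * (2.5286 * s - 1.1 * 1.4286) := by
    gcongr
    nlinarith [mul_nonneg (sub_nonneg.2 s0) (sub_nonneg.2 s1)]
  have a5 : m ^ 2 * s ^ 3 ≤ m ^ 2 * (4.823 * s - 3.973) := by
    gcongr
    nlinarith [mul_nonneg (sub_nonneg.2 s0) (sub_nonneg.2 s1), mul_nonneg (show 0 ≤ s by linarith) (mul_nonneg (sub_nonneg.2 s0) (sub_nonneg.2 s1))]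
  have key : ∀ t : ℝ, (t = 1.1 ∨ t = 1.4286) → 0.10514 * t ≤ (0.40975 - 0.6065 * m ^ 2 * (t / 4 + 0.625) +
      t * 0.14364 - 0.05 * (m * (2.5286 * t - 1.1 * 1.4286)) - 0.03 * (m ^ 2 * (4.823 * t - 3.973)) +
      m ^ 2 * (0.11 + 0.34 * (t - 1.27)) - 0.001) * m := by
    rintro t (rfl | rfl) <;> norm_num <;>
    nlinarith [mul_nonneg (sub_nonneg.2 h0) (sub_nonneg.2 h1), mul_nonneg hm.le (mul_nonneg (sub_nonneg.2 h0) (sub_nonneg.2 h1))]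
  have k1 := mul_le_mul_of_nonneg_left (key _ (Or.inl rfl)) (show 0 ≤ (1.4286 - s) by linarith)
  have k2 := mul_le_mul_of_nonneg_left (key _ (Or.inr rfl)) (show 0 ≤ (s - 1.1) by linarith)
  have k3 : 0.10514 * s ≤ (0.40975 - 0.6065 * m ^ 2 * (s / 4 + 0.625) +
      s * 0.14364 - 0.05 * (m * (2.5286 * s - 1.1 * 1.4286)) - 0.03 * (m ^ 2 * (4.823 * s - 3.973)) +
      m ^ 2 * (0.11 + 0.34 * (s - 1.27)) - 0.001) * m := by
    linarith
  have k4 : s * (0.10514 / m) ≤ 0.40975 - 0.6065 * m ^ 2 * (s / 4 + 0.625) +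
      s * 0.14364 - 0.05 * (m * (2.5286 * s - 1.1 * 1.4286)) - 0.03 * (m ^ 2 * (4.823 * s - 3.973)) +
      m ^ 2 * (0.11 + 0.34 * (s - 1.27)) - 0.001 := by
    rw [mul_div_assoc', div_le_iff₀ hm]
    linarith
  linarith

lemma gain_half {δ m : ℝ} (hm : 0 < m) (hm1 : m ≤ 0.78) (h : 0.7 * δ ≤ m) (h' : m ≤ 2 * δ) :
    δ * (0.936 + 0.05 * δ + 0.03 * δ ^ 2 + 0.31825 - farGain m) <
      (δ - 0.5 * m) + δ / 2 * (δ - 0.5 * m) ^ 2 / 2 - (δ - 0.5 * m) ^ 3 / 6 +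
        m * Real.exp (-(δ * m / 4 + 5 * m ^ 2 / 8)) := by
  have hd : 0 < δ := by linarith
  have e : (δ - 0.5 * m) + δ / 2 * (δ - 0.5 * m) ^ 2 / 2 - (δ - 0.5 * m) ^ 3 / 6 =
      δ - 0.5 * m + (δ - 0.5 * m) ^ 2 * (δ + m) / 12 := by ring
  rw [e]
  obtain ⟨s, rfl⟩ : ∃ s, δ = m * s := ⟨δ / m, by field_simp⟩
  have s0 : 0.5 ≤ s := by nlinarith
  have s1 : s ≤ 1.4286 := by nlinarith
  have hd2 : 0 ≤ (m * s - 0.5 * m) ^ 2 * (m * s + m) / 12 := by positivity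
  have hm' : m * s * (0.10514 / m) = m * (s * (0.10514 / m)) := by ring
  unfold farGain
  split_ifs with h4
  · have hx := Real.add_one_le_exp (-(m * s * m / 4 + 5 * m ^ 2 / 8))
    have hx' := mul_le_mul_of_nonneg_left hx hm.le
    have h5 : 0 < 0.5 - m ^ 2 * (s / 4 + 5 / 8) - 0.25425 * s - 0.05 * m * s ^ 2
        - 0.03 * m ^ 2 * s ^ 3 := by
      have a1 : m * s ^ 2 ≤ 0.28 * (1.4286 * s) := by
        rw [sq]; gcongr
      have a2 : m ^ 2 * s ^ 3 ≤ 0.28 ^ 2 * (1.4286 ^ 2 * s) := by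
        rw [pow_succ s 2]; gcongr
      have a3 : m ^ 2 * (s / 4 + 5 / 8) ≤ 0.28 ^ 2 * (s / 4 + 5 / 8) := by gcongr
      nlinarith
    nlinarith [mul_pos hm h5]
  · push Not at h4
    rcases le_total m 0.55 with h6 | h6
    · have hx := exp_neg_ge_tangent_fifth (x := m * s * m / 4 + 5 * m ^ 2 / 8) (by nlinarith)
      have hx' := mul_le_mul_of_nonneg_left hx hm.le
      have := mul_pos hm (half_cell_one h4.le h6 s0 s1)
      nlinarith
    · have hx := exp_neg_ge_tangent_half (x := m * s * m / 4 + 5 * m ^ 2 / 8) (by nlinarith)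
      have hx' := mul_le_mul_of_nonneg_left hx hm.le
      rcases le_total s 1.1 with h7 | h7
      · have := mul_pos hm (half_cell_two h6 hm1 s0 h7)
        nlinarith
      · have := mul_pos hm (half_cell_three h6 hm1 h7 s1)
        nlinarith

lemma gain_zero {δ m : ℝ} (hd : 0 < δ) (hm : 0 < m) (hm1 : m ≤ 0.78) (h : 2 * δ ≤ m) :
    δ * (0.936 + 0.05 * δ + 0.03 * δ ^ 2 + 0.84283 - farGain m) <
      δ + δ / 2 * δ ^ 2 / 2 - δ ^ 3 / 6 + m * Real.exp (-(δ * m / 2 + m ^ 2)) := by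
  have hX : δ * m / 2 + m ^ 2 ≤ 1.25 * m ^ 2 := by nlinarith
  have hδ : 0.05 * δ + 0.03 * δ ^ 2 ≤ 0.025 := by nlinarith
  have h1 : 2 * δ * Real.exp (-(δ * m / 2 + m ^ 2)) ≤ m * Real.exp (-(δ * m / 2 + m ^ 2)) := by
    gcongr
  suffices 0.936 + 0.025 + 0.84283 - farGain m < 1 + 2 * Real.exp (-(δ * m / 2 + m ^ 2)) by
    have h3 : 0 ≤ δ ^ 3 := by positivity
    have := mul_lt_mul_of_pos_left this hd
    nlinarith [mul_le_mul_of_nonneg_left hδ hd.le]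
  rcases le_total m 0.5 with h5 | h5
  · have hx := Real.add_one_le_exp (-(δ * m / 2 + m ^ 2))
    have h6 : -0.2 ≤ farGain m := by
      unfold farGain
      split_ifs with h4
      · norm_num
      · push Not at h4
        have : 0.10514 / m ≤ 0.4 := by
          rw [div_le_iff₀ hm]
          linarith
        linarith
    nlinarith
  · have hx := exp_neg_ge_tangent_half (x := δ * m / 2 + m ^ 2) (by nlinarith)
    have h6 : 0.18 ≤ farGain m := by
      unfold farGain
      rw [if_neg (by push Not; linarith)]
      have : 0.10514 / m ≤ 0.2103 := by
        rw [div_le_iff₀ hm]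
        linarith
      linarith
    nlinarith

/-- A shift for which the Gaussian gain beats the smoothing and counting errors. -/
lemma exists_shift {l δ m : ℝ} (hd : 0 < δ) (hl : δ ≤ 2 * l) (hm : 0 < m) (hm1 : m ≤ 0.78) :
    ∃ q E : ℝ, 0 ≤ E ∧ 2 * Real.exp (-q) ≤ 0.73576 + 3 / 2 * E ∧ 0 ≤ δ - q * m ∧
      δ * (0.936 + 0.05 * δ + 0.03 * δ ^ 2 + E - farGain m) <
        (δ - q * m) + l * (δ - q * m) ^ 2 / 2 - (δ - q * m) ^ 3 / 6 +
        m * Real.exp (l * (δ - q * m + m) -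
          ((δ - q * m) ^ 2 + 2 * (δ - q * m) * m + 2 * m ^ 2) / 2) := by
  have mono : ∀ d X : ℝ, 0 ≤ d → δ / 2 * (d + m) - (d ^ 2 + 2 * d * m + 2 * m ^ 2) / 2 = X →
      d + δ / 2 * d ^ 2 / 2 - d ^ 3 / 6 + m * Real.exp X ≤
      d + l * d ^ 2 / 2 - d ^ 3 / 6 +
        m * Real.exp (l * (d + m) - (d ^ 2 + 2 * d * m + 2 * m ^ 2) / 2) := by
    rintro d X hd0 rfl
    have : δ / 2 ≤ l := by linarith
    gcongr
  rcases le_total m (0.7 * δ) with h | h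
  · refine ⟨1, 0, le_rfl, ?_, by linarith, ?_⟩
    · have h1 : Real.exp (-1) ≤ 0.36788 := by
        rw [Real.exp_neg, inv_le_comm₀ (Real.exp_pos _) (by norm_num)]
        have := Real.exp_one_gt_d9
        norm_num
        linarith
      linarith
    · rw [add_zero, one_mul]
      refine (gain_full hm hm1 h).trans_le (le_trans ?_
        (mono (δ - m) (-(m ^ 2 / 2)) (by linarith) (by ring)))
      have := Real.add_one_le_exp (-(m ^ 2 / 2))
      nlinarith
  rcases le_total m (2 * δ) with h' | h'
  · refine ⟨0.5, 0.31825, by norm_num, ?_, by linarith, ?_⟩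
    · have h1 : Real.exp (-0.5) ≤ 0.606532 := by
        have h : Real.exp (-0.5) ^ 2 = (Real.exp 1)⁻¹ := by
          rw [← Real.exp_nat_mul, ← Real.exp_neg]
          norm_num
        have h2 : (Real.exp 1)⁻¹ ≤ 0.36788 := by
          rw [inv_le_comm₀ (Real.exp_pos _) (by norm_num)]
          have := Real.exp_one_gt_d9
          norm_num
          linarith
        by_contra! h3
        nlinarith
      linarith
    · exact (gain_half hm hm1 h h').trans_le
        (mono (δ - 0.5 * m) _ (by linarith) (by ring))
  · refine ⟨0, 0.84283, by norm_num, ?_, by linarith, ?_⟩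
    · norm_num
    · rw [zero_mul, sub_zero]
      exact (gain_zero hd hm hm1 h').trans_le (mono δ _ hd.le (by ring))

lemma one_div_sqrt_two_pi_le : 1 / √(2 * π) ≤ 0.398943 := by
  have h : 1 / 0.398943 ≤ √(2 * π) := by
    apply le_sqrt_of_sq_le
    nlinarith [Real.pi_gt_d6]
  rw [div_le_iff₀ (by positivity)]
  rw [div_le_iff₀ (by norm_num)] at h
  linarith

lemma gaussPdf_le_half {l δ : ℝ} (hd : 0 < δ) (hl : δ ≤ 2 * l) :
    gaussPdf l ≤ 0.398943 * Real.exp (-(δ ^ 2 / 8)) := by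
  have h1 := one_div_sqrt_two_pi_le
  have h2 : Real.exp (-(l ^ 2) / 2) ≤ Real.exp (-(δ ^ 2 / 8)) := by
    apply Real.exp_le_exp.2
    nlinarith
  calc gaussPdf l = 1 / √(2 * π) * Real.exp (-(l ^ 2) / 2) := by rw [gaussPdf]; ring
    _ ≤ _ := by gcongr

lemma gaussPdf_mul_le {l δ : ℝ} (hd : 0 < δ) (hl : δ ≤ 2 * l) :
    gaussPdf l * δ ≤ 0.48395 ∧
      gaussPdf l * δ * (1 + δ ^ 2 / 8 + δ ^ 4 / 128) ≤ 0.39895 * δ := by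
  have h := gaussPdf_le_half hd hl
  have he : Real.exp (-(δ ^ 2 / 8)) * Real.exp (δ ^ 2 / 8) = 1 := by
    rw [← Real.exp_add]; simp
  have hp := Real.exp_pos (-(δ ^ 2 / 8))
  constructor
  · have h2 : δ * Real.exp (-(δ ^ 2 / 8)) ≤ 2 * 0.60653066 := by
      have h3 := Real.add_one_le_exp (δ ^ 2 / 8 - 1 / 2)
      have h4 : Real.exp (δ ^ 2 / 8 - 1 / 2) = Real.exp (δ ^ 2 / 8) * Real.exp (-(1 / 2)) := by
        rw [← Real.exp_add]; ring_nf
      have h5 : Real.exp (-(1 / 2)) ≤ 0.60653066 := by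
        have h6 : Real.exp (-(1 / 2)) ^ 2 * Real.exp 1 = 1 := by
          rw [← Real.exp_nat_mul, ← Real.exp_add]; norm_num
        have h7 := Real.exp_one_gt_d9
        by_contra! h8
        have h9 : (0.60653066 : ℝ) ^ 2 < Real.exp (-(1 / 2)) ^ 2 := by gcongr
        nlinarith
      have h6 : δ / 2 ≤ Real.exp (δ ^ 2 / 8) * 0.60653066 := by
        nlinarith [sq_nonneg (δ - 2), mul_le_mul_of_nonneg_left h5 (Real.exp_pos (δ ^ 2 / 8)).le]
      nlinarith [mul_le_mul_of_nonneg_right h6 hp.le]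
    nlinarith
  · have h2 := Real.quadratic_le_exp_of_nonneg (show 0 ≤ δ ^ 2 / 8 by positivity)
    have h3 : Real.exp (-(δ ^ 2 / 8)) * (1 + δ ^ 2 / 8 + δ ^ 4 / 128) ≤ 1 := by
      nlinarith [mul_le_mul_of_nonneg_left h2 hp.le]
    have h4 : 0 < 1 + δ ^ 2 / 8 + δ ^ 4 / 128 := by positivity
    nlinarith [mul_le_mul_of_nonneg_right h (mul_pos hd h4).le, mul_le_mul_of_nonneg_right h3 hd.le]

/-- The parameters `τ = 1 / (1 + T / 2)` and `θ = δ φ(l)` describe the Berry-Esseen ratios. -/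
lemma ratio_params {T q θ : ℝ} (hT : 1 ≤ T) (hq : 0 < q) (hθ : q * θ = 1 + T / 2) :
    0 < 1 / (1 + T / 2) ∧ 1 / (1 + T / 2) ≤ 2 / 3 ∧ 1 / q = 1 / (1 + T / 2) * θ ∧
      T / q = (2 - 2 * (1 / (1 + T / 2))) * θ ∧ (T + 1) / q = (2 - 1 / (1 + T / 2)) * θ := by
  have h : 0 < 1 + T / 2 := by linarith
  have e : θ = (1 + T / 2) / q := by rw [eq_div_iff hq.ne']; linarith
  refine ⟨by positivity, ?_, ?_, ?_, ?_⟩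
  · rw [div_le_div_iff₀ h (by norm_num)]; linarith
  all_goals
    rw [e]
    have : 2 + T ≠ 0 := by linarith
    field_simp
  all_goals ring

lemma exp_neg_half_sq_le {U : ℝ} (hU : 4.339 ≤ U) : Real.exp (-(0.5 * U ^ 2)) ≤ 0.0003 := by
  have h2 : 18.826 ≤ U ^ 2 := by nlinarith
  have h := exp_neg_le_inv_sq (x := 0.125 * U ^ 2) (by positivity)
  have h3 : 0.54135 / (0.125 * U ^ 2) ^ 2 ≤ 0.1 := by
    rw [div_le_iff₀ (by positivity)]
    nlinarith
  calc Real.exp (-(0.5 * U ^ 2)) = Real.exp (-(0.125 * U ^ 2)) ^ 4 := by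
        rw [← Real.exp_nat_mul]; congr 1; push_cast; ring
    _ ≤ 0.1 ^ 4 := by gcongr; exact h.trans h3
    _ ≤ _ := by norm_num

lemma near_term_le {τ θ U : ℝ} (h0 : 0 < θ) (t1 : τ ≤ 2 / 3)
    (hU : U = 4.2 / ((2 - τ) * θ)) : √(π / 2) / U ≤ θ * ((2 - τ) * 0.29842) := by
  have hp : 0 < (2 - τ) * θ := by
    have : 0 < 2 - τ := by linarith
    positivity
  rw [hU, div_div_eq_mul_div, div_le_iff₀ (by norm_num)]
  nlinarith [mul_le_mul_of_nonneg_right sqrt_pi_div_two_le hp.le]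

lemma far_term_le {τ θ U m : ℝ} (h0 : 0 < θ) (h1 : θ ≤ 0.48395) (t0 : 0 < τ) (t1 : τ ≤ 2 / 3)
    (hU : U = 4.2 / ((2 - τ) * θ)) (hm : 0 < m) :
    1.04 / π * ((1 + Real.exp (-(0.5 * U ^ 2))) / (m * U)) ≤ θ * ((2 - τ) * 0.07885 / m) := by
  have hp' : 0 < 2 - τ := by linarith
  have hp : 0 < (2 - τ) * θ := by positivity
  have hU' : 4.339 ≤ U := by
    rw [hU, le_div_iff₀ hp]
    nlinarith
  have he := exp_neg_half_sq_le hU'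
  have hi : 1 / U = (2 - τ) * θ / 4.2 := by rw [hU, one_div_div]
  calc _ = 1.04 * (1 / π) * ((1 + Real.exp (-(0.5 * U ^ 2))) * (1 / U) / m) := by
        field_simp
    _ ≤ 1.04 * 0.31831 * ((1 + 0.0003) * (1 / U) / m) := by
        have : 0 < 1 / U := by rw [hi]; positivity
        gcongr
        exact one_div_pi_le
    _ ≤ _ := by
        have e : ∀ a b : ℝ, a ≤ b → 1.04 * 0.31831 * (a / m) ≤ 1.04 * 0.31831 * (b / m) :=
          fun a b hab => by gcongr
        refine (e _ (0.238169 * ((2 - τ) * θ))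
          (by rw [hi]; rw [mul_div_assoc', div_le_iff₀ (by norm_num)]; nlinarith [hp])).trans (le_of_sub_nonneg ?_)
        have : θ * ((2 - τ) * 0.07885 / m) - 1.04 * 0.31831 * (0.238169 * ((2 - τ) * θ) / m) =
          (0.07885 - 1.04 * 0.31831 * 0.238169) * ((2 - τ) * θ) / m := by ring
        rw [this]
        have : (0 : ℝ) ≤ 0.07885 - 1.04 * 0.31831 * 0.238169 := by norm_num
        positivity

lemma farGain_le {τ m : ℝ} (t1 : τ ≤ 2 / 3) (hm : 0.28 < m) :
    (2 - τ) * 0.07885 / m ≤ (2 - τ) * 0.29842 - farGain m := by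
  rw [farGain, if_neg (not_le.2 hm)]
  have hm0 : 0 < m := by linarith
  have hi : 1 / m ≤ 3.5715 := by
    rw [div_le_iff₀ hm0]; linarith
  have h0 : 0 < 1 / m := by positivity
  rw [div_eq_mul_one_div, div_eq_mul_one_div 0.10514]
  nlinarith

section
variable {α : Type*} [Fintype α] {P v : α → ℝ}

/-- The averaged tail is below the Gaussian value when the lattice scale `m` is not large. -/
lemma averaged_lt_of_scale_le (h : Standardized P v) {n : ℕ} (hn : 0 < n) {l δ m : ℝ}
    (hd : 0 < δ) (hl : δ < 2 * l) (hm : 0 < m) (hm1 : m ≤ 0.78)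
    (hδ : √n * (gaussPdf l * δ) = 1 + (∑ a, P a * |v a| ^ 3) / 2) :
    ∃ x, 2 / √n * Real.exp ((l - δ - x) / m) + ∑ z : Fin n → α, (∏ i, P (z i)) *
      max 0 (1 - Real.exp (-((x - (∑ i, v (z i)) / √n) / m))) < gaussPhi l := by
  obtain ⟨h1, hpoly⟩ := gaussPdf_mul_le hd hl.le
  have hφ := gaussPdf_pos l
  have hT := h.one_le_third
  have hq : 0 < √(n : ℝ) := sqrt_pos.2 (by exact_mod_cast hn)
  obtain ⟨t0, t1, e1, e2, e3⟩ := ratio_params hT hq hδ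
  set T := ∑ a, P a * |v a| ^ 3
  set τ := 1 / (1 + T / 2)
  set θ := gaussPdf l * δ with hθ
  have h0 : 0 < θ := by positivity
  have hn1 : (1 : ℝ) / n = τ ^ 2 * θ ^ 2 := by
    rw [← mul_pow, ← e1, div_pow, one_pow, sq_sqrt n.cast_nonneg]
  have hn2 : (1 : ℝ) / n ≤ 0.11 := by
    rw [hn1, ← mul_pow]
    have : τ * θ ≤ 2 / 3 * 0.48395 := by gcongr
    nlinarith [mul_pos t0 h0]
  obtain ⟨q, E, hE, hqE, hdq, hJ⟩ := exists_shift hd hl.le hm hm1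
  have hfb := freqBound_le (n := n) h0 h1 t0 t1 hn1 rfl
  set U := 4.2 / ((2 - τ) * θ) with hU
  have hU' : U = 4.2 / ((T + 1) / √n) := by rw [e3]
  have hintegrable := integral_exp_neg_mul_gaussPhi_le l hdq hm
  have hB := lhs_le h0 h1 t0 t1 hd hpoly
  have hS : ∑ z : Fin n → α, (∏ i, P (z i)) *
      max 0 (1 - Real.exp (-((l - (δ - q * m) - (∑ i, v (z i)) / √n) / m))) ≤
      (∫ y in Ioi 0, Real.exp (-y) * gaussPhi (l - (δ - q * m) - m * y)) +
        θ * (freqPoly τ θ + (2 - τ) * 0.29842 - farGain m) := by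
    rcases le_or_gt m 0.28 with hm2 | hm2
    · have := averaged_smoothing_near h hn hn2 hU' hm (l - (δ - q * m))
      have h5 := near_term_le h0 t1 hU
      rw [e2] at this
      rw [farGain, if_pos hm2]
      linarith
    · have := averaged_smoothing_far h hn hn2 hU' hm (l - (δ - q * m))
      have h5 := far_term_le h0 h1 t0 t1 hU hm
      have h6 := mul_le_mul_of_nonneg_left (farGain_le t1 hm2) h0.le
      rw [e2, mul_add] at this
      linarith
  have hexp : 2 / √n * Real.exp ((l - δ - (l - (δ - q * m))) / m) ≤ θ * (0.73576 * τ + E) := by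
    have e5 : (l - δ - (l - (δ - q * m))) / m = -q := by field_simp; ring
    rw [e5, div_eq_mul_one_div, e1]
    calc 2 * (τ * θ) * Real.exp (-q) = τ * θ * (2 * Real.exp (-q)) := by ring
      _ ≤ τ * θ * (0.73576 + 3 / 2 * E) := by gcongr
      _ = θ * (0.73576 * τ + 3 / 2 * τ * E) := by ring
      _ ≤ θ * (0.73576 * τ + E) := by gcongr; nlinarith
  refine ⟨l - (δ - q * m), ?_⟩
  have h7 := mul_lt_mul_of_pos_left hJ hφ
  have h8 : θ * ((2 - τ) * 0.29842 + freqPoly τ θ + 0.73576 * τ + (E - farGain m)) ≤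
      gaussPdf l * (δ * (0.936 + 0.05 * δ + 0.03 * δ ^ 2 + E - farGain m)) := by
    rw [hθ, mul_assoc]
    gcongr
    linarith
  linarith

end

section
variable {α : Type*} [Fintype α] {P v : α → ℝ}

lemma sum_iid_succ (n : ℕ) (F : α → (Fin n → α) → ℝ) :
    ∑ z : Fin (n + 1) → α, F (z 0) (Fin.tail z) = ∑ a, ∑ z : Fin n → α, F a z := by
  rw [← Fintype.sum_prod_type']
  exact Fintype.sum_equiv (Fin.consEquiv fun _ => α).symm _ _ fun z => rfl

/-- The first three moments of a sum of i.i.d. standardized variables. -/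
lemma Standardized.moments (h : Standardized P v) (n : ℕ) :
    ∑ z : Fin n → α, ∏ i, P (z i) = 1 ∧
    ∑ z : Fin n → α, (∏ i, P (z i)) * ∑ i, v (z i) = 0 ∧
    ∑ z : Fin n → α, (∏ i, P (z i)) * (∑ i, v (z i)) ^ 2 = n := by
  induction n with
  | zero => simp
  | succ n ih =>
    obtain ⟨i0, i1, i2⟩ := ih
    have e0 := sum_iid_succ (α := α) n fun a z => P a * ∏ i, P (z i)
    have e1 := sum_iid_succ (α := α) n fun a z => (P a * ∏ i, P (z i)) * (v a + ∑ i, v (z i))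
    have e2 := sum_iid_succ (α := α) n fun a z =>
      (P a * ∏ i, P (z i)) * (v a + ∑ i, v (z i)) ^ 2
    simp only [Fin.prod_univ_succ, Fin.sum_univ_succ]
    simp only [Fin.tail] at e0 e1 e2
    rw [e0, e1, e2]
    have f0 : ∀ a, ∑ z : Fin n → α, P a * ∏ i, P (z i) = P a := fun a => by
      rw [← Finset.mul_sum, i0, mul_one]
    have f1 : ∀ a, ∑ z : Fin n → α, (P a * ∏ i, P (z i)) * (v a + ∑ i, v (z i)) = P a * v a :=
      fun a => by
      have : ∀ z : Fin n → α, (P a * ∏ i, P (z i)) * (v a + ∑ i, v (z i)) =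
        P a * v a * ∏ i, P (z i) + P a * ((∏ i, P (z i)) * ∑ i, v (z i)) := fun z => by ring
      simp only [this]
      rw [Finset.sum_add_distrib, ← Finset.mul_sum, ← Finset.mul_sum, i0, i1]
      ring
    have f2 : ∀ a, ∑ z : Fin n → α, (P a * ∏ i, P (z i)) * (v a + ∑ i, v (z i)) ^ 2 =
        P a * v a ^ 2 + P a * n := fun a => by
      have : ∀ z : Fin n → α, (P a * ∏ i, P (z i)) * (v a + ∑ i, v (z i)) ^ 2 =
        P a * v a ^ 2 * ∏ i, P (z i) + 2 * P a * v a * ((∏ i, P (z i)) * ∑ i, v (z i)) +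
          P a * ((∏ i, P (z i)) * (∑ i, v (z i)) ^ 2) := fun z => by ring
      simp only [this]
      rw [Finset.sum_add_distrib, Finset.sum_add_distrib, ← Finset.mul_sum, ← Finset.mul_sum,
        ← Finset.mul_sum, i0, i1, i2]
      ring
    simp only [f0, f1, f2]
    refine ⟨h.sum, h.mean, ?_⟩
    rw [Finset.sum_add_distrib, h.var, ← Finset.sum_mul, h.sum]
    push_cast
    ring

lemma Standardized.sum_quadratic (h : Standardized P v) {n : ℕ} (hn : 0 < n) (b k : ℝ) :
    ∑ z : Fin n → α, (∏ i, P (z i)) * (b - k * ((∑ i, v (z i)) / √n)) ^ 2 = b ^ 2 + k ^ 2 := by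
  obtain ⟨i0, i1, i2⟩ := h.moments n
  have hn0 : (0 : ℝ) < n := by exact_mod_cast hn
  have hs : √(n : ℝ) ^ 2 = n := sq_sqrt hn0.le
  have : ∀ z : Fin n → α, (∏ i, P (z i)) * (b - k * ((∑ i, v (z i)) / √n)) ^ 2 =
      b ^ 2 * ∏ i, P (z i) - 2 * b * k / √n * ((∏ i, P (z i)) * ∑ i, v (z i)) +
        k ^ 2 / √n ^ 2 * ((∏ i, P (z i)) * (∑ i, v (z i)) ^ 2) := fun z => by ring
  simp only [this]
  rw [Finset.sum_add_distrib, Finset.sum_sub_distrib, ← Finset.mul_sum, ← Finset.mul_sum,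
    ← Finset.mul_sum, i0, i1, i2, hs]
  field_simp
  ring

lemma max_one_sub_exp_le {D : ℝ} (hD : 0 < D) (s : ℝ) :
    (1 + D) * max 0 (1 - Real.exp (-(s + Real.log (1 + D)))) ≤ (s + 2 * D) ^ 2 / (4 * D) := by
  have h1 : 0 < 1 + D := by linarith
  rw [mul_max_of_nonneg _ _ h1.le, mul_zero]
  refine max_le (by positivity) ?_
  rw [neg_add, Real.exp_add, Real.exp_neg (Real.log _), Real.exp_log h1]
  have h2 := Real.add_one_le_exp (-s)
  have h3 : (1 + D) * (1 - Real.exp (-s) * (1 + D)⁻¹) = 1 + D - Real.exp (-s) := by field_simp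
  have h4 : (s + 2 * D) ^ 2 / (4 * D) = s ^ 2 / (4 * D) + s + D := by field_simp; ring
  have h5 : 0 ≤ s ^ 2 / (4 * D) := by positivity
  rw [h3, h4]
  linarith

/-- A second-moment substitute for the Gaussian approximation. -/
lemma averaged_lt_of_quadratic (h : Standardized P v) {n : ℕ} (hn : 0 < n) {y m w D ε : ℝ}
    (hm : 0 < m) (hD : 0 < D)
    (hc : 2 / √n * Real.exp (-w) + (y * (1 / m) + w) +
      ((y * (1 / m) + w) ^ 2 + (1 / m) ^ 2) / (4 * D) + ε * D + ε < 1) :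
    ∃ x, 2 / √n * Real.exp ((y - x) / m) + ∑ z : Fin n → α, (∏ i, P (z i)) *
      max 0 (1 - Real.exp (-((x - (∑ i, v (z i)) / √n) / m))) < 1 - ε := by
  have h1 : 0 < 1 + D := by linarith
  refine ⟨y + (Real.log (1 + D) + w) * m, ?_⟩
  set A := y * (1 / m) + w with hA
  have e1 : (y - (y + (Real.log (1 + D) + w) * m)) / m = -(Real.log (1 + D)) + -w := by
    field_simp; ring
  rw [e1, Real.exp_add, Real.exp_neg (Real.log _), Real.exp_log h1]
  have h2 : (1 + D) * ∑ z : Fin n → α, (∏ i, P (z i)) * max 0 (1 - Real.exp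
      (-((y + (Real.log (1 + D) + w) * m - (∑ i, v (z i)) / √n) / m))) ≤
      ((A + 2 * D) ^ 2 + (1 / m) ^ 2) / (4 * D) := by
    rw [← h.sum_quadratic hn, Finset.mul_sum, Finset.sum_div]
    refine Finset.sum_le_sum fun z _ => ?_
    have e2 : (y + (Real.log (1 + D) + w) * m - (∑ i, v (z i)) / √n) / m =
        (A - 1 / m * ((∑ i, v (z i)) / √n)) + Real.log (1 + D) := by
      rw [hA]
      field_simp
      ring
    rw [e2]
    have h3 := mul_le_mul_of_nonneg_left
      (max_one_sub_exp_le hD (A - 1 / m * ((∑ i, v (z i)) / √n)))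
      (Finset.prod_nonneg fun i (_ : i ∈ Finset.univ) => h.nonneg (z i))
    refine le_trans (le_of_eq (by ring)) (h3.trans (le_of_eq (by ring)))
  have h3 : ((A + 2 * D) ^ 2 + (1 / m) ^ 2) / (4 * D) =
      (A ^ 2 + (1 / m) ^ 2) / (4 * D) + A + D := by
    field_simp; ring
  rw [h3] at h2
  rw [← mul_lt_mul_iff_right₀ h1, mul_add]
  have h4 : (1 + D) * (2 / √n * ((1 + D)⁻¹ * Real.exp (-w))) = 2 / √n * Real.exp (-w) := by
    field_simp
  rw [h4]
  linarith

end

lemma quadratic_lt_of_endpoints {a b c x lo hi : ℝ} (hc : 0 ≤ c) (h0 : lo ≤ x) (h1 : x ≤ hi)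
    (hl : a + b * lo + c * lo ^ 2 < 1) (hh : a + b * hi + c * hi ^ 2 < 1) :
    a + b * x + c * x ^ 2 < 1 := by
  rcases h0.eq_or_lt with rfl | h0
  · exact hl
  · have h2 : (a + b * x + c * x ^ 2 - 1) * (hi - lo) = (a + b * lo + c * lo ^ 2 - 1) * (hi - x) +
        (a + b * hi + c * hi ^ 2 - 1) * (x - lo) - c * ((hi - x) * (x - lo) * (hi - lo)) := by ring
    have h3 : 0 < hi - lo := by linarith
    have h4 : 0 ≤ c * ((hi - x) * (x - lo) * (hi - lo)) :=
      mul_nonneg hc (mul_nonneg (mul_nonneg (by linarith) (by linarith)) h3.le)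
    have h5 : (a + b * x + c * x ^ 2 - 1) * (hi - lo) < 0 := by
      rw [h2]
      nlinarith
    nlinarith

/-- The left side of the second-moment criterion, with `p` the density and `E` standing for
`exp (-w)`. -/
noncomputable def quadCrit (p ε l w E D d r : ℝ) : ℝ :=
  4 / 3 * p * d * E + ((l - d) * r + w) + (((l - d) * r + w) ^ 2 + r ^ 2) / (4 * D) + ε * D + ε

lemma quadCrit_lt {p ε l w E D d r lo hi R : ℝ} (hD : 0 < D) (h0 : lo ≤ d) (h1 : d ≤ hi)
    (r0 : 0 ≤ r) (r1 : r ≤ R)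
    (hl0 : quadCrit p ε l w E D lo 0 < 1) (hl1 : quadCrit p ε l w E D lo R < 1)
    (hh0 : quadCrit p ε l w E D hi 0 < 1) (hh1 : quadCrit p ε l w E D hi R < 1) :
    quadCrit p ε l w E D d r < 1 := by
  have hd : ∀ s, quadCrit p ε l w E D lo s < 1 → quadCrit p ε l w E D hi s < 1 →
      quadCrit p ε l w E D d s < 1 := by
    intro s ha hb
    have e : ∀ t, quadCrit p ε l w E D t s = (l * s + w + ((l * s + w) ^ 2 + s ^ 2) / (4 * D) +
        ε * D + ε) + (4 / 3 * p * E - s - 2 * (l * s + w) * s / (4 * D)) * t +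
        (s ^ 2 / (4 * D)) * t ^ 2 := fun t => by rw [quadCrit]; ring
    rw [e] at ha hb ⊢
    exact quadratic_lt_of_endpoints (by positivity) h0 h1 ha hb
  have e : ∀ t, quadCrit p ε l w E D d t = (4 / 3 * p * d * E + w + w ^ 2 / (4 * D) +
      ε * D + ε) + ((l - d) + 2 * (l - d) * w / (4 * D)) * t +
      (((l - d) ^ 2 + 1) / (4 * D)) * t ^ 2 := fun t => by rw [quadCrit]; ring
  have ha := hd 0 hl0 hh0
  have hb := hd R hl1 hh1
  rw [e] at ha hb ⊢
  exact quadratic_lt_of_endpoints (by positivity) r0 r1 ha hb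

lemma one_div_sqrt_two_pi_ge : 0.39894 ≤ 1 / √(2 * π) := by
  have h : √(2 * π) ≤ 1 / 0.39894 := by
    rw [sqrt_le_left (by norm_num)]
    nlinarith [Real.pi_lt_d6]
  have h0 : 0 < √(2 * π) := by positivity
  rw [le_div_iff₀ h0]
  rw [le_div_iff₀ (by norm_num)] at h
  linarith

lemma gaussPdf_eq_mul (t : ℝ) : gaussPdf t = 1 / √(2 * π) * Real.exp (-(t ^ 2 / 2)) := by
  rw [gaussPdf, show -(t ^ 2) / 2 = -(t ^ 2 / 2) by ring]
  ring

lemma exp_neg_le_quadratic {x : ℝ} (hx : 0 ≤ x) : Real.exp (-x) ≤ 1 - x + x ^ 2 / 2 := by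
  have h := Real.quadratic_le_exp_of_nonneg hx
  have h1 : Real.exp (-x) * Real.exp x = 1 := by rw [← Real.exp_add]; simp
  have h2 : 0 ≤ 1 - x + x ^ 2 / 2 := by nlinarith [sq_nonneg (x - 1)]
  have h3 : 1 ≤ (1 - x + x ^ 2 / 2) * Real.exp x := by
    nlinarith [mul_le_mul_of_nonneg_left h h2, pow_nonneg hx 4]
  exact le_of_mul_le_mul_right (h1.le.trans h3) (Real.exp_pos x)

lemma gaussPdf_le_quartic (t : ℝ) : gaussPdf t ≤ 0.39895 * (1 - t ^ 2 / 2 + t ^ 4 / 8) := by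
  rw [gaussPdf_eq_mul]
  have h1 := exp_neg_le_quadratic (show 0 ≤ t ^ 2 / 2 by positivity)
  have h2 := one_div_sqrt_two_pi_le
  calc _ ≤ 0.39895 * Real.exp (-(t ^ 2 / 2)) := by gcongr; linarith
    _ ≤ 0.39895 * (1 - t ^ 2 / 2 + (t ^ 2 / 2) ^ 2 / 2) := by gcongr
    _ = _ := by ring

lemma gaussPhi_zero : gaussPhi 0 = 1 / 2 := by
  have := gaussPhi_add_gaussQ 0
  rw [gaussQ_zero] at this
  linarith

/-- Integrating a pointwise minorant of the density. -/
lemma le_gaussPhi_of_deriv {f f' : ℝ → ℝ} (hf : ∀ t, HasDerivAt f (f' t) t) (h0 : f 0 = 0) {l : ℝ}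
    (hl : 0 ≤ l) (h : ∀ t, 0 < t → t < l → f' t ≤ gaussPdf t) : 1 / 2 + f l ≤ gaussPhi l := by
  have hd : ∀ t, HasDerivAt (fun t => gaussPhi t - f t) (gaussPdf t - f' t) t :=
    fun t => (hasDerivAt_gaussPhi t).sub (hf t)
  have hm : MonotoneOn (fun t => gaussPhi t - f t) (Icc 0 l) := by
    refine monotoneOn_of_deriv_nonneg (convex_Icc 0 l)
      (fun t _ => (hd t).continuousAt.continuousWithinAt)
      (fun t _ => (hd t).differentiableAt.differentiableWithinAt) fun t ht => ?_
    rw [interior_Icc] at ht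
    rw [(hd t).deriv]
    exact sub_nonneg.2 (h t ht.1 ht.2)
  have := hm (left_mem_Icc.2 hl) (right_mem_Icc.2 hl) hl
  simp only [h0, gaussPhi_zero] at this
  linarith

lemma one_sub_gaussPhi_le_cubic {l : ℝ} (hl : 0 ≤ l) :
    1 - gaussPhi l ≤ 0.5 - 0.39894 * (l - l ^ 3 / 6) := by
  have h := le_gaussPhi_of_deriv (f := fun t => 0.39894 * (t - t ^ 3 / 6))
    (f' := fun t => 0.39894 * (1 - t ^ 2 / 2)) (fun t => by
      have := (((hasDerivAt_id t).sub ((hasDerivAt_pow 3 t).div_const 6)).const_mul 0.39894)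
      convert! this using 1
      norm_num
      ring) (by norm_num) hl fun t _ _ => by
      rw [gaussPdf_eq_mul]
      have h1 := one_div_sqrt_two_pi_ge
      have h2 := Real.add_one_le_exp (-(t ^ 2 / 2))
      calc _ ≤ 0.39894 * Real.exp (-(t ^ 2 / 2)) := by gcongr; linarith
        _ ≤ _ := by gcongr
  linarith

lemma one_sub_gaussPhi_le_quintic {l : ℝ} (hl : 0 ≤ l) (hl1 : l ≤ 1) :
    1 - gaussPhi l ≤ 0.5 - 0.39894 * (l - l ^ 3 / 6 + l ^ 5 / 50) := by
  have h := le_gaussPhi_of_deriv (f := fun t => 0.39894 * (t - t ^ 3 / 6 + t ^ 5 / 50))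
    (f' := fun t => 0.39894 * (1 - t ^ 2 / 2 + t ^ 4 / 10)) (fun t => by
      have := ((((hasDerivAt_id t).sub ((hasDerivAt_pow 3 t).div_const 6)).add
        ((hasDerivAt_pow 5 t).div_const 50)).const_mul 0.39894)
      convert! this using 1
      norm_num
      ring) (by norm_num) hl fun t ht htl => by
      rw [gaussPdf_eq_mul]
      have h1 := one_div_sqrt_two_pi_ge
      have hx0 : 0 < t ^ 2 / 2 := by positivity
      have hx1 : t ^ 2 / 2 ≤ 1 / 2 := by nlinarith
      have h3 : 1 - t ^ 2 / 2 + 0.4 * (t ^ 2 / 2) ^ 2 ≤ Real.exp (-(t ^ 2 / 2)) := by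
        generalize t ^ 2 / 2 = x at hx0 hx1
        have hb := Real.exp_bound (x := -x) (by rw [abs_neg, abs_of_pos hx0]; linarith)
          (n := 4) (by norm_num)
        have hb' := (abs_le.1 hb).1
        rw [abs_neg, abs_of_pos hx0] at hb'
        norm_num [Finset.sum_range_succ, Nat.factorial] at hb'
        nlinarith [mul_nonneg (mul_nonneg hx0.le hx0.le) (sub_nonneg.2 hx1),
          mul_nonneg (mul_nonneg hx0.le (mul_nonneg hx0.le hx0.le)) (sub_nonneg.2 hx1)]
      calc 0.39894 * (1 - t ^ 2 / 2 + t ^ 4 / 10) =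
            0.39894 * (1 - t ^ 2 / 2 + 0.4 * (t ^ 2 / 2) ^ 2) := by ring
        _ ≤ 0.39894 * Real.exp (-(t ^ 2 / 2)) := by gcongr
        _ ≤ _ := by gcongr
  linarith

/-- Mills' inequality. -/
lemma mul_gaussQ_le {l : ℝ} (hl : 0 ≤ l) : l * gaussQ l ≤ gaussPdf l := by
  have hd : ∀ t, HasDerivAt (fun t => -gaussPdf t) (t * gaussPdf t) t := fun t => by
    unfold gaussPdf
    have := (((((hasDerivAt_pow 2 t).neg).div_const 2).exp).div_const √(2 * π)).neg
    convert! this using 1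
    norm_num
    ring
  have ht : Tendsto (fun t => -gaussPdf t) atTop (𝓝 0) := by
    have h1 : Tendsto (fun t : ℝ => Real.exp (-t)) atTop (𝓝 0) :=
      Real.tendsto_exp_neg_atTop_nhds_zero
    have h2 := (h1.comp ((tendsto_pow_atTop (n := 2) (by norm_num)).atTop_div_const
      (show (0 : ℝ) < 2 by norm_num))).const_mul (-(1 / √(2 * π)))
    rw [mul_zero] at h2
    refine h2.congr fun t => ?_
    simp only [Function.comp, gaussPdf_eq_mul]
    ring
  have hi := integrableOn_Ioi_deriv_of_nonneg' (a := l) (fun t _ => hd t)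
    (fun t ht => mul_nonneg (hl.trans (le_of_lt ht)) (gaussPdf_pos t).le) ht
  have he := integral_Ioi_of_hasDerivAt_of_nonneg' (a := l) (fun t _ => hd t)
    (fun t ht => mul_nonneg (hl.trans (le_of_lt ht)) (gaussPdf_pos t).le) ht
  rw [gaussQ, ← integral_const_mul]
  calc _ ≤ ∫ t in Ioi l, t * gaussPdf t := by
        refine integral_mono_of_nonneg (.of_forall fun t => mul_nonneg hl (gaussPdf_pos t).le) hi ?_
        exact (ae_restrict_mem measurableSet_Ioi).mono fun t ht =>
          mul_le_mul_of_nonneg_right (le_of_lt ht) (gaussPdf_pos t).le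
    _ = _ := by rw [he]; ring

lemma gaussPdf_le_tail {l : ℝ} (hl : 1.2 ≤ l) :
    gaussPdf l ≤ 0.2 := by
  rw [gaussPdf_eq_mul]
  have h2 := one_div_sqrt_two_pi_le
  have h3 : Real.exp (-(l ^ 2 / 2)) ≤ 0.49 := by
    have h4 := Real.quadratic_le_exp_of_nonneg (show 0 ≤ l ^ 2 / 2 by positivity)
    have h5 := Real.sum_le_exp_of_nonneg (show (0 : ℝ) ≤ l ^ 2 / 2 by positivity) 4
    norm_num [Finset.sum_range_succ, Nat.factorial] at h5
    have h6 : 0.72 ≤ l ^ 2 / 2 := by nlinarith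
    have h7 : Real.exp (-(l ^ 2 / 2)) * Real.exp (l ^ 2 / 2) = 1 := by rw [← Real.exp_add]; simp
    generalize l ^ 2 / 2 = x at *
    have h8 : 1 / 0.49 ≤ Real.exp x := by
      refine le_trans ?_ h5
      nlinarith [pow_le_pow_left₀ (by norm_num) h6 2, pow_le_pow_left₀ (by norm_num) h6 3]
    have h9 := Real.exp_pos (-x)
    rw [div_le_iff₀ (by norm_num)] at h8
    nlinarith
  have h4 : 0 ≤ Real.exp (-(l ^ 2 / 2)) := (Real.exp_pos _).le
  nlinarith [mul_le_mul h2 h3 h4 (by norm_num : (0:ℝ) ≤ 0.398943)]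

lemma exp_neg_tail_le (l : ℝ) :
    Real.exp (-(l ^ 2 / 2)) * (1 + (l ^ 2 / 2 - 0.845)) ≤ 0.4296 := by
  have h1 : 1 / 0.4296 ≤ Real.exp 0.845 := by
    have h5 := Real.sum_le_exp_of_nonneg (show (0 : ℝ) ≤ 0.845 by norm_num) 8
    refine le_trans ?_ h5
    norm_num [Finset.sum_range_succ, Nat.factorial]
  have h2 := Real.add_one_le_exp (l ^ 2 / 2 - 0.845)
  have h3 : Real.exp (l ^ 2 / 2 - 0.845) * Real.exp 0.845 * Real.exp (-(l ^ 2 / 2)) = 1 := by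
    rw [← Real.exp_add, ← Real.exp_add]; norm_num
  have h4 := Real.exp_pos (-(l ^ 2 / 2))
  have h5 := Real.exp_pos (l ^ 2 / 2 - 0.845)
  have h6 : Real.exp (-(l ^ 2 / 2)) * Real.exp (l ^ 2 / 2 - 0.845) ≤ 0.4296 := by
    rw [div_le_iff₀ (by norm_num)] at h1
    have := mul_le_mul_of_nonneg_left h1 (mul_pos h4 h5).le
    nlinarith
  nlinarith [mul_le_mul_of_nonneg_left h2 h4.le]

lemma gaussPdf_mul_le_tail {l : ℝ} (hl : 1.3 ≤ l) : gaussPdf l * l ≤ 0.223 ∧ gaussPdf l ≤ 0.1717 := by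
  rw [gaussPdf_eq_mul]
  have h2 := one_div_sqrt_two_pi_le
  have h3 := exp_neg_tail_le l
  have h4 := Real.exp_pos (-(l ^ 2 / 2))
  set x := Real.exp (-(l ^ 2 / 2))
  have h5 : x * l ≤ 0.5589 := by
    have : 0.4296 * l ≤ 0.5589 * (1 + (l ^ 2 / 2 - 0.845)) := by nlinarith
    have h6 : 0 < 1 + (l ^ 2 / 2 - 0.845) := by nlinarith
    nlinarith
  have h7 : x ≤ 0.43 := by nlinarith
  have h8 : 0 ≤ x * l := by positivity
  constructor
  · rw [mul_assoc]; nlinarith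
  · nlinarith

lemma exp_le_of_taylor {x y : ℝ} (h0 : 0 ≤ x) (h1 : x ≤ 1)
    (h : 1 + x + x ^ 2 / 2 + x ^ 3 / 6 + x ^ 4 / 24 + x ^ 5 / 120 + x ^ 6 / 617 ≤ y) :
    Real.exp x ≤ y := by
  have hb := Real.exp_bound' h0 h1 (n := 6) (by norm_num)
  norm_num [Finset.sum_range_succ, Nat.factorial] at hb
  refine hb.trans (le_trans ?_ h)
  nlinarith [pow_nonneg h0 6]

lemma quadCrit_mono {p p' ε ε' l w E E' D d r : ℝ} (hD : 0 ≤ D) (hd : 0 ≤ d) (hE : 0 ≤ E)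
    (hp0 : 0 ≤ p) (hp : p ≤ p') (he : ε ≤ ε') (hE' : E ≤ E') :
    quadCrit p ε l w E D d r ≤ quadCrit p' ε' l w E' D d r := by
  have : 0 ≤ p' := hp0.trans hp
  unfold quadCrit
  gcongr

lemma quintic_terms_nonneg {a b l : ℝ} (ha : a ≤ l) (hb : l ≤ b) :
    0 ≤ (l - a) ^ 5 ∧ 0 ≤ (l - a) ^ 4 * (b - l) ∧ 0 ≤ (l - a) ^ 3 * (b - l) ^ 2 ∧
      0 ≤ (l - a) ^ 2 * (b - l) ^ 3 ∧ 0 ≤ (l - a) * (b - l) ^ 4 ∧ 0 ≤ (b - l) ^ 5 := by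
  have h1 : 0 ≤ l - a := by linarith
  have h2 : 0 ≤ b - l := by linarith
  refine ⟨?_, ?_, ?_, ?_, ?_, ?_⟩ <;> positivity

/-- Admissibility of the second-moment criterion over a range of shifts. -/
def CritHolds (l δ r : ℝ) : Prop :=
  ∃ w D : ℝ, 0 < D ∧ quadCrit (gaussPdf l) (1 - gaussPhi l) l w (Real.exp (-w)) D δ r < 1

lemma critHolds_of_corners {l δ r p ε w E D lo hi : ℝ} (hp : gaussPdf l ≤ p)
    (he : 1 - gaussPhi l ≤ ε) (hE : Real.exp (-w) ≤ E) (hD : 0 < D) (hlo : 0 ≤ lo)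
    (h0 : lo ≤ δ) (h1 : δ ≤ hi) (r0 : 0 ≤ r) (r1 : r ≤ 1 / 0.78)
    (hl0 : quadCrit p ε l w E D lo 0 < 1) (hl1 : quadCrit p ε l w E D lo (1 / 0.78) < 1)
    (hh0 : quadCrit p ε l w E D hi 0 < 1) (hh1 : quadCrit p ε l w E D hi (1 / 0.78) < 1) :
    CritHolds l δ r :=
  ⟨w, D, hD, (quadCrit_mono hD.le (hlo.trans h0) (Real.exp_pos _).le (gaussPdf_pos l).le hp he
    hE).trans_lt (quadCrit_lt hD h0 h1 r0 r1 hl0 hl1 hh0 hh1)⟩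

lemma critHolds_all_small {l δ r : ℝ} (ha : 0 ≤ l) (hb : l ≤ 0.36) (h0 : 0 ≤ δ)
    (h1 : δ ≤ 2 * l) (r0 : 0 ≤ r) (r1 : r ≤ 1 / 0.78) : CritHolds l δ r := by
  obtain ⟨k0, k1, k2, k3, k4, k5⟩ := quintic_terms_nonneg ha hb
  have hE : Real.exp (-(-0.7)) ≤ 2.0138 := by
    rw [neg_neg]
    exact exp_le_of_taylor (by norm_num) (by norm_num) (by norm_num)
  refine critHolds_of_corners (lo := 0) (D := 1.3) (gaussPdf_le_quartic l)
    (one_sub_gaussPhi_le_cubic (by linarith)) hE (by norm_num) (by linarith) h0 h1 r0 r1 ?_ ?_ ?_ ?_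
  all_goals
    unfold quadCrit
    norm_num
    linarith

lemma critHolds_all_middle {l δ r : ℝ} (ha : 0.36 ≤ l) (hb : l ≤ 0.42) (h0 : 0 ≤ δ)
    (h1 : δ ≤ 2 * l) (r0 : 0 ≤ r) (r1 : r ≤ 1 / 0.78) : CritHolds l δ r := by
  obtain ⟨k0, k1, k2, k3, k4, k5⟩ := quintic_terms_nonneg ha hb
  have hE : Real.exp (-(-0.65)) ≤ 1.9156 := by
    rw [neg_neg]
    exact exp_le_of_taylor (by norm_num) (by norm_num) (by norm_num)
  refine critHolds_of_corners (lo := 0) (D := 1.2) (gaussPdf_le_quartic l)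
    (one_sub_gaussPhi_le_cubic (by linarith)) hE (by norm_num) (by linarith) h0 h1 r0 r1 ?_ ?_ ?_ ?_
  all_goals
    unfold quadCrit
    norm_num
    linarith

lemma critHolds_large_shift_one {l δ r : ℝ} (ha : 0.4 ≤ l) (hb : l ≤ 0.56) (h0 : l ≤ δ)
    (h1 : δ ≤ 2 * l) (r0 : 0 ≤ r) (r1 : r ≤ 1 / 0.78) : CritHolds l δ r := by
  obtain ⟨k0, k1, k2, k3, k4, k5⟩ := quintic_terms_nonneg ha hb
  have hE : Real.exp (-(-0.5)) ≤ 1.6488 := by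
    rw [neg_neg]
    exact exp_le_of_taylor (by norm_num) (by norm_num) (by norm_num)
  refine critHolds_of_corners (lo := l) (D := 1.04) (gaussPdf_le_quartic l)
    (one_sub_gaussPhi_le_quintic (by linarith) (by linarith)) hE (by norm_num) (by linarith) h0 h1 r0 r1 ?_ ?_ ?_ ?_
  all_goals
    unfold quadCrit
    norm_num
    linarith

lemma critHolds_large_shift_two {l δ r : ℝ} (ha : 0.56 ≤ l) (hb : l ≤ 0.67) (h0 : l ≤ δ)
    (h1 : δ ≤ 2 * l) (r0 : 0 ≤ r) (r1 : r ≤ 1 / 0.78) : CritHolds l δ r := by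
  obtain ⟨k0, k1, k2, k3, k4, k5⟩ := quintic_terms_nonneg ha hb
  have hE : Real.exp (-(-0.44)) ≤ 1.5528 := by
    rw [neg_neg]
    exact exp_le_of_taylor (by norm_num) (by norm_num) (by norm_num)
  refine critHolds_of_corners (lo := l) (D := 0.98) (gaussPdf_le_quartic l)
    (one_sub_gaussPhi_le_quintic (by linarith) (by linarith)) hE (by norm_num) (by linarith) h0 h1 r0 r1 ?_ ?_ ?_ ?_
  all_goals
    unfold quadCrit
    norm_num
    linarith

lemma critHolds_large_shift_three {l δ r : ℝ} (ha : 0.67 ≤ l) (hb : l ≤ 1) (h0 : l ≤ δ)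
    (h1 : δ ≤ 2 * l) (r0 : 0 ≤ r) (r1 : r ≤ 1 / 0.78) : CritHolds l δ r := by
  obtain ⟨k0, k1, k2, k3, k4, k5⟩ := quintic_terms_nonneg ha hb
  have hE : Real.exp (-(-0.4)) ≤ 1.4919 := by
    rw [neg_neg]
    exact exp_le_of_taylor (by norm_num) (by norm_num) (by norm_num)
  refine critHolds_of_corners (lo := l) (D := 0.96) (gaussPdf_le_quartic l)
    (one_sub_gaussPhi_le_quintic (by linarith) (by linarith)) hE (by norm_num) (by linarith) h0 h1 r0 r1 ?_ ?_ ?_ ?_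
  all_goals
    unfold quadCrit
    norm_num
    linarith

lemma critHolds_large_shift_four {l δ r : ℝ} (ha : 1 ≤ l) (hb : l ≤ 1.3) (h0 : l ≤ δ)
    (h1 : δ ≤ 2 * l) (r0 : 0 ≤ r) (r1 : r ≤ 1 / 0.78) : CritHolds l δ r := by
  obtain ⟨k0, k1, k2, k3, k4, k5⟩ := quintic_terms_nonneg ha hb
  have hE : Real.exp (-(-0.3)) ≤ 1.3499 := by
    rw [neg_neg]
    exact exp_le_of_taylor (by norm_num) (by norm_num) (by norm_num)
  refine critHolds_of_corners (lo := l) (D := 1) (gaussPdf_le_quartic l)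
    (one_sub_gaussPhi_le_cubic (by linarith)) hE (by norm_num) (by linarith) h0 h1 r0 r1 ?_ ?_ ?_ ?_
  all_goals
    unfold quadCrit
    norm_num
    linarith

lemma critHolds_small_shift {l δ r : ℝ} (ha : 0.4 ≤ l) (hb : l ≤ 1.2) (h0 : 0 ≤ δ)
    (h1 : δ ≤ l) (r0 : 0 ≤ r) (r1 : r ≤ 1 / 0.78) : CritHolds l δ r := by
  obtain ⟨k0, k1, k2, k3, k4, k5⟩ := quintic_terms_nonneg ha hb
  have hE : Real.exp (-(-1.2)) ≤ 3.3203 := by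
    have h := exp_le_of_taylor (x := 0.6) (y := 1.82214) (by norm_num) (by norm_num) (by norm_num)
    have e : Real.exp (-(-1.2)) = Real.exp 0.6 * Real.exp 0.6 := by
      rw [← Real.exp_add]; norm_num
    rw [e]
    nlinarith [Real.exp_pos 0.6]
  refine critHolds_of_corners (lo := 0) (D := 1.7) (gaussPdf_le_quartic l)
    (one_sub_gaussPhi_le_cubic (by linarith)) hE (by norm_num) (by linarith) h0 h1 r0 r1 ?_ ?_ ?_ ?_
  all_goals
    unfold quadCrit
    norm_num
    linarith

lemma gaussPdf_mul_exp_le (l : ℝ) :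
    gaussPdf l * Real.exp (l / 0.78) * (1 + (l - 1 / 0.78) ^ 2 / 2) ≤ 0.9077 := by
  rw [gaussPdf_eq_mul]
  have h1 := one_div_sqrt_two_pi_le
  have h2 := Real.add_one_le_exp ((l - 1 / 0.78) ^ 2 / 2)
  have h3 : Real.exp (-(l ^ 2 / 2)) * Real.exp (l / 0.78) * Real.exp ((l - 1 / 0.78) ^ 2 / 2) =
      Real.exp ((1 / 0.78) ^ 2 / 2) := by
    rw [← Real.exp_add, ← Real.exp_add]
    congr 1
    ring
  have h4 : Real.exp ((1 / 0.78) ^ 2 / 2) ≤ 2.2751 :=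
    exp_le_of_taylor (by norm_num) (by norm_num) (by norm_num)
  have h5 : Real.exp (-(l ^ 2 / 2)) * Real.exp (l / 0.78) * (1 + (l - 1 / 0.78) ^ 2 / 2) ≤
      2.2751 := by
    refine le_trans ?_ h4
    rw [← h3]
    gcongr
    linarith
  have h6 : 0 ≤ Real.exp (-(l ^ 2 / 2)) * Real.exp (l / 0.78) * (1 + (l - 1 / 0.78) ^ 2 / 2) := by
    positivity
  nlinarith [mul_le_mul h1 h5 h6 (by norm_num)]

lemma critHolds_tail_small_shift {l δ r : ℝ} (hl : 1.2 ≤ l) (h0 : 0 ≤ δ)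
    (h1 : δ ≤ l) (r0 : 0 ≤ r) (r1 : r ≤ 1 / 0.78) : CritHolds l δ r := by
  have hl0 : 0 < l := by linarith
  have hD : 0 < 2 * l := by positivity
  have hφ := gaussPdf_le_tail hl
  have hQ := mul_gaussQ_le hl0.le
  rw [gaussQ_eq] at hQ
  have hpE := gaussPdf_mul_exp_le l
  have hε : 1 - gaussPhi l ≤ 0.167 := by nlinarith
  have hp0 := gaussPdf_pos l
  refine ⟨-(l / 0.78), 2 * l, hD, ?_⟩
  rw [neg_neg]
  set ε := 1 - gaussPhi l
  have hs : ε * (2 * l) + ε ≤ 0.567 := by linarith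
  have hi : 1 / l ≤ 1 / 1.2 := one_div_le_one_div_of_le (by norm_num) hl
  have hpEl : 4 / 3 * gaussPdf l * l * Real.exp (l / 0.78) ≤ 1.0765 * l + 0.2 := by
    have h2 : 0 < 1 + (l - 1 / 0.78) ^ 2 / 2 := by positivity
    have h3 : 4 / 3 * 0.9077 * l ≤ (1.0765 * l + 0.2) * (1 + (l - 1 / 0.78) ^ 2 / 2) := by
      norm_num
      nlinarith [mul_nonneg (sub_nonneg.2 hl) (sq_nonneg (l - 50 / 39)), sq_nonneg (l - 1.4)]
    refine le_of_mul_le_mul_right ?_ h2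
    nlinarith [mul_le_mul_of_nonneg_right hpE hl0.le]
  refine quadCrit_lt hD h0 h1 r0 r1 ?_ ?_ ?_ ?_
  · have e : quadCrit (gaussPdf l) ε l (-(l / 0.78)) (Real.exp (l / 0.78)) (2 * l) 0 0 =
      -(l / 0.78) + l * ((1 / 0.78) ^ 2 / 8) + (ε * (2 * l) + ε) := by
      unfold quadCrit; field_simp; ring
    rw [e]
    norm_num
    linarith
  · have e : quadCrit (gaussPdf l) ε l (-(l / 0.78)) (Real.exp (l / 0.78)) (2 * l) 0 (1 / 0.78) =
      (1 / l) * ((1 / 0.78) ^ 2 / 8) + (ε * (2 * l) + ε) := by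
      unfold quadCrit; field_simp; ring
    rw [e]
    norm_num at hi ⊢
    linarith
  · have e : quadCrit (gaussPdf l) ε l (-(l / 0.78)) (Real.exp (l / 0.78)) (2 * l) l 0 =
      4 / 3 * gaussPdf l * l * Real.exp (l / 0.78) - l / 0.78 + l * ((1 / 0.78) ^ 2 / 8) +
        (ε * (2 * l) + ε) := by
      unfold quadCrit; field_simp; ring
    rw [e]
    norm_num at hpEl ⊢
    linarith
  · have e : quadCrit (gaussPdf l) ε l (-(l / 0.78)) (Real.exp (l / 0.78)) (2 * l) l (1 / 0.78) =
      4 / 3 * gaussPdf l * l * Real.exp (l / 0.78) - l / 0.78 +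
        (l + 1 / l) * ((1 / 0.78) ^ 2 / 8) + (ε * (2 * l) + ε) := by
      unfold quadCrit; field_simp; ring
    rw [e]
    norm_num at hpEl hi ⊢
    linarith

lemma critHolds_tail_large_shift {l δ r : ℝ} (hl : 1.3 ≤ l) (h0 : l ≤ δ)
    (h1 : δ ≤ 2 * l) (r0 : 0 ≤ r) (r1 : r ≤ 1 / 0.78) : CritHolds l δ r := by
  have hl0 : 0 < l := by linarith
  obtain ⟨hφl, hφ⟩ := gaussPdf_mul_le_tail hl
  have hQ := mul_gaussQ_le hl0.le
  rw [gaussQ_eq] at hQ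
  have hε : 1 - gaussPhi l ≤ 0.1321 := by nlinarith
  have hE : Real.exp (-(-0.2)) ≤ 1.2215 := by
    rw [neg_neg]
    exact exp_le_of_taylor (by norm_num) (by norm_num) (by norm_num)
  refine ⟨-0.2, l, hl0, ?_⟩
  set ε := 1 - gaussPhi l
  set E := Real.exp (-(-0.2))
  have hp0 := gaussPdf_pos l
  have hs : ε * l + ε ≤ 0.3038 := by linarith
  have hi : 1 / l ≤ 1 / 1.3 := one_div_le_one_div_of_le (by norm_num) hl
  have hpE : 4 / 3 * (gaussPdf l * l) * E ≤ 0.3633 := by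
    have : gaussPdf l * l * E ≤ 0.223 * 1.2215 := mul_le_mul hφl hE (Real.exp_pos _).le (by norm_num)
    linarith
  refine quadCrit_lt hl0 h0 h1 r0 r1 ?_ ?_ ?_ ?_
  · have e : quadCrit (gaussPdf l) ε l (-0.2) E l l 0 =
      4 / 3 * (gaussPdf l * l) * E - 0.2 + 0.01 * (1 / l) + (ε * l + ε) := by
      unfold quadCrit; field_simp; ring
    rw [e]
    norm_num at hi ⊢
    linarith
  · have e : quadCrit (gaussPdf l) ε l (-0.2) E l l (1 / 0.78) =
      4 / 3 * (gaussPdf l * l) * E - 0.2 + (0.01 + (1 / 0.78) ^ 2 / 4) * (1 / l) +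
        (ε * l + ε) := by
      unfold quadCrit; field_simp; ring
    rw [e]
    norm_num at hi ⊢
    linarith
  · have e : quadCrit (gaussPdf l) ε l (-0.2) E l (2 * l) 0 =
      2 * (4 / 3 * (gaussPdf l * l) * E) - 0.2 + 0.01 * (1 / l) + (ε * l + ε) := by
      unfold quadCrit; field_simp; ring
    rw [e]
    norm_num at hi hpE ⊢
    linarith
  · have e : quadCrit (gaussPdf l) ε l (-0.2) E l (2 * l) (1 / 0.78) =
      2 * (4 / 3 * (gaussPdf l * l) * E) - 0.2 - l / 0.78 + l * ((1 / 0.78) ^ 2 / 4) +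
        0.1 / 0.78 + (0.01 + (1 / 0.78) ^ 2 / 4) * (1 / l) + (ε * l + ε) := by
      unfold quadCrit; field_simp; ring
    rw [e]
    norm_num at hi hpE ⊢
    linarith

lemma critHolds {l δ r : ℝ} (hl : 0 < l) (h0 : 0 ≤ δ) (h1 : δ ≤ 2 * l) (r0 : 0 ≤ r)
    (r1 : r ≤ 1 / 0.78) : CritHolds l δ r := by
  rcases le_total l 0.36 with a | a
  · exact critHolds_all_small hl.le a h0 h1 r0 r1
  rcases le_total l 0.42 with b | b
  · exact critHolds_all_middle a b h0 h1 r0 r1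
  have b' : 0.4 ≤ l := by linarith
  rcases le_total δ l with c | c
  · rcases le_total l 1.2 with d | d
    · exact critHolds_small_shift b' d h0 c r0 r1
    · exact critHolds_tail_small_shift d h0 c r0 r1
  · rcases le_total l 0.56 with d | d
    · exact critHolds_large_shift_one b' d c h1 r0 r1
    rcases le_total l 0.67 with e | e
    · exact critHolds_large_shift_two d e c h1 r0 r1
    rcases le_total l 1 with f | f
    · exact critHolds_large_shift_three e f c h1 r0 r1
    rcases le_total l 1.3 with g | g
    · exact critHolds_large_shift_four f g c h1 r0 r1
    · exact critHolds_tail_large_shift g c h1 r0 r1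

section
variable {α : Type*} [Fintype α] {P v : α → ℝ}

lemma averaged_lt_of_le_scale (h : Standardized P v) {n : ℕ} (hn : 0 < n) {l δ m : ℝ}
    (hd : 0 < δ) (hl : δ < 2 * l) (hm1 : 0.78 ≤ m)
    (hδ : √n * (gaussPdf l * δ) = 1 + (∑ a, P a * |v a| ^ 3) / 2) :
    ∃ x, 2 / √n * Real.exp ((l - δ - x) / m) + ∑ z : Fin n → α, (∏ i, P (z i)) *
      max 0 (1 - Real.exp (-((x - (∑ i, v (z i)) / √n) / m))) < gaussPhi l := by
  have hm : 0 < m := by linarith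
  have hq : 0 < √(n : ℝ) := sqrt_pos.2 (by exact_mod_cast hn)
  obtain ⟨w, D, hD, hc⟩ := critHolds (l := l) (by linarith) hd.le hl.le
    (show 0 ≤ 1 / m by positivity) (one_div_le_one_div_of_le (by norm_num) hm1)
  have hs : 2 / √n ≤ 4 / 3 * gaussPdf l * δ := by
    rw [div_le_iff₀ hq]
    have := h.one_le_third
    linarith
  obtain ⟨x, hx⟩ := averaged_lt_of_quadratic h hn (y := l - δ) (w := w) (D := D)
    (ε := 1 - gaussPhi l) hm hD (by
      unfold quadCrit at hc
      have := mul_le_mul_of_nonneg_right hs (Real.exp_pos (-w)).le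
      linarith)
  exact ⟨x, by linarith⟩

end

end

/-- Non-asymptotic converse (Gaussian approximation) for memoryless sources:
for all `0 < ε < 1/2` and all
`n > n₀ = (1/4)(1 + μ₃/(2σ³))²/(φ(Q⁻¹(ε))Q⁻¹(ε))²`,
`R*(n,ε) ≥ H + (σ/√n)Q⁻¹(ε) − (log₂ n)/(2n) − (μ₃/2 + σ³)/(nσ²φ(Q⁻¹(ε)))`,
provided `σ² > 0`. -/
theorem memoryless_converse
    {𝒜 : Type*} [Fintype 𝒜] (P : 𝒜 → ℝ)
    (hP0 : ∀ a, 0 ≤ P a) (hP1 : ∑ a, P a = 1)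
    (hvar : 0 < varent P)
    (ε : ℝ) (hε0 : 0 < ε) (hε : ε < 1 / 2)
    (n : ℕ)
    (hn : (1 / 4) * (1 + mu3 P / (2 * Real.sqrt (varent P) ^ 3)) ^ 2
        / (gaussPdf (gaussQinv ε) * gaussQinv ε) ^ 2 < (n : ℝ)) :
    entBits P + Real.sqrt (varent P) / Real.sqrt n * gaussQinv ε
        - Real.logb 2 n / (2 * n)
        - (mu3 P / 2 + Real.sqrt (varent P) ^ 3)
            / (n * varent P * gaussPdf (gaussQinv ε)) ≤
      RStar (iidPn P n) n ε := by
  have hσ : 0 < √(varent P) := Real.sqrt_pos.2 hvar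
  have hl := gaussQinv_pos hε0 hε
  have hφ := gaussPdf_pos (gaussQinv ε)
  have hΦ := gaussPhi_gaussQinv hε0 hε
  have hS := standardized_stdInfo hP0 hP1 hvar
  have hT := hS.one_le_third
  have hn0 : (0 : ℝ) < n := lt_of_le_of_lt (by positivity) hn
  have hn' : 0 < n := by exact_mod_cast hn0
  have hq : 0 < √(n : ℝ) := Real.sqrt_pos.2 hn0
  have hss : √(n : ℝ) * √n = n := Real.mul_self_sqrt hn0.le
  have hvv : √(varent P) * √(varent P) = varent P := Real.mul_self_sqrt hvar.le
  have hm : 0 < 1 / (√(varent P) * √n * Real.log 2) := by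
    have := Real.log_pos one_lt_two
    positivity
  set l := gaussQinv ε
  set T := mu3 P / √(varent P) ^ 3 with hT'
  have hT1 : 1 ≤ T := by rw [hT', ← third_stdInfo]; exact hT
  set δ := (1 + T / 2) / (√n * gaussPdf l) with hδ
  have hd : 0 < δ := by positivity
  have hdl : δ < 2 * l := by
    have e : (1 / 4 : ℝ) * (1 + mu3 P / (2 * √(varent P) ^ 3)) ^ 2 / (gaussPdf l * l) ^ 2 =
        ((1 + T / 2) / (2 * (gaussPdf l * l))) ^ 2 := by
      rw [hT']
      field_simp
      ring
    rw [e, ← Real.sq_sqrt hn0.le] at hn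
    have h1 := lt_of_pow_lt_pow_left₀ 2 hq.le hn
    rw [div_lt_iff₀ (by positivity)] at h1
    rw [hδ, div_lt_iff₀ (by positivity)]
    linarith
  have hδ' : √n * (gaussPdf l * δ) = 1 + (∑ a, P a * |stdInfo P a| ^ 3) / 2 := by
    rw [third_stdInfo, ← hT', hδ]
    field_simp
  obtain ⟨x, hx⟩ : ∃ x, 2 / √n * Real.exp ((l - δ - x) / (1 / (√(varent P) * √n * Real.log 2))) +
      ∑ z : Fin n → 𝒜, (∏ i, P (z i)) * max 0 (1 - Real.exp (-((x - (∑ i, stdInfo P (z i)) / √n) /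
        (1 / (√(varent P) * √n * Real.log 2))))) < 1 - ε := by
    rw [← hΦ]
    rcases le_total (1 / (√(varent P) * √n * Real.log 2)) 0.78 with h | h
    · exact averaged_lt_of_scale_le hS hn' hd hdl hm h hδ'
    · exact averaged_lt_of_le_scale hS hn' hd hdl h hδ'
  refine rate_le_RStar hP0 hP1 hvar hε0.le hn' (y := l - δ) (x := x) ?_ hx
  rw [hδ, hT']
  clear_value l
  clear hx hδ' hdl hd hδ δ hT1 hT' T hm hn hn'
  generalize √(n : ℝ) = q at *
  generalize √(varent P) = s at *
  rw [← hvv, ← hss]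
  field_simp
  ring
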